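/- arXiv:1705.05292 — 2 statements merged into one kernel-verified Lean document; each statement's English description precedes it below -/
import Mathlib

section
/- Let (X,T) be a TDS, μ ∈ M_T(X), U a cover of X and β a partition of X. Let D be the σ-algebra of T-invariant Borel sets and let y ↦ μ_y (over the associated factor space (Y,ν), ν = μ restricted to D) be the disintegration of μ over D, so that μ = ∫_Y μ_y dν(y) and μ_y is ergodic and T-invariant for ν-almost every y. Then h^+_μ(U|β,T) = ∫_Y h^+_{μ_y}(U|β,T) dν(y) and h^-_μ(U|β,T) = ∫_Y h^-_{μ_y}(U|β,T) dν(y). -/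
open MeasureTheory Real Filter

namespace Paper

variable {X : Type*} [MeasurableSpace X]

/-- `𝒰` is a finite cover of `X` (a finite family of sets whose union is `X`). -/
def IsCover (𝒰 : Finset (Set X)) : Prop :=
  ⋃₀ (𝒰 : Set (Set X)) = Set.univ

/-- `𝒰` is a partition of `X`: a cover by pairwise disjoint sets. -/
def IsPartition (𝒰 : Finset (Set X)) : Prop :=
  IsCover 𝒰 ∧ ∀ A ∈ 𝒰, ∀ B ∈ 𝒰, A ≠ B → Disjoint A B

/-- All members of `𝒰` are measurable (Borel) sets. -/
def MeasF (𝒰 : Finset (Set X)) : Prop := ∀ A ∈ 𝒰, MeasurableSet A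

/-- `𝒰 ≽ 𝒱` : every element of `𝒰` is contained in some element of `𝒱`. -/
def Refines (𝒰 𝒱 : Finset (Set X)) : Prop := ∀ A ∈ 𝒰, ∃ B ∈ 𝒱, A ⊆ B

/-- The join `𝒰 ∨ 𝒱 = {U ∩ V : U ∈ 𝒰, V ∈ 𝒱}`. -/
noncomputable def join (𝒰 𝒱 : Finset (Set X)) : Finset (Set X) :=
  letI := Classical.decEq (Set X)
  (𝒰 ×ˢ 𝒱).image fun p => p.1 ∩ p.2

/-- The preimage cover `f⁻¹𝒰 = {f⁻¹U : U ∈ 𝒰}`. -/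
noncomputable def pre {Y : Type*} (f : X → Y) (𝒰 : Finset (Set Y)) : Finset (Set X) :=
  letI := Classical.decEq (Set X)
  𝒰.image fun U => f ⁻¹' U

/-- `dynJoin f 𝒰 N = 𝒰_0^{N-1} = ⋁_{n=0}^{N-1} f^{-n} 𝒰` (equal to `{univ}` for `N = 0`). -/
noncomputable def dynJoin (f : X → X) (𝒰 : Finset (Set X)) : ℕ → Finset (Set X)
  | 0 => {Set.univ}
  | (N + 1) => join (dynJoin f 𝒰 N) (pre (f^[N]) 𝒰)

/-- `N(𝒰 ∩ B)`: the minimal cardinality of a subfamily of `𝒰` whose union contains `B`. -/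
noncomputable def covNum (𝒰 : Finset (Set X)) (B : Set X) : ℕ :=
  sInf {k : ℕ | ∃ 𝒱 ⊆ 𝒰, 𝒱.card = k ∧ B ⊆ ⋃₀ (𝒱 : Set (Set X))}

/-- `N(𝒰|β) = max_{B ∈ β} N(𝒰 ∩ B)`. -/
noncomputable def covNumCond (𝒰 β : Finset (Set X)) : ℕ :=
  β.sup fun B => covNum 𝒰 B

/-- The entropy `H_μ(α) = -∑_{A ∈ α} μ(A) log μ(A)` of a finite family of sets. -/
noncomputable def entPart (μ : Measure X) (α : Finset (Set X)) : ℝ :=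
  ∑ A ∈ α, negMulLog (μ A).toReal

/-- Conditional entropy `H_μ(α|β) = ∑_{B ∈ β} μ(B) H_{μ_B}(α)`, where `μ_B` is the
conditional measure (which is `0` when `μ(B) = 0`). -/
noncomputable def entCondPart (μ : Measure X) (α β : Finset (Set X)) : ℝ :=
  ∑ B ∈ β, (μ B).toReal * entPart (ProbabilityTheory.cond μ B) α

/-- `H_μ(𝒰) = inf { H_μ(α) : α a measurable partition finer than 𝒰 }`. -/
noncomputable def covEnt (μ : Measure X) (𝒰 : Finset (Set X)) : ℝ :=
  sInf {h : ℝ | ∃ α : Finset (Set X),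
    IsPartition α ∧ MeasF α ∧ Refines α 𝒰 ∧ h = entPart μ α}

/-- `H_μ(𝒰|β) = ∑_{B ∈ β} μ(B) H_{μ_B}(𝒰)` for a cover `𝒰` and a partition `β`. -/
noncomputable def covEntCond (μ : Measure X) (𝒰 β : Finset (Set X)) : ℝ :=
  ∑ B ∈ β, (μ B).toReal * covEnt (ProbabilityTheory.cond μ B) 𝒰

/-- `h_μ(α|β,f) = lim_N (1/N) H_μ(α_0^{N-1}|β_0^{N-1})`; by subadditivity the limit
equals the infimum. -/
noncomputable def hPart (f : X → X) (μ : Measure X) (α β : Finset (Set X)) : ℝ :=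
  ⨅ N : ℕ, entCondPart μ (dynJoin f α (N + 1)) (dynJoin f β (N + 1)) / (N + 1 : ℝ)

/-- `h_μ^-(𝒰|β,f) = lim_N (1/N) H_μ(𝒰_0^{N-1}|β_0^{N-1})`; by subadditivity the limit
equals the infimum. -/
noncomputable def hMinus (f : X → X) (μ : Measure X) (𝒰 β : Finset (Set X)) : ℝ :=
  ⨅ N : ℕ, covEntCond μ (dynJoin f 𝒰 (N + 1)) (dynJoin f β (N + 1)) / (N + 1 : ℝ)

/-- `h_μ^+(𝒰|β,f) = inf { h_μ(α|β,f) : α a measurable partition finer than 𝒰 }`. -/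
noncomputable def hPlus (f : X → X) (μ : Measure X) (𝒰 β : Finset (Set X)) : ℝ :=
  sInf {h : ℝ | ∃ α : Finset (Set X),
    IsPartition α ∧ MeasF α ∧ Refines α 𝒰 ∧ h = hPart f μ α β}

/-- The (combinatorial/topological) conditional entropy
`h(𝒰|β,f) = lim_N (1/N) log N(𝒰_0^{N-1}|β_0^{N-1})`; by subadditivity the limit
equals the infimum. -/
noncomputable def hTop (f : X → X) (𝒰 β : Finset (Set X)) : ℝ :=
  ⨅ N : ℕ, Real.log (covNumCond (dynJoin f 𝒰 (N + 1)) (dynJoin f β (N + 1))) / (N + 1 : ℝ)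

/-- The finite family of sets associated to an indexed cover `{U_1, …, U_M}`. -/
noncomputable def rangeFinset {M : ℕ} (U : Fin M → Set X) : Finset (Set X) :=
  letI := Classical.decEq (Set X)
  Finset.image U Finset.univ

end Paper

namespace Paper

open MeasureTheory Real Filter Topology
open scoped ENNReal

set_option linter.unusedSectionVars false

section Entropy

variable {X : Type*} [MeasurableSpace X] {μ : Measure X}
variable {ι κ τ : Type*} [Fintype ι] [Fintype κ] [Fintype τ]
  [MeasurableSpace ι] [MeasurableSpace κ] [MeasurableSpace τ]
  [MeasurableSingletonClass ι] [MeasurableSingletonClass κ] [MeasurableSingletonClass τ]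

/-- The entropy of the partition of `X` into the fibres of a map to a finite type. -/
noncomputable def fibEnt (μ : Measure X) (g : X → ι) : ℝ :=
  ∑ i, negMulLog (μ.real (g ⁻¹' {i}))

/-- The conditional entropy of the fibres of `a` given the fibres of `b`. -/
noncomputable def fibCondEnt (μ : Measure X) (a : X → ι) (b : X → κ) : ℝ :=
  fibEnt μ (fun x => (a x, b x)) - fibEnt μ b

lemma negMulLog_sum_le {s : Finset ι} {p : ι → ℝ} (hp : ∀ i, 0 ≤ p i) :
    negMulLog (∑ i ∈ s, p i) ≤ ∑ i ∈ s, negMulLog (p i) := by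
  simp only [negMulLog, neg_mul, Finset.sum_neg_distrib, neg_le_neg_iff, Finset.sum_mul]
  refine Finset.sum_le_sum fun i hi => ?_
  rcases (hp i).eq_or_lt with h | h
  · simp [← h]
  · exact mul_le_mul_of_nonneg_left
      (log_le_log h (Finset.single_le_sum (fun j _ => hp j) hi)) h.le

lemma real_preimage_comp [IsFiniteMeasure μ] {g : X → ι} (hg : Measurable g) (φ : ι → κ)
    [DecidableEq κ] (k : κ) :
    μ.real ((fun x => φ (g x)) ⁻¹' {k}) = ∑ i with φ i = k, μ.real (g ⁻¹' {i}) := by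
  rw [← measureReal_biUnion_finset]
  · congr 1
    ext x
    simp
  · intro i _ j _ hij
    exact Disjoint.preimage g (by simpa using hij)
  · exact fun i _ => hg (measurableSet_singleton i)

lemma fibEnt_comp_le [IsFiniteMeasure μ] {g : X → ι} (hg : Measurable g) (φ : ι → κ) :
    fibEnt μ (fun x => φ (g x)) ≤ fibEnt μ g := by
  classical
  unfold fibEnt
  rw [← Finset.sum_fiberwise (s := Finset.univ) (g := φ)]
  refine Finset.sum_le_sum fun k _ => ?_
  rw [real_preimage_comp hg]
  exact negMulLog_sum_le fun i => measureReal_nonneg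

/-- `g` is a function of `g'`. -/
lemma fibEnt_le_of_factors [IsFiniteMeasure μ] {g : X → ι} {g' : X → κ} (hg' : Measurable g')
    (h : ∀ x y, g' x = g' y → g x = g y) : fibEnt μ g ≤ fibEnt μ g' := by
  rcases isEmpty_or_nonempty X with hX | hX
  · have h1 : ∀ s : Set X, s = ∅ := fun s => Set.eq_empty_of_isEmpty s
    simp [fibEnt, h1]
  have : Nonempty ι := hX.map g
  have hfac : Function.FactorsThrough g g' := fun x y hxy => h x y hxy
  obtain ⟨φ, hφ⟩ := (Function.factorsThrough_iff g).1 hfac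
  rw [hφ]
  exact fibEnt_comp_le hg' φ

lemma fibEnt_congr [IsFiniteMeasure μ] {g : X → ι} {g' : X → κ} (hg : Measurable g)
    (hg' : Measurable g') (h : ∀ x y, g x = g y ↔ g' x = g' y) : fibEnt μ g = fibEnt μ g' :=
  le_antisymm (fibEnt_le_of_factors hg' fun x y => (h x y).2)
    (fibEnt_le_of_factors hg fun x y => (h x y).1)

lemma fibEnt_congr_ae {g g' : X → ι} (h : g =ᵐ[μ] g') : fibEnt μ g = fibEnt μ g' := by
  unfold fibEnt
  refine Finset.sum_congr rfl fun i _ => ?_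
  rw [measureReal_congr]
  filter_upwards [h] with x hx
  exact congrArg (· = i) hx

lemma fibEnt_comp_preserving {f : X → X} (hf : MeasurePreserving f μ μ) {g : X → ι}
    (hg : Measurable g) : fibEnt μ (fun x => g (f x)) = fibEnt μ g := by
  unfold fibEnt
  refine Finset.sum_congr rfl fun i _ => ?_
  rw [← hf.measureReal_preimage (hg (measurableSet_singleton i)).nullMeasurableSet]
  rfl

lemma fibEnt_nonneg [IsZeroOrProbabilityMeasure μ] (g : X → ι) : 0 ≤ fibEnt μ g :=
  Finset.sum_nonneg fun _ _ => negMulLog_nonneg measureReal_nonneg measureReal_le_one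

lemma negMulLog_le_one {x : ℝ} (hx : 0 ≤ x) : negMulLog x ≤ 1 := by
  rcases hx.eq_or_lt with rfl | h
  · simp
  · have := log_le_sub_one_of_pos (inv_pos.2 h)
    rw [log_inv] at this
    have h2 := mul_le_mul_of_nonneg_left this hx
    rw [negMulLog]
    have h3 : x * (x⁻¹ - 1) = 1 - x := by field_simp
    linarith

lemma fibEnt_le_card (g : X → ι) : fibEnt μ g ≤ Fintype.card ι := by
  refine (Finset.sum_le_sum fun i _ => negMulLog_le_one measureReal_nonneg).trans ?_
  simp

lemma sum_real_preimage_fst [IsFiniteMeasure μ] {a : X → ι} {b : X → κ} (ha : Measurable a)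
    (hb : Measurable b) (j : κ) :
    ∑ i, μ.real ((fun x => (a x, b x)) ⁻¹' {(i, j)}) = μ.real (b ⁻¹' {j}) := by
  classical
  rw [← measureReal_biUnion_finset]
  · congr 1
    ext x
    simp
  · intro i _ i' _ hij
    exact Disjoint.preimage _ (by simpa using hij)
  · exact fun i _ => (ha.prodMk hb) (measurableSet_singleton _)

/-- Strong subadditivity of entropy. -/
lemma fibEnt_submodular [IsFiniteMeasure μ] {a : X → ι} {b : X → κ} {c : X → τ}
    (ha : Measurable a) (hb : Measurable b) (hc : Measurable c) :
    fibEnt μ (fun x => (a x, b x, c x)) + fibEnt μ c ≤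
      fibEnt μ (fun x => (a x, c x)) + fibEnt μ (fun x => (b x, c x)) := by
  set p : ι → κ → τ → ℝ := fun i j k => μ.real ((fun x => (a x, b x, c x)) ⁻¹' {(i, j, k)})
  set pac : ι → τ → ℝ := fun i k => μ.real ((fun x => (a x, c x)) ⁻¹' {(i, k)})
  set pbc : κ → τ → ℝ := fun j k => μ.real ((fun x => (b x, c x)) ⁻¹' {(j, k)})
  set pc : τ → ℝ := fun k => μ.real (c ⁻¹' {k})
  have hp : ∀ i j k, 0 ≤ p i j k := fun _ _ _ => measureReal_nonneg
  have h1 : ∀ j k, ∑ i, p i j k = pbc j k := fun j k =>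
    sum_real_preimage_fst ha (hb.prodMk hc) (j, k)
  have h2 : ∀ i k, ∑ j, p i j k = pac i k := fun i k => by
    rw [← show ∑ j, μ.real ((fun x => (b x, a x, c x)) ⁻¹' {(j, i, k)}) = pac i k from
      sum_real_preimage_fst hb (ha.prodMk hc) (i, k)]
    refine Finset.sum_congr rfl fun j _ => congrArg μ.real ?_
    ext x
    simp only [Set.mem_preimage, Set.mem_singleton_iff, Prod.mk.injEq]
    tauto
  have h3 : ∀ k, ∑ j, pbc j k = pc k := fun k => sum_real_preimage_fst hb hc k
  have h4 : ∀ k, ∑ i, pac i k = pc k := fun k => sum_real_preimage_fst ha hc k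
  have e0 : fibEnt μ (fun x => (a x, b x, c x)) = ∑ k, ∑ j, ∑ i, negMulLog (p i j k) := by
    rw [fibEnt, Fintype.sum_prod_type]
    simp_rw [Fintype.sum_prod_type]
    rw [Finset.sum_comm, Finset.sum_congr rfl fun j _ => Finset.sum_comm, Finset.sum_comm]
  have e1 : fibEnt μ c = ∑ k, ∑ j, ∑ i, -(p i j k * log (pc k)) := by
    simp only [Finset.sum_neg_distrib, ← Finset.sum_mul, h1, h3]
    simp [fibEnt, negMulLog, pc]
  have e2 : fibEnt μ (fun x => (a x, c x)) = ∑ k, ∑ j, ∑ i, -(p i j k * log (pac i k)) := by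
    rw [Finset.sum_congr rfl fun k _ => Finset.sum_comm]
    simp only [Finset.sum_neg_distrib, ← Finset.sum_mul, h2]
    rw [Finset.sum_comm]
    simp [fibEnt, Fintype.sum_prod_type, negMulLog, pac]
  have e3 : fibEnt μ (fun x => (b x, c x)) = ∑ k, ∑ j, ∑ i, -(p i j k * log (pbc j k)) := by
    simp only [Finset.sum_neg_distrib, ← Finset.sum_mul, h1]
    rw [Finset.sum_comm]
    simp [fibEnt, Fintype.sum_prod_type, negMulLog, pbc]
  have key : ∀ i j k, negMulLog (p i j k) + -(p i j k * log (pc k)) ≤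
      -(p i j k * log (pac i k)) + -(p i j k * log (pbc j k)) +
        (pac i k * pbc j k / pc k - p i j k) := by
    intro i j k
    have hpbc : p i j k ≤ pbc j k := by
      rw [← h1]; exact Finset.single_le_sum (fun i _ => hp i j k) (Finset.mem_univ i)
    have hpac : p i j k ≤ pac i k := by
      rw [← h2]; exact Finset.single_le_sum (fun j _ => hp i j k) (Finset.mem_univ j)
    have hpc : pac i k ≤ pc k := by
      rw [← h4]
      exact Finset.single_le_sum (f := fun i => pac i k) (fun i _ => measureReal_nonneg)
        (Finset.mem_univ i)
    rcases (hp i j k).eq_or_lt with h | h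
    · rw [← h]
      have : 0 ≤ pac i k * pbc j k / pc k := by positivity
      simpa using this
    · have q1 := h.trans_le hpac
      have q2 := h.trans_le hpbc
      have q3 := q1.trans_le hpc
      have := log_le_sub_one_of_pos (x := pac i k * pbc j k / (pc k * p i j k)) (by positivity)
      rw [log_div (by positivity) (by positivity), log_mul q1.ne' q2.ne',
        log_mul q3.ne' h.ne'] at this
      have h5 := mul_le_mul_of_nonneg_left this h.le
      have h6 : p i j k * (pac i k * pbc j k / (pc k * p i j k) - 1) =
          pac i k * pbc j k / pc k - p i j k := by field_simp
      rw [negMulLog]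
      linarith
  have hsum : ∑ k, ∑ j, ∑ i, (pac i k * pbc j k / pc k - p i j k) = 0 := by
    refine Finset.sum_eq_zero fun k _ => ?_
    simp only [Finset.sum_sub_distrib, ← Finset.sum_div, ← Finset.sum_mul, ← Finset.mul_sum,
      h1, h3, h4]
    rcases eq_or_ne (pc k) 0 with h | h
    · simp [h]
    · field_simp
      ring
  have := Finset.sum_le_sum fun k (_ : k ∈ Finset.univ) => Finset.sum_le_sum
    fun j (_ : j ∈ Finset.univ) => Finset.sum_le_sum fun i (_ : i ∈ Finset.univ) => key i j k
  simp only [Finset.sum_add_distrib] at this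
  rw [hsum] at this
  rw [e0, e1, e2, e3]
  linarith

lemma fibCondEnt_nonneg [IsFiniteMeasure μ] {a : X → ι} {b : X → κ} (ha : Measurable a)
    (hb : Measurable b) : 0 ≤ fibCondEnt μ a b :=
  sub_nonneg.2 (fibEnt_le_of_factors (ha.prodMk hb) fun _ _ h => (Prod.ext_iff.1 h).2)

lemma fibCondEnt_le_card [IsZeroOrProbabilityMeasure μ] (a : X → ι) (b : X → κ) :
    fibCondEnt μ a b ≤ Fintype.card ι * Fintype.card κ := by
  have h1 := fibEnt_le_card (μ := μ) (fun x => (a x, b x))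
  have h2 := fibEnt_nonneg (μ := μ) b
  rw [Fintype.card_prod] at h1
  push_cast at h1
  rw [fibCondEnt]
  linarith

lemma fibCondEnt_congr_ae {a a' : X → ι} {b b' : X → κ} (h : a =ᵐ[μ] a') (h' : b =ᵐ[μ] b') :
    fibCondEnt μ a b = fibCondEnt μ a' b' := by
  rw [fibCondEnt, fibCondEnt, fibEnt_congr_ae h', fibEnt_congr_ae (h.prodMk h')]

lemma fibCondEnt_comp_preserving {f : X → X} (hf : MeasurePreserving f μ μ) {a : X → ι}
    {b : X → κ} (ha : Measurable a) (hb : Measurable b) :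
    fibCondEnt μ (fun x => a (f x)) (fun x => b (f x)) = fibCondEnt μ a b := by
  rw [fibCondEnt, fibCondEnt, fibEnt_comp_preserving hf hb,
    fibEnt_comp_preserving hf (ha.prodMk hb)]

variable {ι' κ' : Type*} [Fintype ι'] [Fintype κ'] [MeasurableSpace ι'] [MeasurableSpace κ']
  [MeasurableSingletonClass ι'] [MeasurableSingletonClass κ']

lemma fibCondEnt_mono_left [IsFiniteMeasure μ] {a : X → ι} {a' : X → ι'} {b : X → κ}
    (ha' : Measurable a') (hb : Measurable b) (h : ∀ x y, a' x = a' y → a x = a y) :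
    fibCondEnt μ a b ≤ fibCondEnt μ a' b := by
  refine sub_le_sub_right (fibEnt_le_of_factors (ha'.prodMk hb) fun x y hxy => ?_) _
  rw [Prod.ext_iff] at hxy
  exact Prod.ext (h x y hxy.1) hxy.2

lemma fibCondEnt_anti_right [IsFiniteMeasure μ] {a : X → ι} {b : X → κ} {b' : X → κ'}
    (ha : Measurable a) (hb : Measurable b) (hb' : Measurable b')
    (h : ∀ x y, b' x = b' y → b x = b y) :
    fibCondEnt μ a b' ≤ fibCondEnt μ a b := by
  have h1 := fibEnt_submodular (μ := μ) ha hb' hb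
  have h2 : fibEnt μ (fun x => (a x, b' x)) ≤ fibEnt μ (fun x => (a x, b' x, b x)) :=
    fibEnt_le_of_factors (ha.prodMk (hb'.prodMk hb)) fun x y hxy => by
      simp only [Prod.mk.injEq] at hxy ⊢
      exact ⟨hxy.1, hxy.2.1⟩
  have h3 : fibEnt μ (fun x => (b' x, b x)) ≤ fibEnt μ b' :=
    fibEnt_le_of_factors hb' fun x y hxy => Prod.ext hxy (h x y hxy)
  rw [fibCondEnt, fibCondEnt]
  linarith

lemma fibCondEnt_congr [IsFiniteMeasure μ] {a : X → ι} {a' : X → ι'} {b : X → κ} {b' : X → κ'}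
    (ha : Measurable a) (ha' : Measurable a') (hb : Measurable b) (hb' : Measurable b')
    (h : ∀ x y, a x = a y ↔ a' x = a' y) (h' : ∀ x y, b x = b y ↔ b' x = b' y) :
    fibCondEnt μ a b = fibCondEnt μ a' b' := by
  rw [fibCondEnt, fibCondEnt, fibEnt_congr hb hb' h', fibEnt_congr (ha.prodMk hb) (ha'.prodMk hb')]
  simp [Prod.ext_iff, h, h']

lemma fibCondEnt_pair_le [IsFiniteMeasure μ] {a : X → ι} {a' : X → ι'} {b : X → κ}
    (ha : Measurable a) (ha' : Measurable a') (hb : Measurable b) :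
    fibCondEnt μ (fun x => (a x, a' x)) b ≤ fibCondEnt μ a b + fibCondEnt μ a' b := by
  have h1 := fibEnt_submodular (μ := μ) ha ha' hb
  have h2 : fibEnt μ (fun x => ((a x, a' x), b x)) = fibEnt μ (fun x => (a x, a' x, b x)) :=
    fibEnt_congr ((ha.prodMk ha').prodMk hb) (ha.prodMk (ha'.prodMk hb))
      (by simp [Prod.ext_iff, and_assoc])
  rw [fibCondEnt, fibCondEnt, fibCondEnt]
  linarith

lemma fibCondEnt_pair [IsFiniteMeasure μ] {a : X → ι} {a' : X → ι'} {b : X → κ}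
    (ha : Measurable a) (ha' : Measurable a') (hb : Measurable b) :
    fibCondEnt μ (fun x => (a x, a' x)) b =
      fibCondEnt μ a' b + fibCondEnt μ a (fun x => (a' x, b x)) := by
  have h2 : fibEnt μ (fun x => ((a x, a' x), b x)) = fibEnt μ (fun x => (a x, a' x, b x)) :=
    fibEnt_congr ((ha.prodMk ha').prodMk hb) (ha.prodMk (ha'.prodMk hb))
      (by simp [Prod.ext_iff, and_assoc])
  rw [fibCondEnt, fibCondEnt, fibCondEnt]
  linarith

lemma fibEnt_pair_le [IsProbabilityMeasure μ] {a : X → ι} {b : X → κ} (ha : Measurable a)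
    (hb : Measurable b) : fibEnt μ (fun x => (a x, b x)) ≤ fibEnt μ a + fibEnt μ b := by
  have h1 := fibCondEnt_anti_right (μ := μ) (b := fun _ : X => ()) ha measurable_const hb
    (by simp)
  have h2 : fibEnt μ (fun _ : X => ()) = 0 := by simp [fibEnt]
  have h3 : fibEnt μ (fun x => (a x, ())) = fibEnt μ a :=
    fibEnt_congr (ha.prodMk measurable_const) ha (by simp)
  rw [fibCondEnt, fibCondEnt] at h1
  linarith

/-- Conditional entropy as a weighted sum of entropies of normalised fibres. -/
lemma fibCondEnt_eq_sum [IsFiniteMeasure μ] {a : X → ι} {b : X → κ} (ha : Measurable a)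
    (hb : Measurable b) :
    fibCondEnt μ a b = ∑ j, ∑ i, μ.real (b ⁻¹' {j}) *
      negMulLog ((μ.real (b ⁻¹' {j}))⁻¹ * μ.real ((fun x => (a x, b x)) ⁻¹' {(i, j)})) := by
  rw [fibCondEnt, fibEnt, fibEnt, Fintype.sum_prod_type, Finset.sum_comm,
    ← Finset.sum_sub_distrib]
  refine Finset.sum_congr rfl fun j _ => ?_
  have hs := sum_real_preimage_fst (μ := μ) ha hb j
  have hle : ∀ i, μ.real ((fun x => (a x, b x)) ⁻¹' {(i, j)}) ≤ μ.real (b ⁻¹' {j}) := fun i => by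
    rw [← hs]
    exact Finset.single_le_sum
      (f := fun i => μ.real ((fun x => (a x, b x)) ⁻¹' {(i, j)})) (fun i _ => measureReal_nonneg)
      (Finset.mem_univ i)
  generalize μ.real (b ⁻¹' {j}) = q at *
  have : ∀ i, q * negMulLog (q⁻¹ * μ.real ((fun x => (a x, b x)) ⁻¹' {(i, j)})) =
      negMulLog (μ.real ((fun x => (a x, b x)) ⁻¹' {(i, j)})) +
        μ.real ((fun x => (a x, b x)) ⁻¹' {(i, j)}) * log q := fun i => by
    have h0 : 0 ≤ μ.real ((fun x => (a x, b x)) ⁻¹' {(i, j)}) := measureReal_nonneg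
    have h1 := hle i
    generalize μ.real ((fun x => (a x, b x)) ⁻¹' {(i, j)}) = p at *
    rcases h0.eq_or_lt with rfl | h
    · simp
    · have hq := h.trans_le h1
      rw [negMulLog, negMulLog, log_mul (by positivity) h.ne', log_inv]
      field_simp
      ring
  simp only [this, Finset.sum_add_distrib, ← Finset.sum_mul, hs]
  rw [negMulLog]
  ring

lemma real_cond_preimage [IsFiniteMeasure μ] {a : X → ι} {b : X → κ} (hb : Measurable b)
    (i : ι) (j : κ) :
    (ProbabilityTheory.cond μ (b ⁻¹' {j})).real (a ⁻¹' {i}) =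
      (μ.real (b ⁻¹' {j}))⁻¹ * μ.real ((fun x => (a x, b x)) ⁻¹' {(i, j)}) := by
  rw [measureReal_def, ProbabilityTheory.cond_apply (hb (measurableSet_singleton j)),
    ENNReal.toReal_mul, ENNReal.toReal_inv, measureReal_def, measureReal_def]
  congr 3
  ext x
  simp [and_comm]

lemma fibCondEnt_eq_sum_cond [IsFiniteMeasure μ] {a : X → ι} {b : X → κ} (ha : Measurable a)
    (hb : Measurable b) :
    fibCondEnt μ a b =
      ∑ j, μ.real (b ⁻¹' {j}) * fibEnt (ProbabilityTheory.cond μ (b ⁻¹' {j})) a := by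
  rw [fibCondEnt_eq_sum ha hb]
  refine Finset.sum_congr rfl fun j _ => ?_
  rw [fibEnt, Finset.mul_sum]
  refine Finset.sum_congr rfl fun i _ => ?_
  rw [real_cond_preimage hb]

end Entropy

section Dynamics

variable {X : Type*} [MeasurableSpace X] {μ : Measure X} {f : X → X}
variable {ι κ τ : Type*} [Fintype ι] [Fintype κ] [Fintype τ]
  [MeasurableSpace ι] [MeasurableSpace κ] [MeasurableSpace τ]
  [MeasurableSingletonClass ι] [MeasurableSingletonClass κ] [MeasurableSingletonClass τ]

/-- The itinerary of length `N` with respect to the fibres of `a`. -/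
def block (f : X → X) (a : X → ι) (N : ℕ) (x : X) : Fin N → ι := fun n => a (f^[n] x)

lemma block_eq_iff (f : X → X) (a : X → ι) (N : ℕ) (x y : X) :
    block f a N x = block f a N y ↔ ∀ n < N, a (f^[n] x) = a (f^[n] y) := by
  simp [block, funext_iff, Fin.forall_iff]

lemma measurable_block (hf : Measurable f) {a : X → ι} (ha : Measurable a) (N : ℕ) :
    Measurable (block f a N) :=
  measurable_pi_lambda _ fun n => ha.comp (hf.iterate n)

lemma block_add_eq_iff (f : X → X) (a : X → ι) (m n : ℕ) (x y : X) :
    block f a (m + n) x = block f a (m + n) y ↔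
      block f a m x = block f a m y ∧ block f a n (f^[m] x) = block f a n (f^[m] y) := by
  simp only [block_eq_iff, ← Function.iterate_add_apply]
  refine ⟨fun h => ⟨fun i hi => h i (by omega), fun i hi => h _ (by omega)⟩, fun h i hi => ?_⟩
  rcases lt_or_ge i m with h' | h'
  · exact h.1 i h'
  · have := h.2 (i - m) (by omega)
    rwa [Nat.sub_add_cancel h'] at this

lemma block_block_eq_iff (f : X → X) (a : X → ι) (M k : ℕ) (x y : X) :
    block (f^[M]) (block f a M) k x = block (f^[M]) (block f a M) k y ↔
      block f a (M * k) x = block f a (M * k) y := by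
  induction k with
  | zero => simp [block_eq_iff]
  | succ k ih =>
    rw [block_add_eq_iff, ih, mul_add, mul_one, block_add_eq_iff, ← Function.iterate_mul]
    simp [block_eq_iff (f^[M])]

/-- The conditional entropy of the itineraries of length `N`. -/
noncomputable def blockEnt (f : X → X) (μ : Measure X) (a : X → ι) (b : X → κ) (N : ℕ) : ℝ :=
  fibCondEnt μ (block f a N) (block f b N)

/-- The dynamical conditional entropy of the fibres of `a` given those of `b`. -/
noncomputable def dynEnt (f : X → X) (μ : Measure X) (a : X → ι) (b : X → κ) : ℝ :=
  ⨅ N : ℕ, blockEnt f μ a b (N + 1) / (N + 1 : ℝ)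

variable {a : X → ι} {b : X → κ}

lemma blockEnt_zero [IsFiniteMeasure μ] : blockEnt f μ a b 0 = 0 := by
  rw [blockEnt, fibCondEnt, sub_eq_zero]
  have h1 : Measurable (block f a 0) := measurable_of_subsingleton_codomain _
  have h2 : Measurable (block f b 0) := measurable_of_subsingleton_codomain _
  exact fibEnt_congr (h1.prodMk h2) h2 (by simp [block_eq_iff])

lemma blockEnt_nonneg [IsFiniteMeasure μ] (hf : Measurable f) (ha : Measurable a)
    (hb : Measurable b) (N : ℕ) : 0 ≤ blockEnt f μ a b N :=
  fibCondEnt_nonneg (measurable_block hf ha N) (measurable_block hf hb N)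

lemma subadditive_blockEnt [IsFiniteMeasure μ] (hf : MeasurePreserving f μ μ)
    (ha : Measurable a) (hb : Measurable b) : Subadditive (blockEnt f μ a b) := by
  intro m n
  have hA := measurable_block hf.measurable ha
  have hB := measurable_block hf.measurable hb
  have hm := hf.measurable.iterate m
  calc blockEnt f μ a b (m + n)
      = fibCondEnt μ (fun x => (block f a m x, block f a n (f^[m] x))) (block f b (m + n)) :=
        fibCondEnt_congr (hA _) ((hA m).prodMk ((hA n).comp hm)) (hB _) (hB _)
          (by simp [block_add_eq_iff]) (by simp)
    _ ≤ fibCondEnt μ (block f a m) (block f b (m + n)) +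
          fibCondEnt μ (fun x => block f a n (f^[m] x)) (block f b (m + n)) :=
        fibCondEnt_pair_le (hA m) ((hA n).comp hm) (hB _)
    _ ≤ fibCondEnt μ (block f a m) (block f b m) +
          fibCondEnt μ (fun x => block f a n (f^[m] x)) (fun x => block f b n (f^[m] x)) :=
        add_le_add
          (fibCondEnt_anti_right (hA m) (hB m) (hB _) fun x y h =>
            ((block_add_eq_iff f b m n x y).1 h).1)
          (fibCondEnt_anti_right ((hA n).comp hm) ((hB n).comp hm) (hB _) fun x y h =>
            ((block_add_eq_iff f b m n x y).1 h).2)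
    _ = blockEnt f μ a b m + blockEnt f μ a b n := by
        rw [fibCondEnt_comp_preserving (hf.iterate m) (hA n) (hB n)]
        rfl

lemma blockEnt_mul_le [IsFiniteMeasure μ] (hf : MeasurePreserving f μ μ)
    (ha : Measurable a) (hb : Measurable b) (k n : ℕ) :
    blockEnt f μ a b (k * n) ≤ k * blockEnt f μ a b n := by
  simpa [blockEnt_zero] using (subadditive_blockEnt hf ha hb).apply_mul_add_le k n 0

lemma bddBelow_blockEnt [IsFiniteMeasure μ] (hf : Measurable f) (ha : Measurable a)
    (hb : Measurable b) :
    BddBelow (Set.range fun N : ℕ => blockEnt f μ a b (N + 1) / (N + 1 : ℝ)) :=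
  ⟨0, by rintro _ ⟨N, rfl⟩; exact div_nonneg (blockEnt_nonneg hf ha hb _) (by positivity)⟩

lemma dynEnt_nonneg [IsFiniteMeasure μ] (hf : Measurable f) (ha : Measurable a)
    (hb : Measurable b) : 0 ≤ dynEnt f μ a b :=
  le_ciInf fun _ => div_nonneg (blockEnt_nonneg hf ha hb _) (by positivity)

lemma dynEnt_le [IsFiniteMeasure μ] (hf : Measurable f) (ha : Measurable a)
    (hb : Measurable b) {N : ℕ} (hN : N ≠ 0) : dynEnt f μ a b ≤ blockEnt f μ a b N / N := by
  obtain ⟨N, rfl⟩ := Nat.exists_eq_succ_of_ne_zero hN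
  simpa [dynEnt] using ciInf_le (bddBelow_blockEnt hf ha hb) N

lemma tendsto_blockEnt_div [IsFiniteMeasure μ] (hf : MeasurePreserving f μ μ)
    (ha : Measurable a) (hb : Measurable b) :
    Tendsto (fun N : ℕ => blockEnt f μ a b N / N) atTop (𝓝 (dynEnt f μ a b)) := by
  have hbdd : BddBelow (Set.range fun N : ℕ => blockEnt f μ a b N / N) :=
    ⟨0, by
      rintro _ ⟨N, rfl⟩
      exact div_nonneg (blockEnt_nonneg hf.measurable ha hb _) (by positivity)⟩
  have h := (subadditive_blockEnt hf ha hb).tendsto_lim hbdd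
  have h1 : (subadditive_blockEnt hf ha hb).lim = dynEnt f μ a b := by
    refine le_antisymm (le_ciInf fun N => ?_)
      (ge_of_tendsto h ((eventually_ne_atTop 0).mono fun N => dynEnt_le hf.measurable ha hb))
    simpa using (subadditive_blockEnt hf ha hb).lim_le_div hbdd N.succ_ne_zero
  rwa [h1] at h

lemma blockEnt_one [IsFiniteMeasure μ] (hf : Measurable f) (ha : Measurable a)
    (hb : Measurable b) : blockEnt f μ a b 1 = fibCondEnt μ a b :=
  fibCondEnt_congr (measurable_block hf ha 1) ha (measurable_block hf hb 1) hb
    (by simp [block_eq_iff]) (by simp [block_eq_iff])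

lemma blockEnt_le_mul [IsFiniteMeasure μ] (hf : MeasurePreserving f μ μ)
    (ha : Measurable a) (hb : Measurable b) (N : ℕ) :
    blockEnt f μ a b N ≤ N * fibCondEnt μ a b := by
  simpa [blockEnt_one hf.measurable ha hb] using blockEnt_mul_le hf ha hb N 1

lemma blockEnt_div_le_card [IsProbabilityMeasure μ] (hf : MeasurePreserving f μ μ)
    (ha : Measurable a) (hb : Measurable b) (N : ℕ) :
    blockEnt f μ a b N / N ≤ Fintype.card ι * Fintype.card κ := by
  refine div_le_of_le_mul₀ (by positivity) (by positivity) ?_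
  rw [mul_comm]
  exact (blockEnt_le_mul hf ha hb N).trans
    (mul_le_mul_of_nonneg_left (fibCondEnt_le_card a b) (by positivity))

lemma dynEnt_le_card [IsProbabilityMeasure μ] (hf : MeasurePreserving f μ μ)
    (ha : Measurable a) (hb : Measurable b) :
    dynEnt f μ a b ≤ Fintype.card ι * Fintype.card κ :=
  (dynEnt_le hf.measurable ha hb one_ne_zero).trans (blockEnt_div_le_card hf ha hb 1)

lemma block_congr_ae (hf : MeasurePreserving f μ μ) {c c' : X → ι} (N : ℕ) (hc : c =ᵐ[μ] c') :
    block f c N =ᵐ[μ] block f c' N := by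
  have : ∀ᵐ x ∂μ, ∀ n : Fin N, c (f^[n] x) = c' (f^[n] x) :=
    ae_all_iff.2 fun n => (hf.iterate n).quasiMeasurePreserving.ae hc
  filter_upwards [this] with x hx
  exact funext hx

lemma dynEnt_congr_ae (hf : MeasurePreserving f μ μ) {a' : X → ι} {b' : X → κ}
    (h : a =ᵐ[μ] a') (h' : b =ᵐ[μ] b') : dynEnt f μ a b = dynEnt f μ a' b' := by
  unfold dynEnt blockEnt
  exact iInf_congr fun N => by
    rw [fibCondEnt_congr_ae (block_congr_ae hf (N + 1) h) (block_congr_ae hf (N + 1) h')]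

variable {ι' κ' : Type*} [Fintype ι'] [Fintype κ'] [MeasurableSpace ι'] [MeasurableSpace κ']
  [MeasurableSingletonClass ι'] [MeasurableSingletonClass κ']

lemma block_factors {c : X → ι} {c' : X → ι'} (h : ∀ x y, c' x = c' y → c x = c y) (N : ℕ)
    (x y : X) (hxy : block f c' N x = block f c' N y) : block f c N x = block f c N y := by
  rw [block_eq_iff] at *
  exact fun n hn => h _ _ (hxy n hn)

lemma dynEnt_mono_left [IsFiniteMeasure μ] (hf : Measurable f) {a' : X → ι'} (ha : Measurable a)
    (ha' : Measurable a') (hb : Measurable b) (h : ∀ x y, a' x = a' y → a x = a y) :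
    dynEnt f μ a b ≤ dynEnt f μ a' b := by
  refine ciInf_mono (bddBelow_blockEnt hf ha hb) fun N => ?_
  exact div_le_div_of_nonneg_right (fibCondEnt_mono_left (measurable_block hf ha' _)
    (measurable_block hf hb _) (block_factors h _)) (by positivity)

lemma dynEnt_congr [IsFiniteMeasure μ] (hf : Measurable f) {a' : X → ι'} {b' : X → κ'}
    (ha : Measurable a) (ha' : Measurable a') (hb : Measurable b) (hb' : Measurable b')
    (h : ∀ x y, a x = a y ↔ a' x = a' y) (h' : ∀ x y, b x = b y ↔ b' x = b' y) :
    dynEnt f μ a b = dynEnt f μ a' b' := by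
  unfold dynEnt blockEnt
  refine iInf_congr fun N => ?_
  rw [fibCondEnt_congr (measurable_block hf ha _) (measurable_block hf ha' _)
    (measurable_block hf hb _) (measurable_block hf hb' _)
    (fun x y => ⟨block_factors (fun x y => (h x y).1) _ x y,
      block_factors (fun x y => (h x y).2) _ x y⟩)
    (fun x y => ⟨block_factors (fun x y => (h' x y).1) _ x y,
      block_factors (fun x y => (h' x y).2) _ x y⟩)]

/-- Continuity of entropy in the Rokhlin metric. -/
lemma dynEnt_le_add [IsFiniteMeasure μ] (hf : MeasurePreserving f μ μ) {a' : X → ι'}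
    (ha : Measurable a) (ha' : Measurable a') (hb : Measurable b) :
    dynEnt f μ a' b ≤ dynEnt f μ a b + fibCondEnt μ a' a := by
  refine le_of_tendsto_of_tendsto (tendsto_blockEnt_div hf ha' hb)
    ((tendsto_blockEnt_div hf ha hb).add_const _) ?_
  filter_upwards [eventually_gt_atTop 0] with N hN
  have hA := measurable_block hf.measurable ha N
  have hA' := measurable_block hf.measurable ha' N
  have hB := measurable_block hf.measurable hb N
  have h1 : blockEnt f μ a' b N ≤
      fibCondEnt μ (fun x => (block f a' N x, block f a N x)) (block f b N) :=
    fibCondEnt_mono_left (hA'.prodMk hA) hB (by simp +contextual)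
  rw [fibCondEnt_pair hA' hA hB] at h1
  have h2 : fibCondEnt μ (block f a' N) (fun x => (block f a N x, block f b N x)) ≤
      fibCondEnt μ (block f a' N) (block f a N) :=
    fibCondEnt_anti_right hA' hA (hA.prodMk hB) (by simp +contextual)
  have h3 := blockEnt_le_mul hf ha' ha N
  have hN' : (0 : ℝ) < N := by exact_mod_cast hN
  rw [div_add' _ _ _ hN'.ne']
  refine div_le_div_of_nonneg_right ?_ hN'.le
  rw [mul_comm] at h3
  unfold blockEnt at *
  linarith

/-- Conditioning on an almost surely invariant finite partition does not lower the
dynamical entropy. -/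
lemma dynEnt_le_of_invariant [IsProbabilityMeasure μ] (hf : MeasurePreserving f μ μ) {e : X → τ}
    (ha : Measurable a) (hb : Measurable b) (he : Measurable e)
    (hinv : ∀ᵐ x ∂μ, e (f x) = e x) :
    dynEnt f μ a b ≤ dynEnt f μ a (fun x => (b x, e x)) := by
  have hC : Tendsto (fun N : ℕ => fibEnt μ e / N) atTop (𝓝 0) :=
    tendsto_const_div_atTop_nhds_zero_nat _
  have hlim := (tendsto_blockEnt_div hf ha (hb.prodMk he)).add hC
  rw [add_zero] at hlim
  refine le_of_tendsto_of_tendsto' (tendsto_blockEnt_div hf ha hb) hlim fun N => ?_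
  rw [← add_div]
  refine div_le_div_of_nonneg_right ?_ (by positivity)
  have hA := measurable_block hf.measurable ha N
  have hB := measurable_block hf.measurable hb N
  have hE := measurable_block hf.measurable he N
  have hBE := measurable_block hf.measurable (hb.prodMk he) N
  have hker : ∀ x y, (block f b N x, block f e N x) = (block f b N y, block f e N y) ↔
      block f (fun x => (b x, e x)) N x = block f (fun x => (b x, e x)) N y := fun x y => by
    simp only [Prod.mk.injEq, block_eq_iff]
    exact ⟨fun h n hn => ⟨h.1 n hn, h.2 n hn⟩,
      fun h => ⟨fun n hn => (h n hn).1, fun n hn => (h n hn).2⟩⟩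
  have h1 : fibEnt μ (fun x => (block f a N x, block f b N x)) ≤
      fibEnt μ (fun x => (block f a N x, block f (fun x => (b x, e x)) N x)) :=
    fibEnt_le_of_factors (hA.prodMk hBE) fun x y h => by
      rw [Prod.mk.injEq, ← hker] at h
      simp only [Prod.mk.injEq] at h ⊢
      exact ⟨h.1, h.2.1⟩
  have h2 := fibEnt_pair_le (μ := μ) hB hE
  rw [fibEnt_congr (hB.prodMk hE) hBE hker] at h2
  have hiter : ∀ᵐ x ∂μ, ∀ n, e (f^[n] x) = e x := by
    refine ae_all_iff.2 fun n => ?_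
    induction n with
    | zero => simp
    | succ n ih =>
      filter_upwards [ih, (hf.iterate n).quasiMeasurePreserving.ae hinv] with x h1 h2
      rw [Function.iterate_succ_apply', h2, h1]
  have h3 : block f e N =ᵐ[μ] fun x _ => e x := by
    filter_upwards [hiter] with x hx
    exact funext fun n => hx n
  have h4 : fibEnt μ (block f e N) ≤ fibEnt μ e := by
    rw [fibEnt_congr_ae h3]
    exact fibEnt_le_of_factors he fun x y h => funext fun _ => h
  simp only [blockEnt, fibCondEnt]
  linarith

lemma dynEnt_iterate_le [IsFiniteMeasure μ] (hf : MeasurePreserving f μ μ)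
    (ha : Measurable a) (hb : Measurable b) {k : ℕ} (hk : k ≠ 0) :
    dynEnt (f^[k]) μ (block f a k) (block f b k) ≤ k * dynEnt f μ a b := by
  have hkm := hf.measurable.iterate k
  have hA := measurable_block hf.measurable ha
  have hB := measurable_block hf.measurable hb
  have hk' : (0 : ℝ) < k := by positivity
  rw [mul_comm, ← div_le_iff₀ hk']
  refine le_ciInf fun N => ?_
  rw [div_le_iff₀ hk']
  refine (dynEnt_le hkm (hA k) (hB k) N.succ_ne_zero).trans ?_
  have h1 : blockEnt (f^[k]) μ (block f a k) (block f b k) (N + 1) =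
      blockEnt f μ a b (k * (N + 1)) :=
    fibCondEnt_congr (measurable_block hkm (hA k) _) (hA _) (measurable_block hkm (hB k) _) (hB _)
      (block_block_eq_iff f a k _) (block_block_eq_iff f b k _)
  have h2 := blockEnt_mul_le hf ha hb k (N + 1)
  rw [h1, div_mul_eq_mul_div, Nat.cast_succ]
  exact div_le_div_of_nonneg_right (by linarith) (by positivity)

end Dynamics

section Disintegration

variable {X Y : Type*} [MeasurableSpace X] [mY : MeasurableSpace Y]

/-- The sets `Z` of parameters which are detected by a single measurable subset of `X`,
simultaneously for almost all measures of the family `P`. -/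
@[reducible]
def detectedSpace (ν : Measure Y) (P : Y → Measure X) : MeasurableSpace Y where
  MeasurableSet' Z := MeasurableSet[mY] Z ∧
    ∃ S : Set X, MeasurableSet S ∧ ∀ᵐ y ∂ν, ∀ᵐ x ∂P y, (x ∈ S ↔ y ∈ Z)
  measurableSet_empty := ⟨MeasurableSet.empty, ∅, MeasurableSet.empty, by simp⟩
  measurableSet_compl Z := by
    rintro ⟨hZ, S, hS, h⟩
    exact ⟨hZ.compl, Sᶜ, hS.compl, h.mono fun y hy => hy.mono fun x hx => not_congr hx⟩
  measurableSet_iUnion Z hZ := by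
    choose hZ S hS h using hZ
    refine ⟨MeasurableSet.iUnion hZ, ⋃ i, S i, MeasurableSet.iUnion hS, ?_⟩
    filter_upwards [ae_all_iff.2 h] with y hy
    filter_upwards [ae_all_iff.2 hy] with x hx
    simp [hx]

/-- A disintegration of `μ` whose parameter can be read off the points of `X`. -/
structure IsDetectedDisintegration (μ : Measure X) (ν : Measure Y) (P : Y → Measure X) : Prop where
  prob : ∀ᵐ y ∂ν, IsProbabilityMeasure (P y)
  measurable : ∀ s, MeasurableSet s → Measurable[detectedSpace ν P] fun y => P y s
  eq_lintegral : ∀ s, MeasurableSet s → μ s = ∫⁻ y, P y s ∂ν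

variable {μ : Measure X} {ν : Measure Y} {P : Y → Measure X}

lemma detectedSpace_le : detectedSpace ν P ≤ mY := fun _ h => h.1

lemma ae_ae_of_ae (hdis : ∀ s, MeasurableSet s → μ s = ∫⁻ y, P y s ∂ν)
    (hmeas : ∀ s, MeasurableSet s → Measurable fun y => P y s)
    {p : X → Prop} (h : ∀ᵐ x ∂μ, p x) : ∀ᵐ y ∂ν, ∀ᵐ x ∂P y, p x := by
  have hs := measurableSet_toMeasurable μ {x | ¬ p x}
  have h0 : μ (toMeasurable μ {x | ¬ p x}) = 0 := by rw [measure_toMeasurable]; exact h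
  rw [hdis _ hs, lintegral_eq_zero_iff (hmeas _ hs)] at h0
  filter_upwards [h0] with y hy
  exact measure_mono_null (subset_toMeasurable μ _) hy

lemma exists_detecting_nat {e : Y → ℕ} (he : Measurable[detectedSpace ν P] e) :
    ∃ g : X → ℕ, Measurable g ∧ ∀ᵐ y ∂ν, ∀ᵐ x ∂P y, g x = e y := by
  classical
  have h := fun n => (he (measurableSet_singleton n)).2
  choose S hS h using h
  have hex : ∀ x, ∃ n, x ∈ S n ∪ (⋃ k, S k)ᶜ := fun x => by
    by_cases hx : x ∈ ⋃ k, S k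
    · obtain ⟨n, hn⟩ := Set.mem_iUnion.1 hx
      exact ⟨n, Or.inl hn⟩
    · exact ⟨0, Or.inr hx⟩
  refine ⟨fun x => Nat.find (hex x),
    measurable_find hex fun k => (hS k).union (MeasurableSet.iUnion hS).compl, ?_⟩
  filter_upwards [ae_all_iff.2 h] with y hy
  filter_upwards [ae_all_iff.2 hy] with x hx
  have h1 : x ∈ ⋃ k, S k := Set.mem_iUnion.2 ⟨e y, (hx _).2 rfl⟩
  rcases Nat.find_spec (hex x) with h2 | h2
  · exact ((hx _).1 h2).symm
  · exact absurd h1 h2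

lemma exists_detecting {ι : Type*} [Countable ι] [Nonempty ι] [MeasurableSpace ι]
    [DiscreteMeasurableSpace ι]
    {e : Y → ι} (he : Measurable[detectedSpace ν P] e) :
    ∃ g : X → ι, Measurable g ∧ ∀ᵐ y ∂ν, ∀ᵐ x ∂P y, g x = e y := by
  obtain ⟨φ, hφ⟩ := exists_injective_nat ι
  obtain ⟨g, hg, h⟩ := exists_detecting_nat (e := fun y => φ (e y))
    ((Measurable.of_discrete (f := φ)).comp he)
  refine ⟨fun x => Function.invFun φ (g x),
    (Measurable.of_discrete (f := Function.invFun φ)).comp hg, ?_⟩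
  filter_upwards [h] with y hy
  filter_upwards [hy] with x hx
  rw [hx]
  exact Function.leftInverse_invFun hφ (e y)

namespace IsDetectedDisintegration

variable (D : IsDetectedDisintegration μ ν P)
include D

lemma measurable' (s : Set X) (hs : MeasurableSet s) : Measurable fun y => P y s :=
  (D.measurable s hs).mono detectedSpace_le le_rfl

lemma ae_of_ae_ae {p : X → Prop} (hp : MeasurableSet {x | p x})
    (h : ∀ᵐ y ∂ν, ∀ᵐ x ∂P y, p x) : ∀ᵐ x ∂μ, p x := by
  have h0 : μ {x | p x}ᶜ = 0 := by
    rw [D.eq_lintegral _ hp.compl, lintegral_eq_zero_iff (D.measurable' _ hp.compl)]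
    exact h
  exact h0

lemma real_eq_integral {s : Set X} (hs : MeasurableSet s) :
    μ.real s = ∫ y, (P y).real s ∂ν := by
  rw [measureReal_def, D.eq_lintegral s hs, ← integral_toReal (D.measurable' s hs).aemeasurable]
  · rfl
  · filter_upwards [D.prob] with y hy
    exact measure_lt_top _ _

lemma measurePreserving {f : X → X} (hfm : Measurable f)
    (hf : ∀ᵐ y ∂ν, MeasurePreserving f (P y) (P y)) : MeasurePreserving f μ μ := by
  refine ⟨hfm, Measure.ext fun s hs => ?_⟩
  rw [Measure.map_apply hfm hs, D.eq_lintegral _ hs, D.eq_lintegral _ (hfm hs)]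
  refine lintegral_congr_ae ?_
  filter_upwards [hf] with y hy
  exact hy.measure_preimage hs.nullMeasurableSet

lemma measurable_real {s : Set X} (hs : MeasurableSet s) :
    Measurable[detectedSpace ν P] fun y => (P y).real s :=
  ENNReal.measurable_toReal.comp (D.measurable s hs)

variable {ι κ : Type*} [Fintype ι] [Fintype κ] [MeasurableSpace ι] [MeasurableSpace κ]
  [MeasurableSingletonClass ι] [MeasurableSingletonClass κ]

lemma measurable_fibEnt {g : X → ι} (hg : Measurable g) :
    Measurable[detectedSpace ν P] fun y => fibEnt (P y) g := by
  unfold fibEnt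
  refine Finset.measurable_sum _ fun i _ => ?_
  exact continuous_negMulLog.measurable.comp (D.measurable_real (hg (measurableSet_singleton i)))

lemma measurable_fibCondEnt {a : X → ι} {b : X → κ} (ha : Measurable a) (hb : Measurable b) :
    Measurable[detectedSpace ν P] fun y => fibCondEnt (P y) a b :=
  (D.measurable_fibEnt (ha.prodMk hb)).sub (D.measurable_fibEnt hb)

lemma measurable_blockEnt {f : X → X} (hf : Measurable f) {a : X → ι} {b : X → κ}
    (ha : Measurable a) (hb : Measurable b) (N : ℕ) :
    Measurable[detectedSpace ν P] fun y => blockEnt f (P y) a b N :=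
  D.measurable_fibCondEnt (measurable_block hf ha N) (measurable_block hf hb N)

lemma measurable_dynEnt {f : X → X} (hf : Measurable f) {a : X → ι} {b : X → κ}
    (ha : Measurable a) (hb : Measurable b) :
    Measurable[detectedSpace ν P] fun y => dynEnt f (P y) a b :=
  Measurable.iInf fun N => (D.measurable_blockEnt hf ha hb (N + 1)).div_const _

end IsDetectedDisintegration

lemma abs_mul_sub_setIntegral_le [IsProbabilityMeasure ν] {φ : ℝ → ℝ} (hφ : Continuous φ)
    {δ ε : ℝ}
    (hunif : ∀ s ∈ Set.Icc (0 : ℝ) 1, ∀ t ∈ Set.Icc (0 : ℝ) 1, |s - t| ≤ δ → |φ s - φ t| ≤ ε)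
    {E : Set Y} {r : Y → ℝ} (hr : Measurable r) {G : Set Y} (hG : ∀ᵐ y ∂ν, y ∈ G)
    (hr01 : ∀ y ∈ G, r y ∈ Set.Icc (0 : ℝ) 1)
    (hclose : ∀ y ∈ E, ∀ y' ∈ E, y ∈ G → y' ∈ G → |r y - r y'| ≤ δ) (hE : MeasurableSet E) :
    |ν.real E * φ ((ν.real E)⁻¹ * ∫ y in E, r y ∂ν) - ∫ y in E, φ (r y) ∂ν| ≤ ε * ν.real E := by
  rcases (measureReal_nonneg : 0 ≤ ν.real E).eq_or_lt with h0 | hpos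
  · have : ν E = 0 := by simpa [measureReal_def, ENNReal.toReal_eq_zero_iff] using h0.symm
    simp [← h0, setIntegral_measure_zero _ this]
  have hGE : ∀ᵐ y ∂ν.restrict E, y ∈ E ∧ y ∈ G := by
    filter_upwards [ae_restrict_mem hE, ae_restrict_of_ae hG] with y h1 h2
    exact ⟨h1, h2⟩
  have hri : Integrable r (ν.restrict E) :=
    Integrable.of_bound hr.aestronglyMeasurable 1 (hGE.mono fun y hy => by
      have := hr01 y hy.2
      rw [norm_eq_abs, abs_of_nonneg this.1]
      exact this.2)
  obtain ⟨C, hC⟩ := isCompact_Icc.exists_bound_of_continuousOn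
    (hφ.continuousOn (s := Set.Icc (0 : ℝ) 1))
  have hφi : Integrable (fun y => φ (r y)) (ν.restrict E) :=
    Integrable.of_bound (hφ.measurable.comp hr).aestronglyMeasurable C
      (hGE.mono fun y hy => hC _ (hr01 y hy.2))
  set q := ν.real E
  have hqfin : (ν.restrict E).real Set.univ = q := by simp [q]
  set A := q⁻¹ * ∫ y in E, r y ∂ν
  have hconst : ∀ c : ℝ, ∫ _ in E, c ∂ν = q * c := fun c => by simp [q]
  have hAclose : ∀ y0 ∈ E, y0 ∈ G → |A - r y0| ≤ δ := by
    intro y0 h1 h2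
    have h3 : q * (A - r y0) = ∫ y in E, (r y - r y0) ∂ν := by
      rw [integral_sub hri (integrable_const _), hconst, mul_sub]
      simp only [A]
      rw [mul_inv_cancel_left₀ hpos.ne']
    have h4 : ‖∫ y in E, (r y - r y0) ∂ν‖ ≤ δ * (ν.restrict E).real Set.univ :=
      norm_integral_le_of_norm_le_const (hGE.mono fun y hy => hclose y hy.1 y0 h1 hy.2 h2)
    rw [← h3, hqfin, norm_mul, norm_eq_abs, norm_eq_abs, abs_of_pos hpos, mul_comm] at h4
    exact le_of_mul_le_mul_right h4 hpos
  have hA01 : A ∈ Set.Icc (0 : ℝ) 1 := by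
    have h5 : 0 ≤ ∫ y in E, r y ∂ν :=
      integral_nonneg_of_ae (hGE.mono fun y hy => (hr01 y hy.2).1)
    have h6 : ∫ y in E, r y ∂ν ≤ ∫ _ in E, (1 : ℝ) ∂ν :=
      integral_mono_ae hri (integrable_const _) (hGE.mono fun y hy => (hr01 y hy.2).2)
    rw [hconst, mul_one] at h6
    refine ⟨by positivity, ?_⟩
    simp only [A]
    rw [inv_mul_le_iff₀ hpos, mul_one]
    exact h6
  rw [← hconst, ← integral_sub (integrable_const _) hφi, ← norm_eq_abs]
  refine (norm_integral_le_of_norm_le_const (C := ε) (hGE.mono fun y hy => ?_)).trans_eq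
    (by rw [hqfin])
  exact hunif _ hA01 _ (hr01 y hy.2) (hAclose y hy.1 hy.2)

/-- A finite measurable quantisation of `[0, 1]`-valued functions up to error `δ`. -/
lemma exists_quantization {δ : ℝ} (hδ : 0 < δ) :
    ∃ n : ℕ, ∃ φ : ℝ → Fin (n + 1), Measurable φ ∧
      ∀ s ∈ Set.Icc (0 : ℝ) 1, ∀ t ∈ Set.Icc (0 : ℝ) 1, φ s = φ t → |s - t| ≤ δ := by
  obtain ⟨n, hn⟩ := exists_nat_gt δ⁻¹
  have hn0 : (0 : ℝ) < n := (inv_pos.2 hδ).trans hn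
  let ψ : ℕ → Fin (n + 1) := fun k => ⟨min n k, by omega⟩
  refine ⟨n, fun r => ψ ⌊n * r⌋₊,
    (Measurable.of_discrete (f := ψ)).comp (Nat.measurable_floor.comp (measurable_const_mul _)), ?_⟩
  intro s hs t ht hst
  have hle : ∀ u ∈ Set.Icc (0 : ℝ) 1, ⌊n * u⌋₊ ≤ n := fun u hu =>
    Nat.floor_le_of_le (by nlinarith [hu.2])
  simp only [ψ, Fin.mk.injEq, min_eq_right (hle s hs), min_eq_right (hle t ht)] at hst
  have h1 := Nat.floor_le (mul_nonneg hn0.le hs.1)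
  have h2 := Nat.floor_le (mul_nonneg hn0.le ht.1)
  have h3 := Nat.lt_floor_add_one ((n : ℝ) * s)
  have h4 := Nat.lt_floor_add_one ((n : ℝ) * t)
  rw [hst] at h1 h3
  have h5 : |(n : ℝ) * s - n * t| ≤ 1 := abs_le.2 ⟨by linarith, by linarith⟩
  rw [← mul_sub, abs_mul, abs_of_pos hn0] at h5
  have h6 : 1 < n * δ := by rwa [inv_lt_iff_one_lt_mul₀ hδ] at hn
  by_contra! h
  nlinarith

namespace IsDetectedDisintegration

variable [IsProbabilityMeasure ν] (D : IsDetectedDisintegration μ ν P)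
variable {ι κ τ : Type*} [Fintype ι] [Fintype κ] [MeasurableSpace ι] [MeasurableSpace κ]
  [MeasurableSingletonClass ι] [MeasurableSingletonClass κ]
  [Fintype τ] [MeasurableSpace τ] [MeasurableSingletonClass τ]
include D

lemma isProbabilityMeasure : IsProbabilityMeasure μ := ⟨by
  rw [D.eq_lintegral _ MeasurableSet.univ,
    lintegral_congr_ae (g := fun _ => 1) (D.prob.mono fun y hy => measure_univ)]
  simp⟩

lemma integrable_of_bound {F : Y → ℝ} (hF : AEStronglyMeasurable F ν) (C : ℝ)
    (h0 : ∀ᵐ y ∂ν, 0 ≤ F y) (hC : ∀ᵐ y ∂ν, F y ≤ C) : Integrable F ν :=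
  Integrable.of_bound hF C (by
    filter_upwards [h0, hC] with y h1 h2
    rwa [norm_eq_abs, abs_of_nonneg h1])

lemma integrable_fibEnt {g : X → ι} (hg : Measurable g) :
    Integrable (fun y => fibEnt (P y) g) ν :=
  D.integrable_of_bound
    ((D.measurable_fibEnt hg).mono detectedSpace_le le_rfl).aestronglyMeasurable
    (Fintype.card ι) (D.prob.mono fun _ _ => fibEnt_nonneg g)
    (ae_of_all _ fun _ => fibEnt_le_card g)

lemma abs_fibCondEnt_sub_integral_le {δ ε : ℝ}
    (hunif : ∀ s ∈ Set.Icc (0 : ℝ) 1, ∀ t ∈ Set.Icc (0 : ℝ) 1,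
      |s - t| ≤ δ → |negMulLog s - negMulLog t| ≤ ε)
    {c : X → κ} (hc : Measurable c) {e : Y → τ} (he : Measurable e)
    (hclose : ∀ y y', IsProbabilityMeasure (P y) → IsProbabilityMeasure (P y') → e y = e y' →
      ∀ i, |(P y).real (c ⁻¹' {i}) - (P y').real (c ⁻¹' {i})| ≤ δ)
    {g : X → τ} (hg : Measurable g) (hge : ∀ᵐ y ∂ν, ∀ᵐ x ∂P y, g x = e y) :
    |fibCondEnt μ c g - ∫ y, fibEnt (P y) c ∂ν| ≤ Fintype.card κ * ε := by
  classical
  have hprob := D.isProbabilityMeasure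
  have hE : ∀ j, MeasurableSet (e ⁻¹' {j}) := fun j => he (measurableSet_singleton j)
  have hq : ∀ j, μ.real (g ⁻¹' {j}) = ν.real (e ⁻¹' {j}) := by
    intro j
    rw [D.real_eq_integral (hg (measurableSet_singleton j)), ← integral_indicator_one (hE j)]
    refine integral_congr_ae ?_
    filter_upwards [hge, D.prob] with y hy hp
    by_cases hj : e y = j
    · rw [Set.indicator_of_mem (by exact hj), Pi.one_apply, measureReal_def,
        (prob_compl_eq_zero_iff (hg (measurableSet_singleton j))).1, ENNReal.toReal_one]
      exact hy.mono fun x hx => by simp [hx, hj]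
    · rw [Set.indicator_of_notMem (by exact hj), measureReal_def,
        measure_eq_zero_iff_ae_notMem.2, ENNReal.toReal_zero]
      exact hy.mono fun x hx => by simp [hx, hj]
  have hp : ∀ i j, μ.real ((fun x => (c x, g x)) ⁻¹' {(i, j)}) =
      ∫ y in e ⁻¹' {j}, (P y).real (c ⁻¹' {i}) ∂ν := by
    intro i j
    rw [D.real_eq_integral ((hc.prodMk hg) (measurableSet_singleton _)),
      ← integral_indicator (hE j)]
    refine integral_congr_ae ?_
    filter_upwards [hge] with y hy
    by_cases hj : e y = j
    · rw [Set.indicator_of_mem (by exact hj)]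
      refine measureReal_congr ?_
      filter_upwards [hy] with x hx
      have : (c x, g x) = (i, j) ↔ c x = i := by simp [hx, hj]
      exact propext this
    · rw [Set.indicator_of_notMem (by exact hj), measureReal_def,
        measure_eq_zero_iff_ae_notMem.2, ENNReal.toReal_zero]
      exact hy.mono fun x hx => by simp [hx, hj]
  have hmeas : ∀ i, Measurable fun y => (P y).real (c ⁻¹' {i}) := fun i =>
    (D.measurable_real (hc (measurableSet_singleton i))).mono detectedSpace_le le_rfl
  have h_int : ∀ i, Integrable (fun y => negMulLog ((P y).real (c ⁻¹' {i}))) ν := fun i =>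
    D.integrable_of_bound (continuous_negMulLog.measurable.comp (hmeas i)).aestronglyMeasurable 1
      (D.prob.mono fun _ _ => negMulLog_nonneg measureReal_nonneg measureReal_le_one)
      (ae_of_all _ fun _ => negMulLog_le_one measureReal_nonneg)
  have hsplit : ∫ y, fibEnt (P y) c ∂ν =
      ∑ j, ∑ i, ∫ y in e ⁻¹' {j}, negMulLog ((P y).real (c ⁻¹' {i})) ∂ν := by
    unfold fibEnt
    rw [integral_finsetSum _ fun i _ => h_int i, Finset.sum_comm]
    refine Finset.sum_congr rfl fun i _ => ?_
    rw [← integral_iUnion_fintype hE (fun j j' hj => Disjoint.preimage e (by simpa using hj))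
      fun j => (h_int i).integrableOn]
    rw [← Set.preimage_iUnion, Set.iUnion_of_singleton, Set.preimage_univ, setIntegral_univ]
  have hsumq : ∑ j, ν.real (e ⁻¹' {j}) = 1 := by
    have := sum_real_preimage_fst (μ := ν) he (measurable_const (a := ())) ()
    simp only [Set.preimage_const_of_mem (Set.mem_singleton ()), probReal_univ] at this
    rw [← this]
    refine Finset.sum_congr rfl fun j _ => congrArg ν.real ?_
    ext y
    simp
  rw [fibCondEnt_eq_sum hc hg, hsplit, ← Finset.sum_sub_distrib]
  simp only [← Finset.sum_sub_distrib, hq, hp]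
  refine (Finset.abs_sum_le_sum_abs _ _).trans ((Finset.sum_le_sum fun j _ =>
    Finset.abs_sum_le_sum_abs _ _).trans ?_)
  refine (Finset.sum_le_sum fun j _ => Finset.sum_le_sum fun i _ =>
    abs_mul_sub_setIntegral_le (δ := δ) (ε := ε) (G := {y | IsProbabilityMeasure (P y)})
      continuous_negMulLog hunif (hmeas i) D.prob
      (fun y (hy : IsProbabilityMeasure (P y)) => ⟨measureReal_nonneg, measureReal_le_one⟩)
      (fun y hy y' hy' h h' => hclose y y' h h' (hy.trans hy'.symm) i) (hE j)).trans ?_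
  simp only [Finset.sum_const, Finset.card_univ, nsmul_eq_mul, ← Finset.mul_sum, hsumq, mul_one,
    le_refl]

lemma exists_conditioning {a : X → ι} {b : X → κ} (ha : Measurable a) (hb : Measurable b)
    {ε : ℝ} (hε : 0 < ε) :
    ∃ m : ℕ, ∃ e : Y → Fin m, ∃ g : X → Fin m, Measurable g ∧
      (∀ᵐ y ∂ν, ∀ᵐ x ∂P y, g x = e y) ∧
      |fibCondEnt μ a (fun x => (b x, g x)) - ∫ y, fibCondEnt (P y) a b ∂ν| ≤ ε := by
  have hprob := D.isProbabilityMeasure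
  set K : ℝ := Fintype.card (ι × κ) + Fintype.card κ + 1
  have hK : 0 < K := by positivity
  have huc := isCompact_Icc.uniformContinuousOn_of_continuous
    (continuous_negMulLog.continuousOn (s := Set.Icc (0 : ℝ) 1))
  obtain ⟨δ, hδ, hunif⟩ := Metric.uniformContinuousOn_iff.1 huc (ε / K) (by positivity)
  obtain ⟨n, φ, hφ, hφδ⟩ := exists_quantization (half_pos hδ)
  have hunif' : ∀ s ∈ Set.Icc (0 : ℝ) 1, ∀ t ∈ Set.Icc (0 : ℝ) 1,
      |s - t| ≤ δ / 2 → |negMulLog s - negMulLog t| ≤ ε / K := fun s hs t ht h =>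
    (hunif s hs t ht (h.trans_lt (half_lt_self hδ))).le
  have hab := ha.prodMk hb
  obtain ⟨m, ⟨ψ⟩⟩ := Finite.exists_equiv_fin ((ι × κ → Fin (n + 1)) × (κ → Fin (n + 1)))
  have hne : Nonempty (Fin m) := ⟨ψ (fun _ => 0, fun _ => 0)⟩
  let e : Y → Fin m := fun y => ψ
    (fun i => φ ((P y).real ((fun x => (a x, b x)) ⁻¹' {i})), fun j => φ ((P y).real (b ⁻¹' {j})))
  have he : Measurable[detectedSpace ν P] e := (Measurable.of_discrete (f := ψ)).comp <|
    (@measurable_pi_lambda _ _ _ (detectedSpace ν P) _ _ fun i =>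
      hφ.comp (D.measurable_real (hab (measurableSet_singleton i)))).prodMk
    (@measurable_pi_lambda _ _ _ (detectedSpace ν P) _ _ fun j =>
      hφ.comp (D.measurable_real (hb (measurableSet_singleton j))))
  obtain ⟨g, hg, hge⟩ := exists_detecting he
  refine ⟨m, e, g, hg, hge, ?_⟩
  have he' := he.mono detectedSpace_le le_rfl
  have h1 := D.abs_fibCondEnt_sub_integral_le hunif' hab he' (fun y y' hy hy' hyy i =>
    hφδ _ ⟨measureReal_nonneg, measureReal_le_one⟩ _ ⟨measureReal_nonneg, measureReal_le_one⟩
      (congrFun (Prod.ext_iff.1 (ψ.injective hyy)).1 i)) hg hge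
  have h2 := D.abs_fibCondEnt_sub_integral_le hunif' hb he' (fun y y' hy hy' hyy i =>
    hφδ _ ⟨measureReal_nonneg, measureReal_le_one⟩ _ ⟨measureReal_nonneg, measureReal_le_one⟩
      (congrFun (Prod.ext_iff.1 (ψ.injective hyy)).2 i)) hg hge
  have h3 : fibCondEnt μ a (fun x => (b x, g x)) =
      fibCondEnt μ (fun x => (a x, b x)) g - fibCondEnt μ b g := by
    have : fibEnt μ (fun x => (a x, b x, g x)) = fibEnt μ (fun x => ((a x, b x), g x)) :=
      fibEnt_congr (ha.prodMk (hb.prodMk hg)) (hab.prodMk hg) (by simp [Prod.ext_iff, and_assoc])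
    rw [fibCondEnt, fibCondEnt, fibCondEnt, this]
    ring
  have h4 : ∫ y, fibCondEnt (P y) a b ∂ν =
      ∫ y, fibEnt (P y) (fun x => (a x, b x)) ∂ν - ∫ y, fibEnt (P y) b ∂ν :=
    integral_sub (D.integrable_fibEnt hab) (D.integrable_fibEnt hb)
  have h5 : Fintype.card (ι × κ) * (ε / K) + Fintype.card κ * (ε / K) ≤ ε := by
    rw [← add_mul, ← mul_div_assoc, div_le_iff₀ hK, mul_comm]
    exact mul_le_mul_of_nonneg_left (by simp [K]) hε.le
  rw [h3, h4]
  rw [abs_le] at *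
  constructor <;> linarith

variable {f : X → X} {a : X → ι} {b : X → κ}

lemma integrable_blockEnt_div (hfm : Measurable f)
    (hf : ∀ᵐ y ∂ν, MeasurePreserving f (P y) (P y)) (ha : Measurable a) (hb : Measurable b)
    (N : ℕ) : Integrable (fun y => blockEnt f (P y) a b N / N) ν :=
  D.integrable_of_bound (((D.measurable_blockEnt hfm ha hb N).div_const _).mono
      detectedSpace_le le_rfl).aestronglyMeasurable
    (Fintype.card ι * Fintype.card κ)
    (D.prob.mono fun _ _ => div_nonneg (blockEnt_nonneg hfm ha hb N) (by positivity))
    (by filter_upwards [D.prob, hf] with y _ hy using blockEnt_div_le_card hy ha hb N)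

lemma tendsto_integral_blockEnt_div (hfm : Measurable f)
    (hf : ∀ᵐ y ∂ν, MeasurePreserving f (P y) (P y)) (ha : Measurable a) (hb : Measurable b) :
    Tendsto (fun N : ℕ => ∫ y, blockEnt f (P y) a b N / N ∂ν) atTop
      (𝓝 (∫ y, dynEnt f (P y) a b ∂ν)) := by
  refine tendsto_integral_of_dominated_convergence
    (fun _ => (Fintype.card ι * Fintype.card κ : ℝ))
    (fun N => (D.integrable_blockEnt_div hfm hf ha hb N).aestronglyMeasurable)
    (integrable_const _) (fun N => ?_) ?_
  · filter_upwards [D.prob, hf] with y _ hy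
    rw [norm_eq_abs, abs_of_nonneg (div_nonneg (blockEnt_nonneg hfm ha hb N) (by positivity))]
    exact blockEnt_div_le_card hy ha hb N
  · filter_upwards [D.prob, hf] with y _ hy
    exact tendsto_blockEnt_div hy ha hb

/-- The dynamical conditional entropy of a partition is the average of its values over the
disintegration. -/
theorem dynEnt_eq_integral (hfm : Measurable f)
    (hf : ∀ᵐ y ∂ν, MeasurePreserving f (P y) (P y)) (ha : Measurable a) (hb : Measurable b) :
    dynEnt f μ a b = ∫ y, dynEnt f (P y) a b ∂ν := by
  have hprob := D.isProbabilityMeasure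
  have hfμ := D.measurePreserving hfm hf
  have hlim := D.tendsto_integral_blockEnt_div hfm hf ha hb
  have hA := measurable_block hfm ha
  have hB := measurable_block hfm hb
  refine le_antisymm (ge_of_tendsto hlim ?_)
    (le_of_tendsto_of_tendsto' hlim (tendsto_blockEnt_div hfμ ha hb) fun N => ?_)
  · filter_upwards [eventually_gt_atTop 0] with N hN
    rw [integral_div, le_div_iff₀ (by exact_mod_cast hN)]
    refine le_of_forall_pos_le_add fun ε hε => ?_
    obtain ⟨m, e, g, hg, hge, habs⟩ := D.exists_conditioning (hA N) (hB N) hε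
    have hinv : ∀ᵐ x ∂μ, g (f x) = g x := by
      refine D.ae_of_ae_ae (measurableSet_eq_fun (hg.comp hfm) hg) ?_
      filter_upwards [hge, hf] with y hy hfy
      filter_upwards [hy, hfy.quasiMeasurePreserving.ae hy] with x h1 h2
      rw [h1, h2]
    have h1 := dynEnt_le_of_invariant hfμ ha hb hg hinv
    have h2 := dynEnt_le (μ := μ) hfm ha (hb.prodMk hg) hN.ne'
    have h3 : blockEnt f μ a (fun x => (b x, g x)) N ≤
        fibCondEnt μ (block f a N) (fun x => (block f b N x, g x)) := by
      refine fibCondEnt_anti_right (hA N) ((hB N).prodMk hg)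
        (measurable_block hfm (hb.prodMk hg) N) fun x y h => ?_
      rw [block_eq_iff] at h
      rw [Prod.mk.injEq, block_eq_iff]
      exact ⟨fun n hn => (Prod.ext_iff.1 (h n hn)).1, (Prod.ext_iff.1 (h 0 hN)).2⟩
    rw [le_div_iff₀ (by exact_mod_cast hN)] at h2
    have h4 : dynEnt f μ a b * N ≤ dynEnt f μ a (fun x => (b x, g x)) * N :=
      mul_le_mul_of_nonneg_right h1 (by positivity)
    rw [abs_le] at habs
    unfold blockEnt at *
    linarith
  · rw [integral_div]
    refine div_le_div_of_nonneg_right (le_of_forall_pos_le_add fun ε hε => ?_) (by positivity)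
    obtain ⟨m, e, g, hg, hge, habs⟩ := D.exists_conditioning (hA N) (hB N) hε
    have h1 : fibCondEnt μ (block f a N) (fun x => (block f b N x, g x)) ≤ blockEnt f μ a b N :=
      fibCondEnt_anti_right (hA N) (hB N) ((hB N).prodMk hg) fun x y h => (Prod.ext_iff.1 h).1
    rw [abs_le] at habs
    unfold blockEnt at *
    linarith

end IsDetectedDisintegration

end Disintegration

section Selectors

variable {X : Type*} [MeasurableSpace X] {μ : Measure X} {f : X → X}
variable {ι κ : Type*} [Fintype ι] [Fintype κ] [MeasurableSpace ι] [MeasurableSpace κ]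
  [MeasurableSingletonClass ι] [MeasurableSingletonClass κ]

/-- The measurable selectors of an indexed cover; their fibres are the partitions subordinate to
the cover. -/
def selectors (V : ι → Set X) : Set (X → ι) := {g | Measurable g ∧ ∀ x, x ∈ V (g x)}

/-- The dynamical conditional entropy of an indexed cover, as an infimum over selectors. -/
noncomputable def coverDynEnt (f : X → X) (μ : Measure X) (V : ι → Set X) (b : X → κ) : ℝ :=
  ⨅ g : selectors V, dynEnt f μ (g : X → ι) b

open Classical in
/-- An element of `s`, if there is one, and otherwise an element of `t`. -/
noncomputable def pick [Nonempty ι] (s t : ι → Prop) : ι :=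
  if ∃ i, s i then Classical.epsilon s else Classical.epsilon t

/-- The selector of `V` that follows the approximate instructions `C` wherever they make sense. -/
noncomputable def guidedSelector [Nonempty ι] (V C : ι → Set X) (x : X) : ι :=
  pick (fun i => x ∈ C i ∧ x ∈ V i) (fun i => x ∈ V i)

lemma guidedSelector_mem [Nonempty ι] {V C : ι → Set X} (hV : ∀ i, MeasurableSet (V i))
    (hcov : ∀ x, ∃ i, x ∈ V i) (hC : ∀ i, MeasurableSet (C i)) :
    guidedSelector V C ∈ selectors V := by
  constructor
  · have h : Measurable fun x => ((fun i => x ∈ C i ∧ x ∈ V i : ι → Prop), fun i => x ∈ V i) :=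
      (measurable_pi_lambda _ fun i => measurableSet_setOfPred.1 ((hC i).inter (hV i))).prodMk
        (measurable_pi_lambda _ fun i => measurableSet_setOfPred.1 (hV i))
    exact (Measurable.of_discrete (f := fun p : (ι → Prop) × (ι → Prop) => pick p.1 p.2)).comp h
  · intro x
    unfold guidedSelector pick
    split_ifs with h
    · exact (Classical.epsilon_spec h).2
    · exact Classical.epsilon_spec (hcov x)

lemma guidedSelector_eq [Nonempty ι] {V C : ι → Set X} {a : X → ι} (ha : a ∈ selectors V) {x : X}
    (hx : ∀ i, x ∈ C i ↔ a x = i) : guidedSelector V C x = a x := by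
  have h : ∃ i, x ∈ C i ∧ x ∈ V i := ⟨a x, (hx _).2 rfl, ha.2 x⟩
  unfold guidedSelector pick
  rw [if_pos h]
  exact ((hx _).1 (Classical.epsilon_spec h).1).symm

lemma selectors_nonempty [Nonempty ι] {V : ι → Set X} (hV : ∀ i, MeasurableSet (V i))
    (hcov : ∀ x, ∃ i, x ∈ V i) : Nonempty (selectors V) :=
  ⟨⟨_, guidedSelector_mem hV hcov hV⟩⟩

lemma exists_abs_fibEnt_sub_le {ε : ℝ} (hε : 0 < ε) : ∃ δ > 0, ∀ (m : Measure X)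
    [IsProbabilityMeasure m] (g g' : X → κ), Measurable g → Measurable g' →
    m.real {x | g x ≠ g' x} ≤ δ → |fibEnt m g - fibEnt m g'| ≤ ε := by
  set K : ℝ := Fintype.card κ + 1
  have hK : 0 < K := by positivity
  obtain ⟨δ, hδ, hunif⟩ := Metric.uniformContinuousOn_iff.1
    (isCompact_Icc.uniformContinuousOn_of_continuous
      (continuous_negMulLog.continuousOn (s := Set.Icc (0 : ℝ) 1))) (ε / K) (by positivity)
  refine ⟨δ / 2, half_pos hδ, fun m _ g g' hg hg' hgg => ?_⟩
  have hi : ∀ i, |negMulLog (m.real (g ⁻¹' {i})) - negMulLog (m.real (g' ⁻¹' {i}))| ≤ ε / K := by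
    intro i
    refine (hunif _ ⟨measureReal_nonneg, measureReal_le_one⟩ _
      ⟨measureReal_nonneg, measureReal_le_one⟩ ?_).le
    refine lt_of_le_of_lt ?_ (half_lt_self hδ)
    refine (abs_measureReal_sub_le_measureReal_symmDiff
      (hg (measurableSet_singleton i)).nullMeasurableSet
      (hg' (measurableSet_singleton i)).nullMeasurableSet).trans
      ((measureReal_mono fun x hx => ?_).trans hgg)
    rw [Set.mem_symmDiff] at hx
    rintro (h : g x = g' x)
    simp only [Set.mem_preimage, h, Set.mem_singleton_iff] at hx
    tauto
  unfold fibEnt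
  rw [← Finset.sum_sub_distrib]
  refine (Finset.abs_sum_le_sum_abs _ _).trans ((Finset.sum_le_sum fun i _ => hi i).trans ?_)
  rw [Finset.sum_const, Finset.card_univ, nsmul_eq_mul, ← mul_div_assoc, div_le_iff₀ hK, mul_comm]
  exact mul_le_mul_of_nonneg_left (by simp [K]) hε.le

/-- Countably many selectors approximate all of them, with respect to every probability measure. -/
lemma exists_dense_selectors [MeasurableSpace.CountablyGenerated X] [Nonempty ι]
    {V : ι → Set X} (hV : ∀ i, MeasurableSet (V i)) (hcov : ∀ x, ∃ i, x ∈ V i) :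
    ∃ s : ℕ → X → ι, (∀ j, s j ∈ selectors V) ∧ ∀ (m : Measure X) [IsProbabilityMeasure m],
      ∀ a ∈ selectors V, ∀ ε > 0, ∃ j, fibCondEnt m (s j) a ≤ ε := by
  set 𝒞 := generateSetAlgebra (MeasurableSpace.countableGeneratingSet X)
  have h𝒞 : 𝒞.Countable :=
    countable_generateSetAlgebra (MeasurableSpace.countable_countableGeneratingSet)
  have hgen : ‹MeasurableSpace X› = MeasurableSpace.generateFrom 𝒞 := by
    rw [generateFrom_generateSetAlgebra_eq, MeasurableSpace.generateFrom_countableGeneratingSet]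
  have hdense : ∀ (m : Measure X) [IsProbabilityMeasure m], m.MeasureDense 𝒞 := fun m _ =>
    Measure.MeasureDense.of_generateFrom_isSetAlgebra_finite m isSetAlgebra_generateSetAlgebra hgen
  have hmeas : ∀ c ∈ 𝒞, MeasurableSet c := fun c hc => by
    rw [hgen]
    exact MeasurableSpace.measurableSet_generateFrom hc
  have : Countable 𝒞 := h𝒞.to_subtype
  have : Nonempty 𝒞 := ⟨⟨∅, isSetAlgebra_generateSetAlgebra.empty_mem⟩⟩
  obtain ⟨φ, hφ⟩ := exists_surjective_nat (ι → 𝒞)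
  refine ⟨fun j => guidedSelector V fun i => φ j i,
    fun j => guidedSelector_mem hV hcov fun i => hmeas _ (φ j i).2, fun m _ a ha ε hε => ?_⟩
  obtain ⟨δ, hδ, hclose⟩ := exists_abs_fibEnt_sub_le (X := X) (κ := ι × ι) hε
  set K : ℝ := Fintype.card ι + 1
  have hK : 0 < K := by positivity
  have hex : ∀ i, ∃ t : 𝒞, m.real (symmDiff (a ⁻¹' {i}) t) ≤ δ / K := by
    intro i
    obtain ⟨t, ht, hlt⟩ := (hdense m).approx _ (ha.1 (measurableSet_singleton i))
      (measure_ne_top _ _) (δ / K) (by positivity)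
    exact ⟨⟨t, ht⟩, ENNReal.toReal_le_of_le_ofReal (by positivity) hlt.le⟩
  choose C hC using hex
  obtain ⟨j, rfl⟩ := hφ C
  refine ⟨j, ?_⟩
  have hs := guidedSelector_mem hV hcov fun i => hmeas _ (φ j i).2
  have h1 := hclose m (fun x => (guidedSelector V (fun i => φ j i) x, a x)) (fun x => (a x, a x))
    (hs.1.prodMk ha.1) (ha.1.prodMk ha.1) ?_
  · have h2 : fibEnt m (fun x => (a x, a x)) = fibEnt m a :=
      fibEnt_congr (ha.1.prodMk ha.1) ha.1 (by simp)
    rw [h2] at h1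
    exact (abs_le.1 h1).2
  · have hsub : {x | (guidedSelector V (fun i => φ j i) x, a x) ≠ (a x, a x)} ⊆
        ⋃ i, symmDiff (a ⁻¹' {i}) (φ j i) := by
      intro x hx
      by_contra hx'
      refine hx ?_
      rw [guidedSelector_eq ha fun i => ?_]
      simp only [Set.mem_iUnion, not_exists, Set.mem_symmDiff, Set.mem_preimage,
        Set.mem_singleton_iff] at hx'
      have := hx' i
      tauto
    refine (measureReal_mono hsub).trans ((measureReal_iUnion_fintype_le _).trans
      ((Finset.sum_le_sum fun i _ => hC i).trans ?_))
    rw [Finset.sum_const, Finset.card_univ, nsmul_eq_mul, ← mul_div_assoc, div_le_iff₀ hK, mul_comm]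
    exact mul_le_mul_of_nonneg_left (by simp [K]) hδ.le

variable {V : ι → Set X} {b : X → κ}

lemma bddBelow_selectors [IsFiniteMeasure μ] (hf : Measurable f) (hb : Measurable b) :
    BddBelow (Set.range fun g : selectors V => dynEnt f μ (g : X → ι) b) :=
  ⟨0, by rintro _ ⟨g, rfl⟩; exact dynEnt_nonneg hf g.2.1 hb⟩

lemma coverDynEnt_le [IsFiniteMeasure μ] (hf : Measurable f) (hb : Measurable b) {g : X → ι}
    (hg : g ∈ selectors V) : coverDynEnt f μ V b ≤ dynEnt f μ g b :=
  ciInf_le (bddBelow_selectors hf hb) (⟨g, hg⟩ : selectors V)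

lemma coverDynEnt_nonneg [IsFiniteMeasure μ] (hf : Measurable f) (hb : Measurable b) :
    0 ≤ coverDynEnt f μ V b :=
  Real.iInf_nonneg fun g => dynEnt_nonneg hf g.2.1 hb

end Selectors

section CoverDisintegration

variable {X Y : Type*} [MeasurableSpace X] [mY : MeasurableSpace Y]
  [MeasurableSpace.CountablyGenerated X] {μ : Measure X} {ν : Measure Y} [IsProbabilityMeasure ν]
  {P : Y → Measure X}
variable {ι κ : Type*} [Fintype ι] [Fintype κ] [MeasurableSpace ι] [MeasurableSpace κ]
  [MeasurableSingletonClass ι] [MeasurableSingletonClass κ] [Nonempty ι]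
variable {f : X → X} {V : ι → Set X} {b : X → κ}

namespace IsDetectedDisintegration

variable (D : IsDetectedDisintegration μ ν P)
include D

lemma exists_measurable_coverDynEnt (hfm : Measurable f)
    (hf : ∀ᵐ y ∂ν, MeasurePreserving f (P y) (P y)) (hV : ∀ i, MeasurableSet (V i))
    (hcov : ∀ x, ∃ i, x ∈ V i) (hb : Measurable b) :
    ∃ s : ℕ → X → ι, (∀ j, s j ∈ selectors V) ∧ ∃ F : Y → ℝ, Measurable[detectedSpace ν P] F ∧
      (∀ᵐ y ∂ν, coverDynEnt f (P y) V b = F y) ∧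
      ∀ᵐ y ∂ν, ∀ ε > 0, ∃ j, dynEnt f (P y) (s j) b < F y + ε := by
  obtain ⟨s, hs, hdense⟩ := exists_dense_selectors hV hcov
  have key : ∀ᵐ y ∂ν, coverDynEnt f (P y) V b = ⨅ j, dynEnt f (P y) (s j) b := by
    filter_upwards [D.prob, hf] with y _ hfy
    have := selectors_nonempty hV hcov
    have hbdd : BddBelow (Set.range fun j => dynEnt f (P y) (s j) b) :=
      ⟨0, by rintro _ ⟨j, rfl⟩; exact dynEnt_nonneg hfm (hs j).1 hb⟩
    refine le_antisymm (le_ciInf fun j => coverDynEnt_le hfm hb (hs j)) (le_ciInf fun g => ?_)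
    refine le_of_forall_pos_le_add fun ε hε => ?_
    obtain ⟨j, hj⟩ := hdense (P y) g g.2 ε hε
    exact (ciInf_le hbdd j).trans ((dynEnt_le_add hfy g.2.1 (hs j).1 hb).trans
      (by linarith))
  refine ⟨s, hs, fun y => ⨅ j, dynEnt f (P y) (s j) b,
    Measurable.iInf fun j => D.measurable_dynEnt hfm (hs j).1 hb, key, ae_of_all _ fun y ε hε => ?_⟩
  exact exists_lt_of_ciInf_lt (lt_add_of_pos_right _ hε)

lemma integrable_coverDynEnt (hfm : Measurable f)
    (hf : ∀ᵐ y ∂ν, MeasurePreserving f (P y) (P y)) (hV : ∀ i, MeasurableSet (V i))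
    (hcov : ∀ x, ∃ i, x ∈ V i) (hb : Measurable b) :
    Integrable (fun y => coverDynEnt f (P y) V b) ν := by
  obtain ⟨s, hs, F, hF, hFeq, -⟩ := D.exists_measurable_coverDynEnt hfm hf hV hcov hb
  refine D.integrable_of_bound
    ((hF.mono detectedSpace_le le_rfl).aemeasurable.congr
      (hFeq.mono fun y hy => hy.symm)).aestronglyMeasurable
    (Fintype.card ι * Fintype.card κ) (D.prob.mono fun y _ => coverDynEnt_nonneg hfm hb) ?_
  filter_upwards [D.prob, hf] with y _ hfy
  exact (coverDynEnt_le hfm hb (hs 0)).trans (dynEnt_le_card hfy (hs 0).1 hb)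

/-- The dynamical conditional entropy of a cover is the average of its values over the
disintegration. -/
theorem coverDynEnt_eq_integral (hfm : Measurable f)
    (hf : ∀ᵐ y ∂ν, MeasurePreserving f (P y) (P y)) (hV : ∀ i, MeasurableSet (V i))
    (hcov : ∀ x, ∃ i, x ∈ V i) (hb : Measurable b) :
    coverDynEnt f μ V b = ∫ y, coverDynEnt f (P y) V b ∂ν := by
  classical
  have hprob := D.isProbabilityMeasure
  have h_int := D.integrable_coverDynEnt hfm hf hV hcov hb
  have hintd : ∀ g ∈ selectors V, Integrable (fun y => dynEnt f (P y) g b) ν := fun g hg =>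
    D.integrable_of_bound ((D.measurable_dynEnt hfm hg.1 hb).mono
      detectedSpace_le le_rfl).aestronglyMeasurable (Fintype.card ι * Fintype.card κ)
      (D.prob.mono fun y _ => dynEnt_nonneg hfm hg.1 hb)
      (by filter_upwards [D.prob, hf] with y _ hfy using dynEnt_le_card hfy hg.1 hb)
  refine le_antisymm (le_of_forall_pos_le_add fun ε hε => ?_) ?_
  · obtain ⟨s, hs, F, hF, hFeq, hlt⟩ := D.exists_measurable_coverDynEnt hfm hf hV hcov hb
    have hmd := fun j => D.measurable_dynEnt hfm (hs j).1 hb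
    have hex : ∀ y, ∃ j, dynEnt f (P y) (s j) b < F y + ε ∨
        ∀ k, ¬ dynEnt f (P y) (s k) b < F y + ε := fun y => by
      by_cases h : ∃ j, dynEnt f (P y) (s j) b < F y + ε
      · exact h.imp fun j hj => Or.inl hj
      · exact ⟨0, Or.inr (not_exists.1 h)⟩
    have hlt_meas : ∀ j, MeasurableSet[detectedSpace ν P]
        {y | dynEnt f (P y) (s j) b < F y + ε} := fun j =>
      measurableSet_lt (hmd j) (hF.add_const ε)
    have he : Measurable[detectedSpace ν P] fun y => Nat.find (hex y) := by
      refine measurable_find hex fun j => (hlt_meas j).union ?_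
      have : {y | ∀ k, ¬ dynEnt f (P y) (s k) b < F y + ε} =
          ⋂ k, {y | dynEnt f (P y) (s k) b < F y + ε}ᶜ := by
        ext y
        simp
      have h' : MeasurableSet[detectedSpace ν P] {y | ∀ k, ¬ dynEnt f (P y) (s k) b < F y + ε} := by
        rw [this]
        exact MeasurableSet.iInter fun k => (hlt_meas k).compl
      exact h'
    obtain ⟨j, hj, hje⟩ := exists_detecting_nat he
    set a : X → ι := fun x => s (j x) x
    have ha : a ∈ selectors V :=
      ⟨(measurable_from_prod_countable_right (f := fun p : ℕ × X => s p.1 p.2)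
        fun k => (hs k).1).comp (hj.prodMk measurable_id), fun x => (hs (j x)).2 x⟩
    refine (coverDynEnt_le hfm hb ha).trans ?_
    rw [D.dynEnt_eq_integral hfm hf ha.1 hb]
    have : ∫ y, coverDynEnt f (P y) V b ∂ν + ε = ∫ y, (coverDynEnt f (P y) V b + ε) ∂ν := by
      rw [integral_add h_int (integrable_const _)]
      simp
    rw [this]
    refine integral_mono_ae (hintd a ha) (h_int.add (integrable_const _)) ?_
    filter_upwards [hje, hFeq, hlt, hf] with y h1 h2 h3 hfy
    have h4 : a =ᵐ[P y] s (Nat.find (hex y)) := h1.mono fun x hx => by simp only [a, hx]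
    rw [dynEnt_congr_ae hfy h4 (ae_eq_refl b), h2]
    rcases Nat.find_spec (hex y) with h5 | h5
    · exact h5.le
    · obtain ⟨k, hk⟩ := h3 ε hε
      exact absurd hk (h5 k)
  · have := selectors_nonempty hV hcov
    refine le_ciInf fun g => ?_
    rw [D.dynEnt_eq_integral hfm hf g.2.1 hb]
    refine integral_mono_ae h_int (hintd g g.2) ?_
    filter_upwards [D.prob] with y _
    exact coverDynEnt_le hfm hb g.2

end IsDetectedDisintegration

end CoverDisintegration

section BlockCover

variable {X : Type*} [MeasurableSpace X] {μ : Measure X} {f : X → X}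
variable {ι κ : Type*} [Fintype ι] [Fintype κ] [MeasurableSpace ι] [MeasurableSpace κ]
  [MeasurableSingletonClass ι] [MeasurableSingletonClass κ]

/-- The indexed join of the first `M` preimages of an indexed cover. -/
def blockCover (f : X → X) (V : ι → Set X) (M : ℕ) (w : Fin M → ι) : Set X :=
  {x | ∀ n, f^[n] x ∈ V (w n)}

lemma measurableSet_blockCover (hf : Measurable f) {V : ι → Set X}
    (hV : ∀ i, MeasurableSet (V i)) (M : ℕ) (w : Fin M → ι) :
    MeasurableSet (blockCover f V M w) := by
  have : blockCover f V M w = ⋂ n : Fin M, f^[n] ⁻¹' V (w n) := by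
    ext x
    simp [blockCover]
  rw [this]
  exact MeasurableSet.iInter fun n => hf.iterate n (hV _)

lemma exists_mem_blockCover (f : X → X) {V : ι → Set X} (hcov : ∀ x, ∃ i, x ∈ V i) (M : ℕ)
    (x : X) : ∃ w, x ∈ blockCover f V M w := by
  choose c hc using hcov
  exact ⟨fun n => c (f^[n] x), fun n => hc _⟩

/-- The static conditional entropy of an indexed cover. -/
noncomputable def coverCondEnt (μ : Measure X) (V : ι → Set X) (b : X → κ) : ℝ :=
  ⨅ g : selectors V, fibCondEnt μ (g : X → ι) b

/-- The dynamical conditional entropy of an indexed cover, as the growth rate of the static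
conditional entropies of its iterated joins. -/
noncomputable def coverJoinEnt (f : X → X) (μ : Measure X) (V : ι → Set X) (b : X → κ) : ℝ :=
  ⨅ N : ℕ, coverCondEnt μ (blockCover f V (N + 1)) (block f b (N + 1)) / (N + 1 : ℝ)

variable {V : ι → Set X} {b : X → κ}

lemma coverCondEnt_nonneg [IsFiniteMeasure μ] (hb : Measurable b) : 0 ≤ coverCondEnt μ V b :=
  Real.iInf_nonneg fun g => fibCondEnt_nonneg g.2.1 hb

lemma coverCondEnt_le [IsFiniteMeasure μ] (hb : Measurable b) {g : X → ι}
    (hg : g ∈ selectors V) : coverCondEnt μ V b ≤ fibCondEnt μ g b :=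
  ciInf_le ⟨0, by rintro _ ⟨g, rfl⟩; exact fibCondEnt_nonneg g.2.1 hb⟩ (⟨g, hg⟩ : selectors V)

lemma coverJoinEnt_le [IsFiniteMeasure μ] (hf : Measurable f) (hb : Measurable b) {N : ℕ}
    (hN : N ≠ 0) :
    coverJoinEnt f μ V b ≤ coverCondEnt μ (blockCover f V N) (block f b N) / N := by
  obtain ⟨N, rfl⟩ := Nat.exists_eq_succ_of_ne_zero hN
  have : BddBelow (Set.range fun N : ℕ =>
      coverCondEnt μ (blockCover f V (N + 1)) (block f b (N + 1)) / (N + 1 : ℝ)) :=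
    ⟨0, by
      rintro _ ⟨N, rfl⟩
      exact div_nonneg (coverCondEnt_nonneg (measurable_block hf hb _)) (by positivity)⟩
  simpa [coverJoinEnt] using ciInf_le this N

/-- The concatenation of `k` consecutive values of a selector of an `M`-fold join. -/
def concat (f : X → X) {M : ℕ} (k : ℕ) (g : X → Fin M → ι) (x : X) (i : Fin (k * M)) : ι :=
  g ((f^[M])^[i.divNat] x) i.modNat

lemma concat_mem_selectors (hf : Measurable f) {M : ℕ} (k : ℕ) {g : X → Fin M → ι}
    (hg : g ∈ selectors (blockCover f V M)) :
    concat f k g ∈ selectors (blockCover f V (k * M)) := by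
  refine ⟨measurable_pi_lambda _ fun i => (measurable_pi_apply _).comp
    (hg.1.comp ((hf.iterate M).iterate _)), fun x i => ?_⟩
  have h := hg.2 ((f^[M])^[i.divNat] x) i.modNat
  rwa [← Function.iterate_mul, ← Function.iterate_add_apply, Fin.coe_modNat, Fin.coe_divNat,
    Nat.mod_add_div, Function.iterate_mul] at h

lemma concat_eq_of_block_eq {M k : ℕ} {g : X → Fin M → ι} (x y : X)
    (h : block (f^[M]) g k x = block (f^[M]) g k y) : concat f k g x = concat f k g y := by
  rw [block_eq_iff] at h
  funext i
  exact congrFun (h _ i.divNat.2) _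

lemma coverCondEnt_concat_le [IsFiniteMeasure μ] (hf : Measurable f) (hb : Measurable b) {M : ℕ}
    (k : ℕ) {g : X → Fin M → ι} (hg : g ∈ selectors (blockCover f V M)) :
    coverCondEnt μ (blockCover f V (k * M)) (block f b (k * M)) ≤
      blockEnt (f^[M]) μ g (block f b M) k := by
  have hc := concat_mem_selectors hf k hg
  have hB := measurable_block hf hb (k * M)
  have hB' := measurable_block (hf.iterate M) (measurable_block hf hb M) k
  have hG := measurable_block (hf.iterate M) hg.1 k
  refine (coverCondEnt_le hB hc).trans ((fibCondEnt_mono_left hG hB concat_eq_of_block_eq).trans ?_)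
  refine fibCondEnt_anti_right hG hB' hB fun x y h => ?_
  rwa [block_block_eq_iff, mul_comm]

lemma coverJoinEnt_le_coverDynEnt [IsFiniteMeasure μ] (hf : Measurable f) (hb : Measurable b)
    {M : ℕ} (hM : M ≠ 0) (hne : Nonempty (selectors (blockCover f V M))) :
    coverJoinEnt f μ V b ≤ coverDynEnt (f^[M]) μ (blockCover f V M) (block f b M) / M := by
  have hM0 : (0 : ℝ) < M := by positivity
  rw [le_div_iff₀ hM0]
  refine le_ciInf fun g => le_ciInf fun N => ?_
  have h1 := coverJoinEnt_le (μ := μ) (V := V) hf hb (N := (N + 1) * M) (by positivity)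
  have h2 := coverCondEnt_concat_le (μ := μ) hf hb (N + 1) g.2
  rw [le_div_iff₀ (by positivity)] at h1 ⊢
  push_cast at h1
  linarith

lemma coverDynEnt_le_coverCondEnt [IsFiniteMeasure μ] (hf : Measurable f) (hb : Measurable b)
    {M : ℕ} (hne : Nonempty (selectors (blockCover f V M))) :
    coverDynEnt (f^[M]) μ (blockCover f V M) (block f b M) ≤
      coverCondEnt μ (blockCover f V M) (block f b M) := by
  have hB := measurable_block hf hb M
  refine le_ciInf fun g => (coverDynEnt_le (hf.iterate M) hB g.2).trans ?_
  have := dynEnt_le (μ := μ) (hf.iterate M) g.2.1 hB one_ne_zero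
  rwa [blockEnt_one (hf.iterate M) g.2.1 hB, Nat.cast_one, div_one] at this

lemma coverDynEnt_mul_le [IsFiniteMeasure μ] (hf : MeasurePreserving f μ μ) (hb : Measurable b)
    {M k : ℕ} (hk : k ≠ 0) (hne : Nonempty (selectors (blockCover f V M))) :
    coverDynEnt (f^[k * M]) μ (blockCover f V (k * M)) (block f b (k * M)) ≤
      k * coverDynEnt (f^[M]) μ (blockCover f V M) (block f b M) := by
  have hk0 : (0 : ℝ) < k := by positivity
  rw [← div_le_iff₀' hk0]
  refine le_ciInf fun g => ?_
  rw [div_le_iff₀' hk0]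
  have hfM := hf.measurable.iterate M
  have hc := concat_mem_selectors hf.measurable k g.2
  have hB := measurable_block hf.measurable hb (k * M)
  have hB' := measurable_block hf.measurable hb M
  refine (coverDynEnt_le (hf.measurable.iterate _) hB hc).trans
    (le_trans ?_ (dynEnt_iterate_le (hf.iterate M) g.2.1 hB' hk))
  have hiter : f^[k * M] = (f^[M])^[k] := by rw [mul_comm, Function.iterate_mul]
  rw [hiter, dynEnt_congr (hfM.iterate k) hc.1 hc.1 hB
    (measurable_block hfM hB' k) (fun _ _ => Iff.rfl)
    fun x y => by rw [block_block_eq_iff, mul_comm]]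
  exact dynEnt_mono_left (hfM.iterate k) hc.1 (measurable_block hfM g.2.1 k)
    (measurable_block hfM hB' k) concat_eq_of_block_eq

/-- The approximation of `coverJoinEnt` by partitions subordinate to an `M`-fold join. -/
noncomputable def powerEnt (f : X → X) (μ : Measure X) (V : ι → Set X) (b : X → κ) (M : ℕ) : ℝ :=
  coverDynEnt (f^[M]) μ (blockCover f V M) (block f b M) / M

lemma powerEnt_le_of_dvd [IsFiniteMeasure μ] (hf : MeasurePreserving f μ μ) (hb : Measurable b)
    {M N : ℕ} (hN : N ≠ 0) (hMN : M ∣ N) (hne : Nonempty (selectors (blockCover f V M))) :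
    powerEnt f μ V b N ≤ powerEnt f μ V b M := by
  obtain ⟨k, rfl⟩ := hMN
  rw [mul_comm] at hN ⊢
  obtain ⟨hk, hM⟩ := mul_ne_zero_iff.1 hN
  have hM0 : (0 : ℝ) < M := by positivity
  have hk0 : (0 : ℝ) < k := by positivity
  rw [powerEnt, powerEnt, div_le_div_iff₀ (by positivity) hM0, Nat.cast_mul]
  have := mul_le_mul_of_nonneg_right (coverDynEnt_mul_le hf hb hk hne) hM0.le
  linarith

lemma tendsto_powerEnt_factorial [IsFiniteMeasure μ] (hf : MeasurePreserving f μ μ)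
    (hb : Measurable b) (hne : ∀ M, Nonempty (selectors (blockCover f V M))) :
    Tendsto (fun n : ℕ => powerEnt f μ V b n.factorial) atTop (𝓝 (coverJoinEnt f μ V b)) := by
  refine tendsto_order.2 ⟨fun c hc => Eventually.of_forall fun n => hc.trans_le
    (coverJoinEnt_le_coverDynEnt hf.measurable hb n.factorial_ne_zero (hne _)), fun c hc => ?_⟩
  obtain ⟨N, hN⟩ := exists_lt_of_ciInf_lt hc
  filter_upwards [eventually_ge_atTop (N + 1)] with n hn
  refine (powerEnt_le_of_dvd hf hb n.factorial_ne_zero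
    (Nat.dvd_factorial (Nat.succ_pos N) hn) (hne _)).trans_lt (lt_of_le_of_lt ?_ hN)
  rw [powerEnt, Nat.cast_succ]
  exact div_le_div_of_nonneg_right (coverDynEnt_le_coverCondEnt hf.measurable hb (hne _))
    (by positivity)

lemma powerEnt_factorial_le [IsProbabilityMeasure μ] (hf : MeasurePreserving f μ μ)
    (hb : Measurable b) (hne : ∀ M, Nonempty (selectors (blockCover f V M))) (n : ℕ) :
    powerEnt f μ V b n.factorial ≤ Fintype.card (Fin 1 → ι) * Fintype.card (Fin 1 → κ) := by
  obtain ⟨g⟩ := hne 1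
  refine (powerEnt_le_of_dvd hf hb n.factorial_ne_zero (one_dvd _) (hne _)).trans ?_
  rw [powerEnt, Nat.cast_one, div_one]
  have hB := measurable_block hf.measurable hb 1
  exact (coverDynEnt_le (hf.measurable.iterate 1) hB g.2).trans
    (dynEnt_le_card (hf.iterate 1) g.2.1 hB)

lemma powerEnt_nonneg [IsFiniteMeasure μ] (hf : Measurable f) (hb : Measurable b) (M : ℕ) :
    0 ≤ powerEnt f μ V b M :=
  div_nonneg (coverDynEnt_nonneg (hf.iterate M) (measurable_block hf hb M)) (by positivity)

/-- The growth rate of the entropies of the iterated joins of a cover is the average of its values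
over the disintegration. -/
theorem IsDetectedDisintegration.coverJoinEnt_eq_integral
    [MeasurableSpace.CountablyGenerated X] [Nonempty ι] {Y : Type*} [MeasurableSpace Y]
    {ν : Measure Y} [IsProbabilityMeasure ν] {P : Y → Measure X}
    (D : IsDetectedDisintegration μ ν P) (hfm : Measurable f)
    (hf : ∀ᵐ y ∂ν, MeasurePreserving f (P y) (P y)) (hV : ∀ i, MeasurableSet (V i))
    (hcov : ∀ x, ∃ i, x ∈ V i) (hb : Measurable b) :
    coverJoinEnt f μ V b = ∫ y, coverJoinEnt f (P y) V b ∂ν := by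
  have hprob := D.isProbabilityMeasure
  have hVm := measurableSet_blockCover hfm hV
  have hVc := exists_mem_blockCover f hcov
  have hne : ∀ M, Nonempty (selectors (blockCover f V M)) := fun M =>
    selectors_nonempty (hVm M) (hVc M)
  have hfM : ∀ M, ∀ᵐ y ∂ν, MeasurePreserving (f^[M]) (P y) (P y) := fun M =>
    hf.mono fun y hy => hy.iterate M
  have hpow : ∀ M, powerEnt f μ V b M = ∫ y, powerEnt f (P y) V b M ∂ν := fun M => by
    unfold powerEnt
    rw [integral_div, D.coverDynEnt_eq_integral (hfm.iterate M) (hfM M) (hVm M) (hVc M)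
      (measurable_block hfm hb M)]
  refine tendsto_nhds_unique (tendsto_powerEnt_factorial (D.measurePreserving hfm hf) hb hne) ?_
  simp only [hpow]
  refine tendsto_integral_of_dominated_convergence
    (fun _ => (Fintype.card (Fin 1 → ι) * Fintype.card (Fin 1 → κ) : ℝ)) (fun n => ?_)
    (integrable_const _) (fun n => ?_) ?_
  · exact ((D.integrable_coverDynEnt (hfm.iterate _) (hfM _) (hVm _) (hVc _)
      (measurable_block hfm hb _)).div_const _).aestronglyMeasurable
  · filter_upwards [D.prob, hf] with y _ hy
    rw [norm_eq_abs, abs_of_nonneg (powerEnt_nonneg hfm hb _)]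
    exact powerEnt_factorial_le hy hb hne n
  · filter_upwards [D.prob, hf] with y _ hy
    exact tendsto_powerEnt_factorial hy hb hne

end BlockCover

section Fibering

variable {X : Type*} {ι κ : Type*}

/-- The nonempty members of the family `γ` are exactly the nonempty fibres of `g`. -/
structure IsFibering (g : X → ι) (γ : Finset (Set X)) : Prop where
  fiber_mem : ∀ x, g ⁻¹' {g x} ∈ γ
  eq_fiber : ∀ C ∈ γ, ∀ x ∈ C, C = g ⁻¹' {g x}

lemma IsFibering.sum_eq [Fintype ι] {g : X → ι} {γ : Finset (Set X)} (h : IsFibering g γ)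
    (F : Set X → ℝ) (hF : F ∅ = 0) : ∑ C ∈ γ, F C = ∑ i, F (g ⁻¹' {i}) := by
  have hne : ∀ C, F C ≠ 0 → C.Nonempty := fun C hC => Set.nonempty_iff_ne_empty.2 fun h0 =>
    hC (h0 ▸ hF)
  symm
  refine Finset.sum_bij_ne_zero (fun i _ _ => g ⁻¹' {i}) (fun i _ hi => ?_)
    (fun i _ hi j _ hj hij => ?_) (fun C hC hFC => ?_) fun _ _ _ => rfl
  · obtain ⟨x, rfl⟩ := hne _ hi
    exact h.fiber_mem x
  · obtain ⟨x, rfl⟩ := hne _ hi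
    exact (Set.ext_iff.1 hij x).1 rfl
  · obtain ⟨x, hx⟩ := hne C hFC
    have hCx := h.eq_fiber C hC x hx
    exact ⟨g x, Finset.mem_univ _, hCx ▸ hFC, hCx.symm⟩

lemma IsFibering.congr {g : X → ι} {g' : X → κ} {γ : Finset (Set X)} (h : IsFibering g γ)
    (hg : ∀ x y, g x = g y ↔ g' x = g' y) : IsFibering g' γ := by
  have : ∀ x, g' ⁻¹' {g' x} = g ⁻¹' {g x} := fun x => by
    ext y
    exact (hg y x).symm
  exact ⟨fun x => this x ▸ h.fiber_mem x, fun C hC x hx => this x ▸ h.eq_fiber C hC x hx⟩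

lemma IsFibering.join {g : X → ι} {g' : X → κ} {γ γ' : Finset (Set X)} (h : IsFibering g γ)
    (h' : IsFibering g' γ') : IsFibering (fun x => (g x, g' x)) (join γ γ') := by
  classical
  have key : ∀ x, (fun x => (g x, g' x)) ⁻¹' {(g x, g' x)} = g ⁻¹' {g x} ∩ g' ⁻¹' {g' x} := by
    intro x
    ext y
    simp
  constructor
  · intro x
    rw [key]
    exact Finset.mem_image.2 ⟨(_, _), Finset.mem_product.2 ⟨h.fiber_mem x, h'.fiber_mem x⟩, rfl⟩
  · intro C hC x hx
    obtain ⟨⟨A, B⟩, hAB, rfl⟩ := Finset.mem_image.1 hC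
    rw [Finset.mem_product] at hAB
    rw [key, ← h.eq_fiber A hAB.1 x hx.1, ← h'.eq_fiber B hAB.2 x hx.2]

lemma IsFibering.pre {Y : Type*} {g : X → ι} {γ : Finset (Set X)} (h : IsFibering g γ)
    (f : Y → X) : IsFibering (fun y => g (f y)) (pre f γ) := by
  classical
  constructor
  · exact fun y => Finset.mem_image.2 ⟨_, h.fiber_mem (f y), rfl⟩
  · intro C hC y hy
    obtain ⟨A, hA, rfl⟩ := Finset.mem_image.1 hC
    rw [h.eq_fiber A hA (f y) hy]
    rfl

lemma IsFibering.itinerary {g : X → ι} {γ : Finset (Set X)} (h : IsFibering g γ) (f : X → X)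
    (N : ℕ) :
    IsFibering (block f g N) (dynJoin f γ N) := by
  induction N with
  | zero =>
    have : ∀ x, block f g 0 ⁻¹' {block f g 0 x} = Set.univ := fun x => by
      ext y
      simp [eq_iff_true_of_subsingleton]
    constructor
    · exact fun x => by simp [this, dynJoin]
    · exact fun C hC x _ => by rw [this]; simpa [dynJoin] using hC
  | succ N ih =>
    refine (ih.join (h.pre (f^[N]))).congr fun x y => ?_
    simp only [Prod.mk.injEq, block, funext_iff, Fin.forall_iff]
    refine ⟨fun hxy n hn => ?_, fun hxy => ⟨fun n hn => hxy n (by omega), hxy N (by omega)⟩⟩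
    rcases Nat.lt_succ_iff_lt_or_eq.1 hn with h1 | rfl
    · exact hxy.1 n h1
    · exact hxy.2

lemma range_blockCover {V : ι → Set X} {𝒰 : Finset (Set X)} (h : Set.range V = 𝒰) (f : X → X)
    (N : ℕ) : Set.range (blockCover f V N) = dynJoin f 𝒰 N := by
  classical
  induction N with
  | zero =>
    have : ∀ w, blockCover f V 0 w = Set.univ := fun w => by
      ext y
      simp [blockCover]
    ext C
    simp [this, dynJoin, eq_comm]
  | succ N ih =>
    have key : ∀ w i, blockCover f V (N + 1) (Fin.snoc w i : Fin (N + 1) → ι) =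
        blockCover f V N w ∩ f^[N] ⁻¹' V i := by
      intro w i
      ext x
      simp [blockCover, Fin.forall_fin_succ']
    ext C
    have hmem : C ∈ dynJoin f 𝒰 (N + 1) ↔
        ∃ A ∈ (dynJoin f 𝒰 N : Set (Set X)), ∃ B ∈ (𝒰 : Set (Set X)), A ∩ f^[N] ⁻¹' B = C := by
      simp [dynJoin, join, pre]
      tauto
    rw [Finset.mem_coe, hmem, ← ih, ← h]
    simp only [Set.exists_range_iff, ← key]
    constructor
    · rintro ⟨w, rfl⟩
      exact ⟨fun n => w n.castSucc, w (Fin.last N), by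
        congr 1
        exact Fin.snoc_init_self w⟩
    · rintro ⟨w, i, rfl⟩
      exact ⟨_, rfl⟩

end Fibering

section FinsetEntropy

variable {X : Type*} [MeasurableSpace X] {μ : Measure X} {f : X → X}
variable {ι κ : Type*} [Fintype ι] [Fintype κ] [MeasurableSpace ι] [MeasurableSpace κ]
  [MeasurableSingletonClass ι] [MeasurableSingletonClass κ]

lemma entPart_eq_fibEnt {g : X → ι} {γ : Finset (Set X)} (h : IsFibering g γ) :
    entPart μ γ = fibEnt μ g :=
  h.sum_eq (fun C => negMulLog (μ C).toReal) (by simp)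

lemma entCondPart_eq_fibCondEnt [IsFiniteMeasure μ] {a : X → ι} {b : X → κ}
    {γ δ : Finset (Set X)} (hγ : IsFibering a γ) (hδ : IsFibering b δ) (ha : Measurable a)
    (hb : Measurable b) : entCondPart μ γ δ = fibCondEnt μ a b := by
  rw [fibCondEnt_eq_sum_cond ha hb]
  simp only [entCondPart, entPart_eq_fibEnt hγ]
  exact hδ.sum_eq (fun B => (μ B).toReal * fibEnt (ProbabilityTheory.cond μ B) a) (by simp)

lemma hPart_eq_dynEnt [IsFiniteMeasure μ] (hf : Measurable f) {a : X → ι} {b : X → κ}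
    {γ δ : Finset (Set X)} (hγ : IsFibering a γ) (hδ : IsFibering b δ) (ha : Measurable a)
    (hb : Measurable b) : hPart f μ γ δ = dynEnt f μ a b :=
  iInf_congr fun N => by
    rw [entCondPart_eq_fibCondEnt (hγ.itinerary f _) (hδ.itinerary f _) (measurable_block hf ha _)
      (measurable_block hf hb _), blockEnt]

lemma exists_enumeration (𝒰 : Finset (Set X)) :
    ∃ V : Fin 𝒰.card → Set X, Function.Injective V ∧ Set.range V = 𝒰 :=
  ⟨fun i => 𝒰.equivFin.symm i, Subtype.val_injective.comp 𝒰.equivFin.symm.injective, by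
    rw [Set.range_comp' Subtype.val 𝒰.equivFin.symm]
    simp⟩

lemma exists_mem_of_range {V : ι → Set X} {𝒰 : Finset (Set X)} (h𝒰 : IsCover 𝒰)
    (hV : Set.range V = 𝒰) (x : X) : ∃ i, x ∈ V i := by
  have : x ∈ ⋃₀ Set.range V := by rw [hV, h𝒰]; trivial
  simpa using this

lemma exists_isFibering [Nonempty X] {γ : Finset (Set X)} (hγ : IsPartition γ) (hm : MeasF γ) :
    ∃ n : ℕ, ∃ g : X → Fin n, Measurable g ∧ IsFibering g γ := by
  obtain ⟨V, hinj, hV⟩ := exists_enumeration γ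
  have hcov := exists_mem_of_range hγ.1 hV
  have hmem : ∀ i, V i ∈ γ := fun i => Finset.mem_coe.1 (hV ▸ Set.mem_range_self i)
  have : Nonempty (Fin γ.card) := ⟨(hcov (Classical.arbitrary X)).choose⟩
  obtain ⟨g, hg, hgV⟩ := (selectors_nonempty (fun i => hm _ (hmem i)) hcov).some
  have huniq : ∀ A ∈ γ, ∀ B ∈ γ, ∀ x ∈ A, x ∈ B → A = B := fun A hA B hB x hxA hxB => by
    by_contra hne
    exact Set.disjoint_left.1 (hγ.2 A hA B hB hne) hxA hxB
  have hfib : ∀ x, g ⁻¹' {g x} = V (g x) := fun x => by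
    ext y
    refine ⟨fun (hy : g y = g x) => hy ▸ hgV y, fun hy => ?_⟩
    exact hinj (huniq _ (hmem _) _ (hmem _) y (hgV y) hy)
  exact ⟨_, g, hg, fun x => hfib x ▸ hmem _, fun C hC x hx => by
    rw [hfib]
    exact huniq C hC _ (hmem _) x hx (hgV x)⟩

/-- An infimum over measurable partitions finer than a cover is an infimum over selectors. -/
lemma sInf_partitions_eq_iInf_selectors [Nonempty X] {𝒰 : Finset (Set X)} {V : ι → Set X}
    (hV : Set.range V = 𝒰) (hne : Nonempty (selectors V)) {Φ : Finset (Set X) → ℝ}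
    {Ψ : (X → ι) → ℝ}
    (hΦΨ : ∀ g ∈ selectors V, ∀ α, IsFibering g α → Φ α = Ψ g)
    (hΨΦ : ∀ α (n : ℕ) (g : X → Fin n) (φ : Fin n → ι), Measurable g → IsFibering g α →
      Ψ (fun x => φ (g x)) ≤ Φ α)
    (hΨ : ∀ g ∈ selectors V, 0 ≤ Ψ g) :
    sInf {h : ℝ | ∃ α : Finset (Set X), IsPartition α ∧ MeasF α ∧ Refines α 𝒰 ∧ h = Φ α} =
      ⨅ g : selectors V, Ψ g := by
  classical
  have hbdd : BddBelow (Set.range fun g : selectors V => Ψ g) :=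
    ⟨0, by rintro _ ⟨g, rfl⟩; exact hΨ g g.2⟩
  have hlow : ∀ h ∈ {h : ℝ | ∃ α : Finset (Set X),
      IsPartition α ∧ MeasF α ∧ Refines α 𝒰 ∧ h = Φ α}, ⨅ g : selectors V, Ψ g ≤ h := by
    rintro _ ⟨α, hα, hαm, hαU, rfl⟩
    obtain ⟨n, g, hg, hgα⟩ := exists_isFibering hα hαm
    have hex : ∀ j, ∃ i, g ⁻¹' {j} ⊆ V i := fun j => by
      rcases (g ⁻¹' {j}).eq_empty_or_nonempty with h0 | ⟨x, rfl⟩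
      · exact ⟨hne.some.1 (Classical.arbitrary X), by simp [h0]⟩
      · obtain ⟨B, hB, hsub⟩ := hαU _ (hgα.fiber_mem x)
        rw [← Finset.mem_coe, ← hV] at hB
        obtain ⟨i, rfl⟩ := hB
        exact ⟨i, hsub⟩
    choose φ hφ using hex
    have hsel : (fun x => φ (g x)) ∈ selectors V :=
      ⟨(Measurable.of_discrete (f := φ)).comp hg, fun x => hφ (g x) rfl⟩
    exact (ciInf_le hbdd ⟨_, hsel⟩).trans (hΨΦ α n g φ hg hgα)
  have hmem : ∀ g : selectors V, Ψ g ∈ {h : ℝ | ∃ α : Finset (Set X),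
      IsPartition α ∧ MeasF α ∧ Refines α 𝒰 ∧ h = Φ α} := by
    rintro ⟨g, hg⟩
    refine ⟨Finset.univ.image fun i => g ⁻¹' {i}, ⟨?_, ?_⟩, ?_, ?_, (hΦΨ g hg _ ⟨?_, ?_⟩).symm⟩
    · refine Set.eq_univ_of_forall fun x => ⟨g ⁻¹' {g x}, by simp, rfl⟩
    · simp only [Finset.mem_image, Finset.mem_univ, true_and]
      rintro _ ⟨i, rfl⟩ _ ⟨j, rfl⟩ hij
      exact Disjoint.preimage g (by
        rw [Set.disjoint_singleton]
        rintro rfl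
        exact hij rfl)
    · simp only [MeasF, Finset.mem_image, Finset.mem_univ, true_and]
      rintro _ ⟨i, rfl⟩
      exact hg.1 (measurableSet_singleton i)
    · simp only [Refines, Finset.mem_image, Finset.mem_univ, true_and]
      rintro _ ⟨i, rfl⟩
      refine ⟨V i, Finset.mem_coe.1 (hV ▸ Set.mem_range_self i), ?_⟩
      rintro x rfl
      exact hg.2 x
    · exact fun x => by simp
    · simp only [Finset.mem_image, Finset.mem_univ, true_and]
      rintro _ ⟨i, rfl⟩ x rfl
      rfl
  exact le_antisymm (le_ciInf fun g => csInf_le ⟨_, hlow⟩ (hmem g))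
    (le_csInf ⟨_, hmem hne.some⟩ hlow)

variable {𝒰 β : Finset (Set X)} {V : ι → Set X} {b : X → κ}

lemma hPlus_eq_coverDynEnt [Nonempty X] [IsFiniteMeasure μ] (hf : Measurable f)
    (hV : Set.range V = 𝒰) (hne : Nonempty (selectors V)) (hb : Measurable b)
    (hβ : IsFibering b β) : hPlus f μ 𝒰 β = coverDynEnt f μ V b :=
  sInf_partitions_eq_iInf_selectors (Φ := fun α => hPart f μ α β) (Ψ := fun g => dynEnt f μ g b)
    hV hne (fun _ hg _ hα => hPart_eq_dynEnt hf hα hβ hg.1 hb)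
    (fun _ _ _ φ hg hα => (dynEnt_mono_left hf ((Measurable.of_discrete (f := φ)).comp hg) hg hb
      fun _ _ h => congrArg φ h).trans (hPart_eq_dynEnt hf hα hβ hg hb).ge)
    fun _ hg => dynEnt_nonneg hf hg.1 hb

lemma covEnt_eq_iInf_selectors [Nonempty X] [IsZeroOrProbabilityMeasure μ]
    (hV : Set.range V = 𝒰) (hne : Nonempty (selectors V)) :
    covEnt μ 𝒰 = ⨅ g : selectors V, fibEnt μ (g : X → ι) :=
  sInf_partitions_eq_iInf_selectors (Φ := entPart μ) (Ψ := fun g => fibEnt μ g)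
    hV hne (fun _ _ _ hα => entPart_eq_fibEnt hα)
    (fun _ _ _ φ hg hα => (fibEnt_comp_le hg φ).trans (entPart_eq_fibEnt hα).ge)
    fun _ _ => fibEnt_nonneg _

lemma covEntCond_eq_coverCondEnt [Nonempty X] [IsProbabilityMeasure μ]
    (hV : Set.range V = 𝒰) (hne : Nonempty (selectors V)) (hb : Measurable b)
    (hβ : IsFibering b β) : covEntCond μ 𝒰 β = coverCondEnt μ V b := by
  have hbdd : ∀ m : Measure X, IsZeroOrProbabilityMeasure m →
      BddBelow (Set.range fun g : selectors V => fibEnt m (g : X → ι)) := fun m _ =>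
    ⟨0, by rintro _ ⟨g, rfl⟩; exact fibEnt_nonneg _⟩
  have h1 : covEntCond μ 𝒰 β = ∑ j, μ.real (b ⁻¹' {j}) *
      ⨅ g : selectors V, fibEnt (ProbabilityTheory.cond μ (b ⁻¹' {j})) (g : X → ι) := by
    simp only [covEntCond, covEnt_eq_iInf_selectors hV hne]
    exact hβ.sum_eq (fun B => (μ B).toReal *
      ⨅ g : selectors V, fibEnt (ProbabilityTheory.cond μ B) (g : X → ι)) (by simp)
  rw [h1]
  refine le_antisymm (le_ciInf fun g => ?_) (le_of_forall_pos_le_add fun ε hε => ?_)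
  · rw [fibCondEnt_eq_sum_cond g.2.1 hb]
    exact Finset.sum_le_sum fun j _ => mul_le_mul_of_nonneg_left
      (ciInf_le (hbdd _ inferInstance) g) measureReal_nonneg
  · have hex : ∀ j, ∃ g : selectors V, fibEnt (ProbabilityTheory.cond μ (b ⁻¹' {j})) (g : X → ι) <
        (⨅ g : selectors V, fibEnt (ProbabilityTheory.cond μ (b ⁻¹' {j})) (g : X → ι)) + ε :=
      fun j => exists_lt_of_ciInf_lt (lt_add_of_pos_right _ hε)
    choose s hs using hex
    set g : X → ι := fun x => (s (b x)).1 x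
    have hg : g ∈ selectors V :=
      ⟨(measurable_from_prod_countable_right (f := fun p : κ × X => (s p.1).1 p.2)
        fun k => (s k).2.1).comp (hb.prodMk measurable_id), fun x => (s (b x)).2.2 x⟩
    have hsum : ∑ j, μ.real (b ⁻¹' {j}) = 1 := by
      have := real_preimage_comp (μ := μ) hb (fun _ => ()) ()
      simpa using this.symm
    refine (coverCondEnt_le hb hg).trans ?_
    rw [fibCondEnt_eq_sum_cond hg.1 hb]
    calc _ ≤ ∑ j, μ.real (b ⁻¹' {j}) *
          ((⨅ g : selectors V, fibEnt (ProbabilityTheory.cond μ (b ⁻¹' {j})) (g : X → ι)) + ε) := by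
          refine Finset.sum_le_sum fun j _ => mul_le_mul_of_nonneg_left ?_ measureReal_nonneg
          rw [fibEnt_congr_ae (g' := (s j : X → ι))]
          · exact (hs j).le
          · filter_upwards [ProbabilityTheory.ae_cond_mem (hb (measurableSet_singleton j))]
              with x (hx : b x = j)
            simp only [g, hx]
      _ = _ := by simp only [mul_add, Finset.sum_add_distrib, ← Finset.sum_mul, hsum, one_mul]

lemma hMinus_eq_coverJoinEnt [Nonempty X] [IsProbabilityMeasure μ] (hf : Measurable f)
    (hV : Set.range V = 𝒰) (hne : ∀ M, Nonempty (selectors (blockCover f V M)))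
    (hb : Measurable b) (hβ : IsFibering b β) : hMinus f μ 𝒰 β = coverJoinEnt f μ V b :=
  iInf_congr fun N => by
    rw [covEntCond_eq_coverCondEnt (range_blockCover hV f _) (hne _) (measurable_block hf hb _)
      (hβ.itinerary f _)]

end FinsetEntropy

section MeanErgodic

variable {X : Type*} [MeasurableSpace X] {μ : Measure X} {f : X → X}

lemma exists_tendstoInMeasure_birkhoffAverage (hf : MeasurePreserving f μ μ) {φ : X → ℝ}
    (hφ : MemLp φ 2 μ) :
    ∃ g : Lp ℝ 2 μ, Lp.compMeasurePreserving f hf g = g ∧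
      TendstoInMeasure μ (fun N => birkhoffAverage ℝ f φ N) atTop g := by
  let L : Lp ℝ 2 μ →L[ℝ] Lp ℝ 2 μ := (Lp.compMeasurePreservingₗᵢ ℝ f hf).toContinuousLinearMap
  have hL : ‖L‖ ≤ 1 := LinearIsometry.norm_toContinuousLinearMap_le _
  have hconv := L.tendsto_birkhoffAverage_orthogonalProjection hL hφ.toLp
  refine ⟨_, ((L.eqLocus (1 : Lp ℝ 2 μ →L[ℝ] Lp ℝ 2 μ)).orthogonalProjectionOnto hφ.toLp).2, ?_⟩
  refine (tendstoInMeasure_of_tendsto_Lp hconv).congr_left fun N => ?_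
  have hiter : ∀ n, (L^[n] hφ.toLp : X → ℝ) =ᵐ[μ] fun x => φ (f^[n] x) := fun n => by
    have h1 : L^[n] hφ.toLp = Lp.compMeasurePreserving f^[n] (hf.iterate n) hφ.toLp :=
      congrFun (Lp.compMeasurePreserving_iterate hf n) _
    rw [h1]
    exact (Lp.coeFn_compMeasurePreserving _ _).trans
      ((hf.iterate n).quasiMeasurePreserving.ae_eq_comp hφ.coeFn_toLp)
  have hsum : ((birkhoffSum L id N hφ.toLp : Lp ℝ 2 μ) : X → ℝ) =ᵐ[μ]
      fun x => birkhoffSum f φ N x := by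
    simp only [birkhoffSum, id]
    refine (Lp.coeFn_finsetSum _ _).trans ?_
    filter_upwards [ae_all_iff.2 hiter] with x hx
    simp [hx]
  filter_upwards [Lp.coeFn_smul ((N : ℝ)⁻¹) (birkhoffSum L id N hφ.toLp), hsum] with x h1 h2
  simp only [birkhoffAverage]
  rw [h1, Pi.smul_apply, h2]

lemma memLp_indicator_one [IsFiniteMeasure μ] {A : Set X} (hA : MeasurableSet A) :
    MemLp (A.indicator fun _ => (1 : ℝ)) 2 μ :=
  memLp_indicator_const 2 hA 1 (Or.inr (measure_ne_top μ A))

lemma abs_birkhoffAverage_indicator_le (A : Set X) (N : ℕ) (x : X) :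
    ‖birkhoffAverage ℝ f (A.indicator fun _ => (1 : ℝ)) N x‖ ≤ 1 := by
  have h : ‖birkhoffSum f (A.indicator fun _ => (1 : ℝ)) N x‖ ≤ N := by
    refine (norm_sum_le _ _).trans ((Finset.sum_le_sum (g := fun _ => (1 : ℝ)) fun n _ => ?_).trans
      (by simp))
    by_cases hx : f^[n] x ∈ A <;> simp [hx]
  rw [birkhoffAverage, norm_smul, norm_inv, Real.norm_natCast]
  exact inv_mul_le_one_of_le₀ h N.cast_nonneg

lemma measurable_birkhoffAverage (hf : Measurable f) {φ : X → ℝ} (hφ : Measurable φ) (N : ℕ) :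
    Measurable (birkhoffAverage ℝ f φ N) :=
  (Finset.measurable_sum (Finset.range N) fun n _ => hφ.comp (hf.iterate n)).const_smul
    ((N : ℝ)⁻¹)

lemma integral_birkhoffAverage_indicator [IsFiniteMeasure μ] (hf : MeasurePreserving f μ μ)
    {A : Set X} (hA : MeasurableSet A) {N : ℕ} (hN : N ≠ 0) :
    ∫ x, birkhoffAverage ℝ f (A.indicator fun _ => (1 : ℝ)) N x ∂μ = μ.real A := by
  have hN' : (N : ℝ) ≠ 0 := Nat.cast_ne_zero.2 hN
  have h_int : ∀ n, Integrable (fun x => A.indicator (fun _ => (1 : ℝ)) (f^[n] x)) μ := fun n =>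
    (hf.iterate n).integrable_comp_of_integrable ((integrable_const 1).indicator hA)
  have hval : ∀ n, ∫ x, A.indicator (fun _ => (1 : ℝ)) (f^[n] x) ∂μ = μ.real A := fun n => by
    have h1 := integral_indicator_one (μ := μ) ((hf.iterate n).measurable hA)
    rw [measureReal_def, (hf.iterate n).measure_preimage hA.nullMeasurableSet] at h1
    exact h1
  simp only [birkhoffAverage, birkhoffSum, smul_eq_mul]
  rw [integral_const_mul, integral_finsetSum _ fun n _ => h_int n]
  simp [hval, hN']

lemma ae_eq_measureReal_of_ergodic [IsProbabilityMeasure μ] (hf : Ergodic f μ) {A : Set X}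
    (hA : MeasurableSet A) {ns : ℕ → ℕ} (hns : StrictMono ns) {G : X → ℝ}
    (hG : ∀ᵐ x ∂μ, Tendsto (fun i => birkhoffAverage ℝ f (A.indicator fun _ => (1 : ℝ)) (ns i) x)
      atTop (𝓝 (G x))) : ∀ᵐ x ∂μ, G x = μ.real A := by
  have hmp := hf.toMeasurePreserving
  have hmeas := fun N => (measurable_birkhoffAverage hmp.measurable
    (measurable_const.indicator hA) N : Measurable
      (birkhoffAverage ℝ f (A.indicator fun _ => (1 : ℝ)) N))
  obtain ⟨g, hg, hconv⟩ :=
    exists_tendstoInMeasure_birkhoffAverage hmp (memLp_indicator_one (μ := μ) hA)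
  obtain ⟨c, hc⟩ := hf.ae_eq_const_of_ae_eq_comp_ae (Lp.aestronglyMeasurable g)
    ((Lp.coeFn_compMeasurePreserving g hmp).symm.trans (by rw [hg]))
  have hGg : G =ᵐ[μ] g := tendstoInMeasure_ae_unique
    (tendstoInMeasure_of_tendsto_ae (fun i => (hmeas (ns i)).aestronglyMeasurable) hG)
    (hconv.comp hns.tendsto_atTop)
  have hGc : ∀ᵐ x ∂μ, G x = c := hGg.trans hc
  have hlim := tendsto_integral_of_dominated_convergence (fun _ => (1 : ℝ))
    (fun i => (hmeas (ns i)).aestronglyMeasurable) (integrable_const 1)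
    (fun i => ae_of_all _ fun x => abs_birkhoffAverage_indicator_le A (ns i) x) hG
  have h_int : ∫ x, G x ∂μ = μ.real A := by
    refine tendsto_nhds_unique hlim (tendsto_const_nhds.congr' ?_)
    filter_upwards [eventually_ge_atTop 1] with i hi
    exact (integral_birkhoffAverage_indicator hmp hA
      (Nat.one_le_iff_ne_zero.1 (hi.trans (hns.id_le i)))).symm
  have hcA : c = μ.real A := by
    rw [← h_int, integral_congr_ae hGc]
    simp
  exact hcA ▸ hGc

end MeanErgodic

section Ergodic

variable {X Y : Type*} [MeasurableSpace X] [MeasurableSpace Y] {μ : Measure X} {ν : Measure Y}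
  {P : Y → Measure X} {f : X → X}

lemma exists_ae_eq_measureReal [IsFiniteMeasure μ] (hf : MeasurePreserving f μ μ)
    (hprob : ∀ᵐ y ∂ν, IsProbabilityMeasure (P y)) (herg : ∀ᵐ y ∂ν, Ergodic f (P y))
    (hmeas : ∀ s, MeasurableSet s → Measurable fun y => P y s)
    (hdis : ∀ s, MeasurableSet s → μ s = ∫⁻ y, P y s ∂ν) {A : Set X} (hA : MeasurableSet A) :
    ∃ G : X → ℝ, Measurable G ∧ ∀ᵐ y ∂ν, ∀ᵐ x ∂P y, G x = (P y).real A := by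
  obtain ⟨g, -, hg⟩ :=
    exists_tendstoInMeasure_birkhoffAverage hf (memLp_indicator_one (μ := μ) hA)
  obtain ⟨ns, hns, hlim⟩ := hg.exists_seq_tendsto_ae
  refine ⟨g, (Lp.stronglyMeasurable g).measurable, ?_⟩
  filter_upwards [ae_ae_of_ae hdis hmeas hlim, hprob, herg] with y h1 h2 h3
  exact ae_eq_measureReal_of_ergodic h3 hA hns h1

lemma isDetectedDisintegration_of_ergodic [IsFiniteMeasure μ] (hf : MeasurePreserving f μ μ)
    (hprob : ∀ᵐ y ∂ν, IsProbabilityMeasure (P y)) (herg : ∀ᵐ y ∂ν, Ergodic f (P y))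
    (hmeas : ∀ s, MeasurableSet s → Measurable fun y => P y s)
    (hdis : ∀ s, MeasurableSet s → μ s = ∫⁻ y, P y s ∂ν) : IsDetectedDisintegration μ ν P := by
  refine ⟨hprob, fun A hA B hB => ⟨hmeas A hA hB, ?_⟩, hdis⟩
  obtain ⟨G, hG, h⟩ := exists_ae_eq_measureReal hf hprob herg hmeas hdis hA
  refine ⟨(fun x => ENNReal.ofReal (G x)) ⁻¹' B, hG.ennreal_ofReal hB, ?_⟩
  filter_upwards [h, hprob] with y hy hy'
  filter_upwards [hy] with x hx
  rw [Set.mem_preimage, hx, ofReal_measureReal]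
  rfl

end Ergodic

end Paper

open Paper MeasureTheory Real Filter

/-- ergodic decomposition of `h⁺` and `h⁻`: Let `(X,T)` be a TDS,
`μ ∈ M_T(X)`, and let `y ↦ μ_y` (over a probability space `(Y,ν)`) be the disintegration
of `μ` over the σ-algebra of `T`-invariant sets, so that `μ = ∫ μ_y dν(y)` with `μ_y`
ergodic and `T`-invariant for ν-a.e. `y`. Then for every cover `𝒰` and partition `β`,
`h⁺_μ(𝒰|β,T) = ∫ h⁺_{μ_y}(𝒰|β,T) dν(y)` and `h⁻_μ(𝒰|β,T) = ∫ h⁻_{μ_y}(𝒰|β,T) dν(y)`. -/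
theorem statement15 {X Y : Type*} [MetricSpace X] [CompactSpace X]
    [MeasurableSpace X] [BorelSpace X] [MeasurableSpace Y] (T : X ≃ₜ X)
    (μ : MeasureTheory.Measure X) [MeasureTheory.IsProbabilityMeasure μ]
    (hT : MeasureTheory.MeasurePreserving (⇑T) μ μ)
    (ν : MeasureTheory.Measure Y) [MeasureTheory.IsProbabilityMeasure ν]
    (μy : Y → MeasureTheory.Measure X)
    (hprob : ∀ᵐ y ∂ν, MeasureTheory.IsProbabilityMeasure (μy y))
    (herg : ∀ᵐ y ∂ν, Ergodic (⇑T) (μy y))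
    (hmeas : ∀ s : Set X, MeasurableSet s → Measurable fun y => μy y s)
    (hdisint : ∀ s : Set X, MeasurableSet s → μ s = ∫⁻ y, μy y s ∂ν)
    (𝒰 β : Finset (Set X)) (h𝒰 : IsCover 𝒰) (h𝒰m : MeasF 𝒰)
    (hβ : IsPartition β) (hβm : MeasF β) :
    hPlus (⇑T) μ 𝒰 β = ∫ y, hPlus (⇑T) (μy y) 𝒰 β ∂ν ∧
    hMinus (⇑T) μ 𝒰 β = ∫ y, hMinus (⇑T) (μy y) 𝒰 β ∂ν := by
  have hX : Nonempty X := nonempty_of_isProbabilityMeasure μ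
  have hTm : Measurable T := T.continuous.measurable
  obtain ⟨V, -, hVr⟩ := exists_enumeration 𝒰
  have hVcov := exists_mem_of_range h𝒰 hVr
  have hVm : ∀ i, MeasurableSet (V i) := fun i => h𝒰m _ (by
    rw [← Finset.mem_coe, ← hVr]
    exact Set.mem_range_self i)
  obtain ⟨i₀, -⟩ := hVcov hX.some
  have hι : Nonempty (Fin 𝒰.card) := ⟨i₀⟩
  obtain ⟨n, b, hb, hfib⟩ := exists_isFibering hβ hβm
  have hne := selectors_nonempty hVm hVcov
  have hneM : ∀ M, Nonempty (selectors (blockCover T V M)) := fun M =>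
    selectors_nonempty (measurableSet_blockCover hTm hVm M) (exists_mem_blockCover T hVcov M)
  have D := isDetectedDisintegration_of_ergodic hT hprob herg hmeas hdisint
  have hmp := herg.mono fun y hy => hy.toMeasurePreserving
  constructor
  · rw [hPlus_eq_coverDynEnt hTm hVr hne hb hfib,
      D.coverDynEnt_eq_integral hTm hmp hVm hVcov hb]
    refine integral_congr_ae ?_
    filter_upwards [hprob] with y hy
    exact (hPlus_eq_coverDynEnt hTm hVr hne hb hfib).symm
  · rw [hMinus_eq_coverJoinEnt hTm hVr hneM hb hfib,
      D.coverJoinEnt_eq_integral hTm hmp hVm hVcov hb]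
    refine integral_congr_ae ?_
    filter_upwards [hprob] with y hy
    exact (hMinus_eq_coverJoinEnt hTm hVr hneM hb hfib).symm
end

section
/- Let (X,T) be a TDS, U a cover of X (not necessarily open) and β a partition of X. Then inf over all finite Borel partitions α with α ≽ U of sup over μ ∈ M_T(X) of h_μ(α|β,T) is at most h(U|β,T). -/
open MeasureTheory Real Filter

open Paper MeasureTheory Real Filter

/-- A Borel marker set whose return times are at least `N`, visited in the past by every point
having no period smaller than `N`. -/
theorem exists_marker {X : Type*} [TopologicalSpace X] [T2Space X] [SecondCountableTopology X]
    [MeasurableSpace X] [BorelSpace X] (T : X ≃ₜ X) (N : ℕ) :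
    ∃ F : Set X, MeasurableSet F ∧ (∀ x ∈ F, ∀ i, 0 < i → i < N → T^[i] x ∉ F) ∧
      ∀ x, (∀ i, 0 < i → i < N → T^[i] x ≠ x) → ∃ k, T.symm^[k] x ∈ F := by
  have hTs : ∀ k (x : X), T^[k] (T.symm^[k] x) = x := fun k x =>
    (Function.LeftInverse.iterate (g := T) (f := T.symm) T.apply_symm_apply k) x
  have hsT : ∀ k (x : X), T.symm^[k] (T^[k] x) = x := fun k x =>
    (Function.LeftInverse.iterate (g := T.symm) (f := T) T.symm_apply_apply k) x
  have hcT : ∀ k, Continuous (T^[k]) := fun k => T.continuous.iterate k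
  have hcs : ∀ k, Continuous (T.symm^[k]) := fun k => T.symm.continuous.iterate k
  set Q : Set X := {x | ∀ i, 0 < i → i < N → T^[i] x ≠ x} with hQ
  have hnhd : ∀ x ∈ Q, ∃ V : Set X, IsOpen V ∧ x ∈ V ∧
      ∀ i, 0 < i → i < N → ∀ y ∈ V, T^[i] y ∉ V := by
    intro x hx
    have h1 : ∀ i : ℕ, ∃ V : Set X, IsOpen V ∧ x ∈ V ∧
        (0 < i → i < N → ∀ y ∈ V, T^[i] y ∉ V) := by
      intro i
      by_cases hi : 0 < i ∧ i < N
      · obtain ⟨V, W, hV, hW, hxV, hxW, hVW⟩ := t2_separation (hx i hi.1 hi.2)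
        refine ⟨W ∩ T^[i] ⁻¹' V, hW.inter (hV.preimage (hcT i)), ⟨hxW, hxV⟩, ?_⟩
        intro _ _ y hy hy'
        exact Set.disjoint_left.1 hVW hy.2 hy'.1
      · exact ⟨Set.univ, isOpen_univ, trivial, fun a b => (hi ⟨a, b⟩).elim⟩
    choose V hV hxV hVd using h1
    refine ⟨⋂ i ∈ Finset.range N, V i, isOpen_biInter_finset fun i _ => hV i, ?_, ?_⟩
    · simp [hxV]
    · intro i hi hiN y hy hy'
      simp only [Finset.mem_range, Set.mem_iInter] at hy hy'
      exact hVd i hi hiN y (hy i hiN) (hy' i hiN)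
  choose! V hV hxV hVd using hnhd
  obtain ⟨t, htQ, htc, htcov⟩ := TopologicalSpace.countable_cover_nhdsWithin
    (f := V) (s := Q) fun x hx => mem_nhdsWithin_of_mem_nhds ((hV x hx).mem_nhds (hxV x hx))
  rcases t.eq_empty_or_nonempty with rfl | hne
  · refine ⟨∅, MeasurableSet.empty, fun x hx => hx.elim, fun x hx => ?_⟩
    simpa using htcov hx
  obtain ⟨a, rfl⟩ := htc.exists_eq_range hne
  have haQ : ∀ k, a k ∈ Q := fun k => htQ ⟨k, rfl⟩
  let G : ℕ → Set X := fun k => Nat.rec (∅ : Set X) (fun k S =>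
    S ∪ (V (a k) \ ⋃ i ∈ Finset.range N, (T^[i] ⁻¹' S ∪ T.symm^[i] ⁻¹' S))) k
  have hG0 : G 0 = ∅ := rfl
  have hGs : ∀ k, G (k + 1) = G k ∪
    (V (a k) \ ⋃ i ∈ Finset.range N, (T^[i] ⁻¹' G k ∪ T.symm^[i] ⁻¹' G k)) := fun k => rfl
  have hGm : ∀ k, MeasurableSet (G k) := by
    intro k
    induction k with
    | zero => exact MeasurableSet.empty
    | succ k ih =>
      rw [hGs]
      refine ih.union ((hV _ (haQ k)).measurableSet.diff ?_)
      exact Finset.measurableSet_biUnion _ fun i _ =>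
        ((hcT i).measurable ih).union ((hcs i).measurable ih)
  have hmono : Monotone G := monotone_nat_of_le_succ fun k => by
    rw [hGs]; exact Set.subset_union_left
  have hGd : ∀ k, ∀ x ∈ G k, ∀ i, 0 < i → i < N → T^[i] x ∉ G k := by
    intro k
    induction k with
    | zero => intro x hx; exact hx.elim
    | succ k ih =>
      intro x hx i hi hiN hx'
      rw [hGs] at hx hx'
      simp only [Set.mem_union, Set.mem_sdiff, Set.mem_iUnion, Finset.mem_range, Set.mem_preimage,
        not_exists, not_or] at hx hx'
      rcases hx with hx | ⟨hx, hx2⟩ <;> rcases hx' with hx' | ⟨hx', hx2'⟩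
      · exact ih x hx i hi hiN hx'
      · have := (hx2' i hiN).2
        rw [hsT] at this
        exact this hx
      · exact (hx2 i hiN).1 hx'
      · exact hVd _ (haQ k) i hi hiN x hx hx'
  refine ⟨⋃ k, G k, MeasurableSet.iUnion hGm, ?_, ?_⟩
  · intro x hx i hi hiN hx'
    obtain ⟨k, hk⟩ := Set.mem_iUnion.1 hx
    obtain ⟨l, hl⟩ := Set.mem_iUnion.1 hx'
    exact hGd (max k l) x (hmono (le_max_left _ _) hk) i hi hiN (hmono (le_max_right _ _) hl)
  · intro x hx
    have hy : T.symm^[N] x ∈ Q := by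
      intro i hi hiN h
      apply hx i hi hiN
      have h2 := congrArg (T^[N]) h
      rwa [← Function.iterate_add_apply, add_comm, Function.iterate_add_apply, hTs] at h2
    obtain ⟨_, ⟨k, rfl⟩, hk⟩ := Set.mem_iUnion₂.1 (htcov hy)
    rcases em (T.symm^[N] x ∈ G (k + 1)) with hk1 | hk1
    · exact ⟨N, Set.mem_iUnion.2 ⟨k + 1, hk1⟩⟩
    rw [hGs] at hk1
    simp only [Set.mem_union, Set.mem_sdiff, hk, true_and, not_or, not_not, Set.mem_iUnion,
      Finset.mem_range, Set.mem_preimage] at hk1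
    obtain ⟨-, i, hi, h | h⟩ := hk1
    · refine ⟨N - i, Set.mem_iUnion.2 ⟨k, ?_⟩⟩
      have : T.symm^[N] x = T.symm^[i] (T.symm^[N - i] x) := by
        rw [← Function.iterate_add_apply]; congr 2; omega
      rwa [this, hTs] at h
    · refine ⟨i + N, Set.mem_iUnion.2 ⟨k, ?_⟩⟩
      rwa [Function.iterate_add_apply]

/-- The time elapsed since the last visit to a measurable set. -/
theorem exists_lastVisit {X : Type*} [MeasurableSpace X] {S : X → X} (hS : Measurable S)
    {F : Set X} (hF : MeasurableSet F) :
    ∃ c : X → ℕ, Measurable c ∧ ∀ x, (∃ k, S^[k] x ∈ F) →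
      S^[c x] x ∈ F ∧ ∀ j < c x, S^[j] x ∉ F := by
  classical
  let p : X → ℕ → Prop := fun x k => S^[k] x ∈ F ∨ ∀ j, S^[j] x ∉ F
  have hp : ∀ x, ∃ k, p x k := fun x => by
    by_cases h : ∃ k, S^[k] x ∈ F
    · exact h.imp fun k hk => Or.inl hk
    · exact ⟨0, Or.inr (not_exists.1 h)⟩
  have hm : ∀ k, MeasurableSet {x | S^[k] x ∈ F} := fun k => (hS.iterate k) hF
  refine ⟨fun x => Nat.find (hp x), measurable_find hp fun k => ?_, fun x hx => ⟨?_, ?_⟩⟩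
  · have h2 : MeasurableSet {x | ∀ j, S^[j] x ∉ F} := by
      simp only [Set.ofPred_forall]
      exact MeasurableSet.iInter fun j => (hm j).compl
    exact (hm k).union h2
  · exact (Nat.find_spec (hp x)).resolve_right fun h => hx.elim h
  · exact fun j hj h => Nat.find_min (hp x) hj (Or.inl h)

/-- On `S`, the `a`-name of length `n` of a point is determined by its `b`-name of length `n`
together with one of `C` symbols. -/
def HasCode {X ι κ : Type*} (f : X → X) (a : X → ι) (b : X → κ) (S : Set X) (n C : ℕ) : Prop :=
  ∃ code : X → Fin C, ∀ x ∈ S, ∀ y ∈ S, code x = code y →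
    (∀ i < n, b (f^[i] x) = b (f^[i] y)) → ∀ i < n, a (f^[i] x) = a (f^[i] y)

theorem hasCode_of_fintype {X ι κ : Type*} {f : X → X} {a : X → ι} {b : X → κ} {S : Set X} {n : ℕ}
    {γ : Type*} [Fintype γ] (code : X → γ)
    (h : ∀ x ∈ S, ∀ y ∈ S, code x = code y →
      (∀ i < n, b (f^[i] x) = b (f^[i] y)) → ∀ i < n, a (f^[i] x) = a (f^[i] y)) :
    HasCode f a b S n (Fintype.card γ) :=
  ⟨fun x => Fintype.equivFin γ (code x), fun x hx y hy hxy =>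
    h x hx y hy ((Fintype.equivFin γ).injective hxy)⟩

theorem HasCode.mul {X ι κ : Type*} {f : X → X} {a : X → ι} {b : X → κ} {S : Set X} {n C : ℕ}
    (h : HasCode f a b S n C) (hn : 0 < n) (hS : ∀ x ∈ S, ∀ i, f^[i] x ∈ S) (m : ℕ) :
    HasCode f a b S (n * m) (C ^ m) := by
  obtain ⟨code, hc⟩ := h
  have := hasCode_of_fintype (f := f) (a := a) (b := b) (S := S) (n := n * m)
    (fun x (j : Fin m) => code (f^[n * j] x)) ?_
  · simpa using this
  intro x hx y hy hxy hb i hi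
  have hj : i / n < m := Nat.div_lt_of_lt_mul hi
  have key := hc (f^[n * (i / n)] x) (hS x hx _) (f^[n * (i / n)] y) (hS y hy _)
    (congrFun hxy ⟨i / n, hj⟩) (fun k hk => by
      rw [← Function.iterate_add_apply, ← Function.iterate_add_apply]
      apply hb
      calc k + n * (i / n) < n + n * (i / n) := by omega
        _ = n * (i / n + 1) := by ring
        _ ≤ n * m := Nat.mul_le_mul_left _ hj) (i % n) (Nat.mod_lt _ hn)
  rwa [← Function.iterate_add_apply, ← Function.iterate_add_apply, Nat.mod_add_div] at key

theorem HasCode.union {X ι κ : Type*} {f : X → X} {a : X → ι} {b : X → κ} {S : Set X} {n C D : ℕ}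
    (h : HasCode f a b S n C) (h' : HasCode f a b Sᶜ n D) :
    HasCode f a b Set.univ n (C + D) := by
  classical
  obtain ⟨c, hc⟩ := h
  obtain ⟨d, hd⟩ := h'
  have := hasCode_of_fintype (f := f) (a := a) (b := b) (S := Set.univ) (n := n)
    (fun x => if x ∈ S then (Sum.inl (c x) : Fin C ⊕ Fin D) else Sum.inr (d x)) ?_
  · simpa using this
  intro x _ y _ hxy
  by_cases hx : x ∈ S <;> by_cases hy : y ∈ S <;> simp only [hx, hy, if_true, if_false] at hxy
  · exact hc x hx y hy (Sum.inl_injective hxy)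
  · cases hxy
  · cases hxy
  · exact hd x hx y hy (Sum.inr_injective hxy)

theorem hasCode_periodic {X ι κ : Type*} [Fintype ι] (f : X → X) (a : X → ι) (b : X → κ)
    {N : ℕ} (hN : 0 < N) (n : ℕ) :
    HasCode f a b {x | ∀ i, 0 < i → i < N → f^[i] x ≠ x}ᶜ n (N * Fintype.card ι ^ N) := by
  classical
  have hex : ∀ x, x ∈ {x | ∀ i, 0 < i → i < N → f^[i] x ≠ x}ᶜ →
      ∃ p : Fin N, 0 < (p : ℕ) ∧ f^[p] x = x := by
    intro x hx
    simp only [Set.mem_compl_iff, Set.mem_ofPred_eq, not_forall, not_not] at hx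
    obtain ⟨i, hi, hiN, h⟩ := hx
    exact ⟨⟨i, hiN⟩, hi, h⟩
  have : ∀ x, ∃ p : Fin N, x ∈ {x | ∀ i, 0 < i → i < N → f^[i] x ≠ x}ᶜ →
      0 < (p : ℕ) ∧ f^[p] x = x := fun x => by
    by_cases hx : x ∈ {x | ∀ i, 0 < i → i < N → f^[i] x ≠ x}ᶜ
    · exact (hex x hx).imp fun p hp _ => hp
    · exact ⟨⟨0, hN⟩, fun h => absurd h hx⟩
  choose p hp using this
  have := hasCode_of_fintype (f := f) (a := a) (b := b)
    (S := {x | ∀ i, 0 < i → i < N → f^[i] x ≠ x}ᶜ) (n := n)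
    (fun x => (p x, fun i : Fin N => a (f^[i] x))) ?_
  · simpa using this
  intro x hx y hy hxy _ i _
  obtain ⟨h1, h2⟩ := Prod.ext_iff.1 hxy
  simp only at h1 h2
  have hx' := hp x hx
  have hy' := hp y hy
  have e1 := Function.IsPeriodicPt.iterate_mod_apply (f := f) (x := x) hx'.2 i
  have e2 := Function.IsPeriodicPt.iterate_mod_apply (f := f) (x := y) hy'.2 i
  rw [← e1, ← e2, ← h1]
  exact congrFun h2 ⟨i % p x, (Nat.mod_lt _ hx'.1).trans (p x).2⟩

theorem clock_sub {γ : ℕ → ℕ} {V : ℕ → Prop} (h0 : ∀ i, V i → γ i = 0)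
    (hs : ∀ i, ¬ V (i + 1) → γ (i + 1) = γ i + 1) (i : ℕ) :
    ∀ j, j ≤ γ i → j ≤ i → γ (i - j) = γ i - j := by
  intro j
  induction j with
  | zero => simp
  | succ j ih =>
    intro h1 h2
    have h3 := ih (by omega) (by omega)
    have e : i - j = (i - (j + 1)) + 1 := by omega
    have h4 : ¬ V (i - (j + 1) + 1) := fun hV => by
      have := h0 _ hV
      rw [← e] at this
      omega
    have := hs _ h4
    rw [← e] at this
    omega

theorem clock_add {γ : ℕ → ℕ} {V : ℕ → Prop}
    (hs : ∀ i, ¬ V (i + 1) → γ (i + 1) = γ i + 1) (i : ℕ) :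
    ∀ d, (∀ k, i < k → k ≤ i + d → ¬ V k) → γ (i + d) = γ i + d := by
  intro d
  induction d with
  | zero => simp
  | succ d ih =>
    intro h
    have h1 := ih fun k hk hk' => h k hk (by omega)
    have h2 := hs (i + d) (h _ (by omega) (by omega))
    rw [← add_assoc, h2, h1, add_assoc]

theorem clock_mod_congr {γ γ' : ℕ → ℕ} {V V' : ℕ → Prop} {n N : ℕ}
    (h0 : ∀ i, V i → γ i = 0) (hs : ∀ i, ¬ V (i + 1) → γ (i + 1) = γ i + 1)
    (h0' : ∀ i, V' i → γ' i = 0) (hs' : ∀ i, ¬ V' (i + 1) → γ' (i + 1) = γ' i + 1)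
    (hV : ∀ i < N, (V i ↔ V' i)) (hγ : γ 0 % n = γ' 0 % n) :
    ∀ i < N, γ i % n = γ' i % n := by
  intro i
  induction i with
  | zero => exact fun _ => hγ
  | succ i ih =>
    intro hi
    by_cases h : V (i + 1)
    · rw [h0 _ h, h0' _ ((hV _ hi).1 h)]
    · rw [hs _ h, hs' _ (fun h' => h ((hV _ hi).2 h'))]
      exact Nat.ModEq.add_right 1 (ih (by omega))

theorem clock_second {γ : ℕ → ℕ} {V : ℕ → Prop} {n N : ℕ}
    (h0 : ∀ i, V i → γ i = 0) (hs : ∀ i, ¬ V (i + 1) → γ (i + 1) = γ i + 1)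
    (huniq : ∀ i < N, ∀ j < N, V i → V j → i = j) {i j : ℕ} (hij : i < j) (hjN : j < N)
    (hjn : j < i + n) (hi : γ i % n = 0) (hj : γ j % n = 0) : V j := by
  by_contra hV
  by_cases h : ∃ v, i < v ∧ v ≤ j ∧ V v
  · obtain ⟨v, hv1, hv2, hv⟩ := h
    have hne : v ≠ j := fun e => hV (e ▸ hv)
    have := clock_add hs v (j - v) fun k hk hk' hVk => by
      have := huniq k (by omega) v (by omega) hVk hv
      omega
    rw [Nat.add_sub_cancel' hv2, h0 _ hv, zero_add] at this
    rw [this, Nat.mod_eq_of_lt (by omega)] at hj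
    omega
  · have := clock_add hs i (j - i) fun k hk hk' hVk => h ⟨k, hk, by omega, hVk⟩
    rw [Nat.add_sub_cancel' hij.le] at this
    rw [this, Nat.add_mod, hi, zero_add, Nat.mod_mod, Nat.mod_eq_of_lt (by omega)] at hj
    omega

theorem hasCode_window {X ι κ : Type*} [Fintype ι] {T : X ≃ X} {b : X → κ} {n K q : ℕ}
    (hn : 0 < n) (hq : 0 < q)
    {δ : X → Fin n → ι} {e : X → Fin K}
    (hδ : ∀ x y, (∀ i < n, b (T^[i] x) = b (T^[i] y)) → e x = e y → δ x = δ y)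
    {F Q : Set X} {c : X → ℕ}
    (hF : ∀ x ∈ F, ∀ i, 0 < i → i < n * q → T^[i] x ∉ F)
    (hQ : ∀ x ∈ Q, ∀ i, T^[i] x ∈ Q)
    (hc0 : ∀ x ∈ F, c x = 0) (hcs : ∀ x ∈ Q, T x ∉ F → c (T x) = c x + 1)
    {a : X → ι} (ha : ∀ x, a x = δ (T.symm^[c x % n] x) ⟨c x % n, Nat.mod_lt _ hn⟩) :
    HasCode T a b Q (n * q) (n * ((n * q + 1) * ((Fintype.card ι) ^ n *
      ((Fintype.card ι) ^ n * (K * K ^ q))))) := by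
  classical
  have hτ : ∀ x, ∃ t : Fin (n * q + 1), ∀ i < n * q, (T^[i] x ∈ F ↔ i = t) := by
    intro x
    by_cases h : ∃ i < n * q, T^[i] x ∈ F
    · obtain ⟨t, ht, htF⟩ := h
      refine ⟨⟨t, by omega⟩, fun i hi => ⟨fun hiF => ?_, fun h => h ▸ htF⟩⟩
      have aux : ∀ s t, s < t → t < n * q → T^[s] x ∈ F → T^[t] x ∉ F := by
        intro s t hst ht hs
        have := hF _ hs (t - s) (by omega) (by omega)
        rwa [← Function.iterate_add_apply, Nat.sub_add_cancel hst.le] at this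
      rcases lt_trichotomy i t with h | h | h
      · exact absurd htF (aux _ _ h ht hiF)
      · exact h
      · exact absurd hiF (aux _ _ h hi htF)
    · refine ⟨⟨n * q, by omega⟩, fun i hi => ⟨fun hiF => absurd ⟨i, hi, hiF⟩ h, fun h => ?_⟩⟩
      simp only at h
      omega
  choose τ hτ using hτ
  let st : X → ℕ → Set ℕ := fun x j => {k | k < n ∧ c (T^[n * j + k] x) % n = 0}
  have hcard := hasCode_of_fintype (f := T) (a := a) (b := b) (S := Q) (n := n * q)
    (γ := Fin n × Fin (n * q + 1) × (Fin n → ι) × (Fin n → ι) × Fin K × (Fin q → Fin K))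
    (fun x => (⟨c x % n, Nat.mod_lt _ hn⟩, τ x, fun k => a (T^[k] x),
      fun k => a (T^[n * q - n + k] x), e (T^[τ x] x),
      fun j => e (T^[n * j + sInf (st x j)] x))) ?_
  · simpa using hcard
  intro x hx y hy hxy hb
  simp only [Prod.mk.injEq, Fin.mk.injEq] at hxy
  obtain ⟨h_c, h_τ, h_ini, h_fin, h_ext, h_tab⟩ := hxy
  have h_nq : n ≤ n * q := Nat.le_mul_of_pos_right n hq
  have clock0 : ∀ z, ∀ i, T^[i] z ∈ F → c (T^[i] z) = 0 := fun z i h => hc0 _ h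
  have clocks : ∀ z ∈ Q, ∀ i, ¬ T^[i + 1] z ∈ F → c (T^[i + 1] z) = c (T^[i] z) + 1 := by
    intro z hz i h
    rw [Function.iterate_succ_apply'] at h ⊢
    exact hcs _ (hQ z hz i) h
  have huniq : ∀ i < n * q, ∀ j < n * q, T^[i] x ∈ F → T^[j] x ∈ F → i = j := by
    intro i hi j hj h h'
    rw [(hτ x i hi).1 h, (hτ x j hj).1 h']
  have hphase : ∀ i < n * q, c (T^[i] x) % n = c (T^[i] y) % n :=
    clock_mod_congr (clock0 x) (clocks x hx) (clock0 y) (clocks y hy)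
      (fun i hi => by rw [hτ x i hi, hτ y i hi, h_τ]) h_c
  have hst : ∀ j < q, st x j = st y j := by
    intro j hj
    ext k
    refine and_congr_right fun hk => ?_
    rw [hphase]
    calc n * j + k < n * j + n := by omega
      _ = n * (j + 1) := by ring
      _ ≤ n * q := Nat.mul_le_mul_left _ hj
  -- at a block start, the symbol `e` is recorded in the code
  have hstart : ∀ i < n * q, c (T^[i] x) % n = 0 → e (T^[i] x) = e (T^[i] y) := by
    intro i hi h
    have hjq : i / n < q := Nat.div_lt_of_lt_mul hi
    have hmem : i % n ∈ st x (i / n) :=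
      ⟨Nat.mod_lt _ hn, by rw [Nat.div_add_mod]; exact h⟩
    have hinf := Nat.sInf_mem (Set.nonempty_of_mem hmem)
    have hle := Nat.sInf_le hmem
    rcases hle.eq_or_lt with heq | hlt
    · have := congrFun h_tab ⟨i / n, hjq⟩
      simp only at this
      rwa [← hst _ hjq, heq, Nat.div_add_mod] at this
    · have hdm := Nat.div_add_mod i n
      have := clock_second (clock0 x) (clocks x hx) huniq
        (i := n * (i / n) + sInf (st x (i / n))) (j := i) (n := n) (by omega) hi
        (by have := Nat.mod_lt i hn; omega) hinf.2 h
      have hiτ := (hτ x i hi).1 this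
      rw [hiτ]
      rwa [← h_τ] at h_ext
  intro i hi
  set s := c (T^[i] x) % n with hs
  have hsn : s < n := Nat.mod_lt _ hn
  by_cases h1 : i < n
  · exact congrFun h_ini ⟨i, h1⟩
  by_cases h2 : n * q - n ≤ i
  · have := congrFun h_fin ⟨i - (n * q - n), by omega⟩
    simp only at this
    rwa [Nat.add_sub_cancel' h2] at this
  have hback : ∀ z, T.symm^[s] (T^[i] z) = T^[i - s] z := by
    intro z
    have e1 : T^[i] z = T^[s] (T^[i - s] z) := by
      rw [← Function.iterate_add_apply]; congr 2; omega
    rw [e1]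
    exact (Function.LeftInverse.iterate (g := T.symm) (f := T) T.symm_apply_apply s) _
  have hphase0 : c (T^[i - s] x) % n = 0 := by
    rw [clock_sub (clock0 x) (clocks x hx) i s (Nat.mod_le _ _) (by omega)]
    exact Nat.sub_mod_eq_zero_of_mod_eq (by rw [hs, Nat.mod_mod])
  have hδxy : δ (T^[i - s] x) = δ (T^[i - s] y) := by
    refine hδ _ _ (fun k hk => ?_) (hstart _ (by omega) hphase0)
    rw [← Function.iterate_add_apply, ← Function.iterate_add_apply]
    exact hb _ (by omega)
  have hsy : c (T^[i] y) % n = s := (hphase i hi).symm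
  rw [ha, ha]
  simp only [hsy, ← hs]
  rw [hback, hback, hδxy]

namespace Paper

section Combinatorics

variable {X : Type*}

theorem mem_dynJoin {f : X → X} {𝒰 : Finset (Set X)} {n : ℕ} {A : Set X} :
    A ∈ dynJoin f 𝒰 n ↔
      ∃ s : ℕ → Set X, (∀ i < n, s i ∈ 𝒰) ∧ A = {x | ∀ i < n, f^[i] x ∈ s i} := by
  classical
  induction n generalizing A with
  | zero => simp [dynJoin]
  | succ n ih =>
    simp only [dynJoin, Paper.join, pre, Finset.mem_image, Finset.mem_product, Prod.exists]
    constructor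
    · rintro ⟨P, R, ⟨hP, U, hU, rfl⟩, rfl⟩
      obtain ⟨s, hs, rfl⟩ := ih.1 hP
      refine ⟨fun i => if i < n then s i else U, fun i _ => ?_, ?_⟩
      · dsimp only
        split_ifs with h
        exacts [hs i h, hU]
      · ext x
        simp only [Set.mem_inter_iff, Set.mem_ofPred_eq, Set.mem_preimage]
        constructor
        · rintro ⟨h1, h2⟩ i hi
          split_ifs with h
          · exact h1 i h
          · rwa [show i = n by omega]
        · intro h
          refine ⟨fun i hi => ?_, ?_⟩
          · simpa [hi] using h i (by omega)
          · simpa using h n (by omega)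
    · rintro ⟨s, hs, rfl⟩
      refine ⟨{x | ∀ i < n, f^[i] x ∈ s i}, f^[n] ⁻¹' s n,
        ⟨ih.2 ⟨s, fun i hi => hs i (by omega), rfl⟩, s n, hs n (by omega), rfl⟩, ?_⟩
      ext x
      simp only [Set.mem_inter_iff, Set.mem_ofPred_eq, Set.mem_preimage, Nat.forall_lt_succ_right]

theorem IsCover.exists_mem {𝒰 : Finset (Set X)} (h : IsCover 𝒰) (x : X) : ∃ A ∈ 𝒰, x ∈ A := by
  have : x ∈ ⋃₀ (𝒰 : Set (Set X)) := by rw [h]; trivial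
  simpa using this

theorem isCover_of_exists_mem {𝒰 : Finset (Set X)} (h : ∀ x, ∃ A ∈ 𝒰, x ∈ A) : IsCover 𝒰 :=
  Set.eq_univ_of_forall fun x => by simpa using h x

theorem IsPartition.eq_of_mem {𝒰 : Finset (Set X)} (h : IsPartition 𝒰) {A B : Set X}
    (hA : A ∈ 𝒰) (hB : B ∈ 𝒰) {x : X} (hxA : x ∈ A) (hxB : x ∈ B) : A = B := by
  by_contra hne
  exact Set.disjoint_left.1 (h.2 A hA B hB hne) hxA hxB

theorem isCover_dynJoin {𝒰 : Finset (Set X)} (h : IsCover 𝒰) (f : X → X) (n : ℕ) :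
    IsCover (dynJoin f 𝒰 n) := by
  refine isCover_of_exists_mem fun x => ?_
  choose s hs hxs using fun i => h.exists_mem (f^[i] x)
  exact ⟨_, mem_dynJoin.2 ⟨s, fun i _ => hs i, rfl⟩, fun i _ => hxs i⟩

theorem isPartition_dynJoin {𝒰 : Finset (Set X)} (h : IsPartition 𝒰) (f : X → X) (n : ℕ) :
    IsPartition (dynJoin f 𝒰 n) := by
  refine ⟨isCover_dynJoin h.1 f n, fun A hA B hB hne => Set.disjoint_left.2 fun x hxA hxB => hne ?_⟩
  obtain ⟨s, hs, rfl⟩ := mem_dynJoin.1 hA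
  obtain ⟨t, ht, rfl⟩ := mem_dynJoin.1 hB
  have : ∀ i < n, s i = t i := fun i hi => h.eq_of_mem (hs i hi) (ht i hi) (hxA i hi) (hxB i hi)
  ext y
  exact forall₂_congr fun i hi => by rw [this i hi]

theorem hTop_nonneg (f : X → X) (𝒰 β : Finset (Set X)) : 0 ≤ hTop f 𝒰 β :=
  le_ciInf fun _ => div_nonneg (Real.log_natCast_nonneg _) (by positivity)

theorem ncard_le_of_hasCode {ι κ : Type*} {f : X → X} {a : X → ι} {b : X → κ} {n C : ℕ}
    (h : HasCode f a b Set.univ n C) {α β : Finset (Set X)} (hα : IsPartition α)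
    (hαa : ∀ A ∈ α, ∃ j, A = a ⁻¹' {j}) (hβb : ∀ B ∈ β, ∀ x ∈ B, ∀ y ∈ B, b x = b y)
    {B : Set X} (hB : B ∈ dynJoin f β n) :
    {A ∈ (dynJoin f α n : Set (Set X)) | (A ∩ B).Nonempty}.ncard ≤ C := by
  obtain ⟨code, hc⟩ := h
  have : ∀ A : {A ∈ (dynJoin f α n : Set (Set X)) | (A ∩ B).Nonempty}, (A.1 ∩ B).Nonempty :=
    fun A => A.2.2
  choose pt hpt using this
  rw [← Nat.card_coe_set_eq]
  refine (Nat.card_le_card_of_injective (fun A => code (pt A)) ?_).trans_eq (Nat.card_fin C)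
  intro A A' hAA'
  obtain ⟨t, ht, hBt⟩ := mem_dynJoin.1 hB
  have hb : ∀ i < n, b (f^[i] (pt A)) = b (f^[i] (pt A')) := by
    intro i hi
    have h1 := (hpt A).2
    have h2 := (hpt A').2
    rw [hBt] at h1 h2
    exact hβb _ (ht i hi) _ (h1 i hi) _ (h2 i hi)
  have key := hc _ trivial _ trivial hAA' hb
  obtain ⟨s, hs, hAs⟩ := mem_dynJoin.1 A.2.1
  have hmem : pt A' ∈ A.1 := by
    have h1 := (hpt A).1
    rw [hAs] at h1 ⊢
    intro i hi
    obtain ⟨j, hj⟩ := hαa _ (hs i hi)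
    have h2 := h1 i hi
    rw [hj] at h2 ⊢
    exact (key i hi).symm.trans h2
  exact Subtype.ext ((isPartition_dynJoin hα f n).eq_of_mem A.2.1 A'.2.1 hmem (hpt A').1)

theorem exists_covering_subfamily {𝒰 : Finset (Set X)} (h : IsCover 𝒰) (B : Set X) :
    ∃ 𝒱 ⊆ 𝒰, 𝒱.card = covNum 𝒰 B ∧ B ⊆ ⋃₀ (𝒱 : Set (Set X)) :=
  Nat.sInf_mem (s := {k : ℕ | ∃ 𝒱 ⊆ 𝒰, 𝒱.card = k ∧ B ⊆ ⋃₀ (𝒱 : Set (Set X))})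
    ⟨𝒰.card, 𝒰, subset_rfl, rfl, by rw [h]; exact Set.subset_univ _⟩

theorem covNumCond_pos [Nonempty X] {𝒰 β : Finset (Set X)} (h : IsCover 𝒰) (hβ : IsCover β) :
    0 < covNumCond 𝒰 β := by
  obtain ⟨x⟩ := ‹Nonempty X›
  obtain ⟨B, hB, hxB⟩ := hβ.exists_mem x
  refine lt_of_lt_of_le ?_ (Finset.le_sup (f := fun B => covNum 𝒰 B) hB)
  obtain ⟨𝒱, -, hc, hcov⟩ := exists_covering_subfamily h B
  obtain ⟨V, hV, -⟩ := hcov hxB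
  rw [← hc]
  exact Finset.card_pos.2 ⟨V, hV⟩

end Combinatorics

section Entropy

variable {X : Type*} [MeasurableSpace X]

theorem measF_dynJoin {𝒰 : Finset (Set X)} (h : MeasF 𝒰) {f : X → X} (hf : Measurable f) (n : ℕ) :
    MeasF (dynJoin f 𝒰 n) := by
  intro A hA
  obtain ⟨s, hs, rfl⟩ := mem_dynJoin.1 hA
  simp only [Set.ofPred_forall]
  exact MeasurableSet.iInter fun i => MeasurableSet.iInter fun hi =>
    (hf.iterate i) (h _ (hs i hi))

theorem sum_negMulLog_le_log_card {ι : Type*} (s : Finset ι) (p : ι → ℝ) (hp : ∀ i ∈ s, 0 ≤ p i)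
    (hsum : ∑ i ∈ s, p i = 1) : ∑ i ∈ s, negMulLog (p i) ≤ log s.card := by
  have hne : s.Nonempty := by
    rw [Finset.nonempty_iff_ne_empty]
    rintro rfl
    simp at hsum
  have hC : (0 : ℝ) < s.card := by exact_mod_cast hne.card_pos
  have key : ∀ i ∈ s, negMulLog (p i) ≤ p i * log s.card + ((s.card : ℝ)⁻¹ - p i) := by
    intro i hi
    rcases (hp i hi).eq_or_lt with h | h
    · rw [← h]; simp
    · have h1 := Real.log_le_sub_one_of_pos (x := (p i * s.card)⁻¹) (by positivity)
      rw [Real.log_inv, Real.log_mul h.ne' hC.ne'] at h1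
      have h2 := mul_le_mul_of_nonneg_left h1 h.le
      have h3 : p i * ((p i * (s.card : ℝ))⁻¹ - 1) = (s.card : ℝ)⁻¹ - p i := by
        field_simp
      rw [negMulLog]
      linarith
  refine (Finset.sum_le_sum key).trans ?_
  rw [Finset.sum_add_distrib, ← Finset.sum_mul, Finset.sum_sub_distrib, hsum, Finset.sum_const,
    nsmul_eq_mul, mul_inv_cancel₀ hC.ne']
  simp

theorem sum_measure_toReal {α : Finset (Set X)} (hα : IsPartition α) (hαm : MeasF α)
    (μ : Measure X) [IsProbabilityMeasure μ] : ∑ A ∈ α, (μ A).toReal = 1 := by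
  have hsum := measure_biUnion_finset (μ := μ) (f := id)
    (fun A hA B hB h => hα.2 A hA B hB h) hαm
  simp only [id] at hsum
  rw [← ENNReal.toReal_sum fun A _ => measure_ne_top μ A, ← hsum]
  have : ⋃ A ∈ α, A = (Set.univ : Set X) := by
    rw [← hα.1, Set.sUnion_eq_biUnion]; simp
  rw [this]
  simp

theorem entPart_nonneg (μ : Measure X) [IsZeroOrProbabilityMeasure μ] (α : Finset (Set X)) :
    0 ≤ entPart μ α :=
  Finset.sum_nonneg fun _ _ => negMulLog_nonneg ENNReal.toReal_nonneg
    (ENNReal.toReal_le_of_le_ofReal zero_le_one (by simpa using prob_le_one))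

theorem entCondPart_nonneg (μ : Measure X) [IsProbabilityMeasure μ] (α β : Finset (Set X)) :
    0 ≤ entCondPart μ α β :=
  Finset.sum_nonneg fun _ _ => mul_nonneg ENNReal.toReal_nonneg (entPart_nonneg _ _)

theorem entCondPart_le_log {α β : Finset (Set X)} (hα : IsPartition α) (hαm : MeasF α)
    (hβ : IsPartition β) (hβm : MeasF β) (μ : Measure X) [IsProbabilityMeasure μ] {C : ℕ}
    (hC : ∀ B ∈ β, {A ∈ (α : Set (Set X)) | (A ∩ B).Nonempty}.ncard ≤ C) :
    entCondPart μ α β ≤ log C := by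
  classical
  have key : ∀ B ∈ β, (μ B).toReal * entPart (ProbabilityTheory.cond μ B) α ≤
      (μ B).toReal * log C := by
    intro B hB
    by_cases h0 : μ B = 0
    · simp [h0]
    refine mul_le_mul_of_nonneg_left ?_ ENNReal.toReal_nonneg
    have := ProbabilityTheory.cond_isProbabilityMeasure h0
    set ν := ProbabilityTheory.cond μ B
    set s := α.filter fun A => (A ∩ B).Nonempty with hs
    have hzero : ∀ A ∈ α, A ∉ s → ν A = 0 := by
      intro A hA hAs
      have : B ∩ A = ∅ := by
        rw [Set.inter_comm, ← Set.not_nonempty_iff_eq_empty]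
        exact fun h => hAs (Finset.mem_filter.2 ⟨hA, h⟩)
      rw [ProbabilityTheory.cond_apply (hβm B hB), this]
      simp
    have h1 : entPart ν α = ∑ A ∈ s, negMulLog (ν A).toReal :=
      (Finset.sum_subset (Finset.filter_subset _ _) fun A hA hAs => by
        rw [hzero A hA hAs]; simp).symm
    have h2 : ∑ A ∈ s, (ν A).toReal = 1 := by
      rw [← sum_measure_toReal hα hαm ν]
      exact Finset.sum_subset (Finset.filter_subset _ _) fun A hA hAs => by
        rw [hzero A hA hAs]; simp
    rw [h1]
    refine (sum_negMulLog_le_log_card s _ (fun _ _ => ENNReal.toReal_nonneg) h2).trans ?_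
    have hne : s.Nonempty := by
      rw [Finset.nonempty_iff_ne_empty]
      intro h
      simp [h] at h2
    refine Real.log_le_log (by exact_mod_cast hne.card_pos) ?_
    have h3 := hC B hB
    rw [show {A ∈ (α : Set (Set X)) | (A ∩ B).Nonempty} = (s : Set (Set X)) by
      ext A; simp [hs], Set.ncard_coe_finset] at h3
    exact_mod_cast h3
  refine (Finset.sum_le_sum key).trans ?_
  rw [← Finset.sum_mul, sum_measure_toReal hβ hβm μ, one_mul]

theorem hPart_le {f : X → X} (μ : Measure X) [IsProbabilityMeasure μ] (α β : Finset (Set X))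
    {n : ℕ} (hn : 0 < n) :
    hPart f μ α β ≤ entCondPart μ (dynJoin f α n) (dynJoin f β n) / n := by
  obtain ⟨n, rfl⟩ := Nat.exists_eq_succ_of_ne_zero hn.ne'
  have hbdd : BddBelow (Set.range fun N : ℕ =>
      entCondPart μ (dynJoin f α (N + 1)) (dynJoin f β (N + 1)) / (N + 1 : ℝ)) := by
    refine ⟨0, ?_⟩
    rintro _ ⟨N, rfl⟩
    exact div_nonneg (entCondPart_nonneg _ _ _) (by positivity)
  have := ciInf_le hbdd n
  rw [Nat.cast_succ]
  exact this

theorem hPart_nonneg (f : X → X) (μ : Measure X) [IsProbabilityMeasure μ]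
    (α β : Finset (Set X)) : 0 ≤ hPart f μ α β :=
  le_ciInf fun _ => div_nonneg (entCondPart_nonneg _ _ _) (by positivity)

/-- A measurable choice of `𝒰`-names of length `n` taking at most `N(𝒰_0^{n-1}|β_0^{n-1})` values
on each element of `β_0^{n-1}`. -/
theorem exists_block_code [Nonempty X] {f : X → X} (hf : Measurable f) {𝒰 β : Finset (Set X)}
    (h𝒰 : IsCover 𝒰) (h𝒰m : MeasF 𝒰) (hβ : IsCover β) {r s : ℕ} {U : Fin r → Set X}
    (hU : ∀ A, A ∈ 𝒰 ↔ ∃ i, U i = A) {W : Fin s → Set X} (hW : ∀ j, W j ∈ β) {b : X → Fin s}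
    (hb : ∀ x, x ∈ W (b x)) (hbm : Measurable b) (n : ℕ) :
    ∃ (δ : X → Fin n → Fin r) (e : X → Fin (covNumCond (dynJoin f 𝒰 n) (dynJoin f β n))),
      Measurable δ ∧ (∀ x y, (∀ i < n, b (f^[i] x) = b (f^[i] y)) → e x = e y → δ x = δ y) ∧
      ∀ x i, f^[i] x ∈ U (δ x i) := by
  classical
  have hr : Nonempty (Fin r) := by
    obtain ⟨x⟩ := ‹Nonempty X›
    obtain ⟨A, hA, -⟩ := h𝒰.exists_mem x
    exact ⟨((hU A).1 hA).choose⟩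
  set K := covNumCond (dynJoin f 𝒰 n) (dynJoin f β n)
  let Bset : (Fin n → Fin s) → Set X := fun w => {x | ∀ i : Fin n, f^[i] x ∈ W (w i)}
  have hBset : ∀ w, Bset w ∈ dynJoin f β n := by
    intro w
    obtain ⟨B₀, hB₀, -⟩ := hβ.exists_mem (Classical.arbitrary X)
    refine mem_dynJoin.2 ⟨fun i => if h : i < n then W (w ⟨i, h⟩) else B₀, fun i hi => ?_, ?_⟩
    · simp [hi, hW]
    · ext x
      refine ⟨fun h i hi => by simpa [hi] using h ⟨i, hi⟩, fun h i => ?_⟩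
      simpa using h i i.2
  have hword : ∀ A, ∃ v : Fin n → Fin r, A ∈ dynJoin f 𝒰 n →
      ∀ x ∈ A, ∀ i : Fin n, f^[i] x ∈ U (v i) := by
    intro A
    by_cases hA : A ∈ dynJoin f 𝒰 n
    · obtain ⟨t, ht, rfl⟩ := mem_dynJoin.1 hA
      choose v hv using fun i : Fin n => (hU _).1 (ht i i.2)
      exact ⟨v, fun _ x hx i => by rw [hv]; exact hx i i.2⟩
    · exact ⟨Classical.arbitrary _, fun h => absurd h hA⟩
  choose word hword using hword
  have hg : ∀ w, ∃ g : Fin K → Fin n → Fin r, ∀ x ∈ Bset w, ∃ k, ∀ i, f^[i] x ∈ U (g k i) := by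
    intro w
    obtain ⟨𝒱, h𝒱, hcard, hcov⟩ := exists_covering_subfamily (isCover_dynJoin h𝒰 f n) (Bset w)
    have hle : 𝒱.card ≤ K := hcard ▸ Finset.le_sup (f := covNum (dynJoin f 𝒰 n)) (hBset w)
    refine ⟨fun k => if h : (k : ℕ) < 𝒱.card then word (𝒱.equivFin.symm ⟨k, h⟩).1
      else Classical.arbitrary _, fun x hx => ?_⟩
    obtain ⟨V, hV, hxV⟩ := hcov hx
    have hlt := (𝒱.equivFin ⟨V, hV⟩).2
    refine ⟨⟨𝒱.equivFin ⟨V, hV⟩, hlt.trans_le hle⟩, fun i => ?_⟩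
    simp only [hlt, dif_pos, Fin.eta, Equiv.symm_apply_apply]
    exact hword V (h𝒱 hV) x hxV i
  choose g hg using hg
  let bn : X → Fin n → Fin s := fun x i => b (f^[i] x)
  have hbn : Measurable bn := measurable_pi_lambda _ fun i => hbm.comp (hf.iterate i)
  have hp : ∀ x, ∃ k : ℕ, ∃ h : k < K, ∀ i, f^[i] x ∈ U (g (bn x) ⟨k, h⟩ i) := fun x => by
    obtain ⟨k, hk⟩ := hg (bn x) x fun i => hb _
    exact ⟨k, k.2, hk⟩
  have hfind := measurable_find hp fun k => by
    by_cases hk : k < K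
    · have : {x | ∃ h : k < K, ∀ i, f^[i] x ∈ U (g (bn x) ⟨k, h⟩ i)} =
          ⋃ w, (bn ⁻¹' {w} ∩ ⋂ i : Fin n, f^[i] ⁻¹' U (g w ⟨k, hk⟩ i)) := by
        ext x
        simp [hk]
      rw [this]
      exact MeasurableSet.iUnion fun w => (hbn (measurableSet_singleton w)).inter
        (MeasurableSet.iInter fun i => (hf.iterate i) (h𝒰m _ ((hU _).2 ⟨_, rfl⟩)))
    · simp [hk]
  let e : X → Fin K := fun x => ⟨Nat.find (hp x), (Nat.find_spec (hp x)).1⟩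
  have he : Measurable e := measurable_to_countable' fun k => by
    have : e ⁻¹' {k} = (fun x => Nat.find (hp x)) ⁻¹' {(k : ℕ)} := by
      ext x
      simp only [Set.mem_preimage, Set.mem_singleton_iff, Fin.ext_iff, e]
    rw [this]
    exact hfind (measurableSet_singleton _)
  refine ⟨fun x => g (bn x) (e x), e, ?_, fun x y hxy hexy => ?_,
    fun x i => (Nat.find_spec (hp x)).2 i⟩
  · exact (measurable_of_countable fun p : (Fin n → Fin s) × Fin K => g p.1 p.2).comp
      (hbn.prodMk he)
  · have : bn x = bn y := funext fun i => hxy i i.2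
    simp only [this, hexy]

end Entropy

theorem exists_mul_le_div {c : ℝ} {N : ℕ} (hN : 0 < N) {ε : ℝ} (hε : 0 < ε) :
    ∃ m : ℕ, 0 < m ∧ c ≤ ε * (N * m) := by
  obtain ⟨m, hm⟩ := exists_nat_gt (c / (ε * N))
  have hN' : (0 : ℝ) < N := by exact_mod_cast hN
  refine ⟨m + 1, by omega, ?_⟩
  rw [div_lt_iff₀ (by positivity)] at hm
  push_cast
  nlinarith [mul_pos hε hN']

theorem exists_log_window_le {n K I : ℕ} (hn : 0 < n) (hK : 0 < K) (hI : 0 < I) {ε : ℝ}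
    (hε : 0 < ε) :
    ∃ q : ℕ, 0 < q ∧ log ((n * ((n * q + 1) * (I ^ n * (I ^ n * (K * K ^ q)))) : ℕ) : ℝ) ≤
      (log K / n + ε) * ((n * q : ℕ) : ℝ) := by
  have hn' : (0 : ℝ) < n := by exact_mod_cast hn
  have hK' : (0 : ℝ) < K := by exact_mod_cast hK
  have hI' : (0 : ℝ) < I := by exact_mod_cast hI
  set c : ℝ := log n + 2 * n * log I + log K
  have hlim : Tendsto (fun q : ℕ => ((n * q + 1 : ℕ) : ℝ)) atTop atTop := by
    refine tendsto_natCast_atTop_atTop.comp (tendsto_atTop_mono (fun q => ?_) tendsto_id)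
    exact (Nat.le_mul_of_pos_left q hn).trans (Nat.le_succ _)
  have h1 := (Real.isLittleO_log_id_atTop.bound (half_pos hε)).filter_mono hlim
  have h2 : ∀ᶠ q : ℕ in atTop, c + ε / 2 ≤ ε / 2 * (n * q) := by
    have : Tendsto (fun q : ℕ => ε / 2 * (n * (q : ℝ))) atTop atTop :=
      (tendsto_natCast_atTop_atTop.const_mul_atTop hn').const_mul_atTop (half_pos hε)
    exact this.eventually_ge_atTop _
  obtain ⟨q, hq1, hq2, hq⟩ := ((eventually_map.1 h1).and (h2.and (eventually_gt_atTop 0))).exists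
  refine ⟨q, hq, ?_⟩
  have hlog : log ((n * q + 1 : ℕ) : ℝ) ≤ ε / 2 * (n * q + 1) := by
    refine (le_abs_self _).trans (hq1.trans_eq ?_)
    rw [id, Real.norm_of_nonneg (by positivity)]
    push_cast
    ring
  have hexp : log ((n * ((n * q + 1) * (I ^ n * (I ^ n * (K * K ^ q)))) : ℕ) : ℝ) =
      log n + (log ((n * q + 1 : ℕ) : ℝ) + (n * log I + (n * log I + (log K + q * log K)))) := by
    have : ((n * q + 1 : ℕ) : ℝ) ≠ 0 := by positivity
    rw [Nat.cast_mul, Nat.cast_mul (n * q + 1)]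
    push_cast at this ⊢
    rw [log_mul (by positivity) (by positivity), log_mul this (by positivity),
      log_mul (by positivity) (by positivity), log_mul (by positivity) (by positivity),
      log_mul (by positivity) (by positivity), log_pow, log_pow]
  have hmul : (log K / n + ε) * ((n * q : ℕ) : ℝ) = q * log K + ε * (n * q) := by
    push_cast
    field_simp
  rw [hexp, hmul]
  simp only [c] at hq2
  linarith

theorem exists_log_le {n K I : ℕ} (hn : 0 < n) (hK : 0 < K) (hI : 0 < I) {ε : ℝ} (hε : 0 < ε) :
    ∃ q m : ℕ, 0 < q ∧ 0 < m ∧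
      log (((n * ((n * q + 1) * (I ^ n * (I ^ n * (K * K ^ q))))) ^ m +
        n * q * I ^ (n * q) : ℕ) : ℝ) / ((n * q * m : ℕ) : ℝ) ≤ log K / n + ε := by
  obtain ⟨q, hq, h⟩ := exists_log_window_le hn hK hI (half_pos hε)
  set C := n * ((n * q + 1) * (I ^ n * (I ^ n * (K * K ^ q)))) with hCdef
  have hC : 0 < C := by positivity
  set D := n * q * I ^ (n * q)
  have hN : 0 < n * q := Nat.mul_pos hn hq
  obtain ⟨m, hm, hm'⟩ := exists_mul_le_div (c := log ((1 + D : ℕ) : ℝ)) hN (half_pos hε)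
  refine ⟨q, m, hq, hm, ?_⟩
  have hNm : (0 : ℝ) < ((n * q * m : ℕ) : ℝ) := by exact_mod_cast Nat.mul_pos hN hm
  rw [div_le_iff₀ hNm]
  have h1 : C ^ m + D ≤ C ^ m * (1 + D) := by
    have := Nat.one_le_pow m C hC
    nlinarith [Nat.zero_le D]
  have h2 : log ((C ^ m + D : ℕ) : ℝ) ≤ m * log C + log ((1 + D : ℕ) : ℝ) := by
    have hC' : (0 : ℝ) < C := by exact_mod_cast hC
    have hD : (0 : ℝ) < ((1 + D : ℕ) : ℝ) := by positivity
    calc log ((C ^ m + D : ℕ) : ℝ) ≤ log ((C ^ m * (1 + D) : ℕ) : ℝ) :=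
          Real.log_le_log (by exact_mod_cast Nat.add_pos_left (pow_pos hC m) D)
            (by exact_mod_cast h1)
      _ = m * log C + log ((1 + D : ℕ) : ℝ) := by
          rw [Nat.cast_mul, log_mul (by positivity) hD.ne', Nat.cast_pow, log_pow]
  have h3 := mul_le_mul_of_nonneg_left h (Nat.cast_nonneg (α := ℝ) m)
  rw [Nat.cast_mul (n * q) m]
  nlinarith

/-- Every cover is refined by a Borel partition whose names are, relative to `β`, essentially no
more numerous than those of the cover. -/
theorem exists_partition_hPart_le {X : Type*} [TopologicalSpace X] [T2Space X]
    [SecondCountableTopology X] [MeasurableSpace X] [BorelSpace X] [Nonempty X] (T : X ≃ₜ X)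
    {𝒰 β : Finset (Set X)} (h𝒰 : IsCover 𝒰) (h𝒰m : MeasF 𝒰)
    (hβ : IsPartition β) (hβm : MeasF β) {ε : ℝ} (hε : 0 < ε) :
    ∃ α : Finset (Set X), IsPartition α ∧ MeasF α ∧ Refines α 𝒰 ∧
      ∀ μ : Measure X, IsProbabilityMeasure μ → hPart T μ α β ≤ hTop T 𝒰 β + ε := by
  classical
  obtain ⟨n₀, hn₀⟩ := exists_lt_of_ciInf_lt (lt_add_of_pos_right (hTop T 𝒰 β) (half_pos hε))
  obtain ⟨n, hn, hnlog⟩ : ∃ n : ℕ, 0 < n ∧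
      log (covNumCond (dynJoin T 𝒰 n) (dynJoin T β n)) / n < hTop T 𝒰 β + ε / 2 :=
    ⟨n₀ + 1, n₀.succ_pos, by rw [Nat.cast_succ]; exact hn₀⟩
  have hK : 0 < covNumCond (dynJoin T 𝒰 n) (dynJoin T β n) :=
    covNumCond_pos (isCover_dynJoin h𝒰 T n) (isCover_dynJoin hβ.1 T n)
  have hTm : Measurable T := T.continuous.measurable
  have hTsm : Measurable T.symm := T.symm.continuous.measurable
  let U : Fin 𝒰.card → Set X := fun i => (𝒰.equivFin.symm i).1
  have hU : ∀ A, A ∈ 𝒰 ↔ ∃ i, U i = A := fun A =>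
    ⟨fun h => ⟨𝒰.equivFin ⟨A, h⟩, by simp [U]⟩, fun ⟨i, hi⟩ => hi ▸ (𝒰.equivFin.symm i).2⟩
  let W : Fin β.card → Set X := fun i => (β.equivFin.symm i).1
  have hW : ∀ i, W i ∈ β := fun i => (β.equivFin.symm i).2
  have hexb : ∀ x, ∃ i, x ∈ W i := fun x => by
    obtain ⟨B, hB, hx⟩ := hβ.1.exists_mem x
    exact ⟨β.equivFin ⟨B, hB⟩, by simpa [W] using hx⟩
  choose b hb using hexb
  have hWinj : ∀ i j x, x ∈ W i → x ∈ W j → i = j := fun i j x hi hj =>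
    β.equivFin.symm.injective (Subtype.ext (hβ.eq_of_mem (hW i) (hW j) hi hj))
  have hbm : Measurable b := measurable_to_countable' fun i => by
    have : b ⁻¹' {i} = W i := by
      ext x
      exact ⟨fun h => (show b x = i from h) ▸ hb x, fun h => hWinj _ _ x (hb x) h⟩
    rw [this]
    exact hβm _ (hW i)
  have hI : 0 < 𝒰.card := by
    obtain ⟨A, hA, -⟩ := h𝒰.exists_mem (Classical.arbitrary X)
    exact Finset.card_pos.2 ⟨A, hA⟩
  obtain ⟨δ, e, hδm, hδ, hδU⟩ := exists_block_code hTm h𝒰 h𝒰m hβ.1 hU hW hb hbm n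
  obtain ⟨q, m, hq, hm, hqm⟩ := exists_log_le hn hK hI (half_pos hε)
  have hN : 0 < n * q := Nat.mul_pos hn hq
  obtain ⟨F, hFm, hF, hFQ⟩ := exists_marker T (n * q)
  obtain ⟨c, hcm, hc⟩ := exists_lastVisit hTsm hFm
  set Q : Set X := {x | ∀ i, 0 < i → i < n * q → T^[i] x ≠ x} with hQdef
  have hQ : ∀ x ∈ Q, ∀ i, T^[i] x ∈ Q := by
    intro x hx i k hk hkN h
    refine hx k hk hkN ((T.injective.iterate i) ?_)
    rwa [← Function.iterate_add_apply, add_comm, Function.iterate_add_apply]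
  have hc0 : ∀ x ∈ F, c x = 0 := by
    intro x hx
    by_contra h
    exact (hc x ⟨0, hx⟩).2 0 (Nat.pos_of_ne_zero h) hx
  have hcs : ∀ x ∈ Q, T x ∉ F → c (T x) = c x + 1 := by
    intro x hx hTx
    have hsymm : ∀ k, T.symm^[k + 1] (T x) = T.symm^[k] x := fun k => by
      rw [Function.iterate_succ_apply, T.symm_apply_apply]
    have h1 := hc x (hFQ x hx)
    have h2 := hc (T x) (hFQ _ (hQ x hx 1))
    have h3 : c (T x) ≠ 0 := fun h => hTx (by simpa [h] using h2.1)
    obtain ⟨k, hk⟩ := Nat.exists_eq_succ_of_ne_zero h3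
    rw [hk, Nat.succ_eq_add_one] at h2 ⊢
    rw [hsymm] at h2
    rcases lt_trichotomy k (c x) with h | h | h
    · exact absurd h2.1 (h1.2 k h)
    · rw [h]
    · exact absurd (by rw [hsymm]; exact h1.1) (h2.2 (c x + 1) (by omega))
  let a : X → Fin 𝒰.card := fun x => δ (T.symm^[c x % n] x) ⟨c x % n, Nat.mod_lt _ hn⟩
  have haU : ∀ x, x ∈ U (a x) := by
    intro x
    have h := hδU (T.symm^[c x % n] x) ⟨c x % n, Nat.mod_lt _ hn⟩
    have h2 : T^[c x % n] (T.symm^[c x % n] x) = x :=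
      (Function.LeftInverse.iterate (g := T) (f := T.symm) T.apply_symm_apply _) x
    simp only [h2] at h
    exact h
  have ham : Measurable a := measurable_to_countable' fun j => by
    have : a ⁻¹' {j} = ⋃ s : Fin n, ((fun x => c x % n) ⁻¹' {(s : ℕ)} ∩
        (fun x => δ (T.symm^[s] x) s) ⁻¹' {j}) := by
      ext x
      simp only [Set.mem_preimage, Set.mem_singleton_iff, Set.mem_iUnion, Set.mem_inter_iff, a]
      constructor
      · exact fun h => ⟨⟨c x % n, Nat.mod_lt _ hn⟩, rfl, h⟩
      · rintro ⟨⟨s, hs⟩, h1, h2⟩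
        simp only at h1
        subst h1
        exact h2
    rw [this]
    refine MeasurableSet.iUnion fun s => MeasurableSet.inter ?_ ?_
    · exact ((measurable_of_countable fun k : ℕ => k % n).comp hcm) (measurableSet_singleton _)
    · exact ((measurable_pi_apply s).comp (hδm.comp (hTsm.iterate s))) (measurableSet_singleton _)
  have hcode : HasCode T a b Set.univ (n * q * m) _ :=
    ((hasCode_window (T := T.toEquiv) hn hq hδ hF hQ hc0 hcs fun _ => rfl).mul hN hQ m).union
      (hasCode_periodic T a b hN (n * q * m))
  rw [Fintype.card_fin] at hcode
  let α : Finset (Set X) := Finset.univ.image fun j => a ⁻¹' {j}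
  have hαa : ∀ A ∈ α, ∃ j, A = a ⁻¹' {j} := fun A hA => by
    obtain ⟨j, -, rfl⟩ := Finset.mem_image.1 hA
    exact ⟨j, rfl⟩
  have hα : IsPartition α := by
    refine ⟨isCover_of_exists_mem fun x =>
      ⟨a ⁻¹' {a x}, Finset.mem_image_of_mem _ (Finset.mem_univ _), rfl⟩, ?_⟩
    intro A hA B hB hne
    obtain ⟨i, rfl⟩ := hαa A hA
    obtain ⟨j, rfl⟩ := hαa B hB
    refine Set.disjoint_left.2 fun x hi hj => hne ?_
    rw [show i = j from (show a x = i from hi).symm.trans hj]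
  have hαm : MeasF α := fun A hA => by
    obtain ⟨j, rfl⟩ := hαa A hA
    exact ham (measurableSet_singleton j)
  refine ⟨α, hα, hαm, fun A hA => ?_, fun μ _ => ?_⟩
  · obtain ⟨j, rfl⟩ := hαa A hA
    exact ⟨U j, (hU _).2 ⟨j, rfl⟩, fun x hx => (show a x = j from hx) ▸ haU x⟩
  have hβb : ∀ B ∈ β, ∀ x ∈ B, ∀ y ∈ B, b x = b y := by
    intro B hB x hx y hy
    have h := hβ.eq_of_mem (hW (b x)) hB (hb x) hx
    exact hWinj _ _ y (by rw [h]; exact hy) (hb y)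
  calc hPart T μ α β ≤ _ := hPart_le μ α β (Nat.mul_pos hN hm)
    _ ≤ _ := div_le_div_of_nonneg_right
        (entCondPart_le_log (isPartition_dynJoin hα T _) (measF_dynJoin hαm hTm _)
          (isPartition_dynJoin hβ T _) (measF_dynJoin hβm hTm _) μ
          fun B hB => ncard_le_of_hasCode hcode hα hαa hβb hB) (Nat.cast_nonneg _)
    _ ≤ _ := hqm
    _ ≤ hTop T 𝒰 β + ε := by linarith

end Paper

/-- For every TDS `(X,T)`, cover `𝒰` (not necessarily open) and partition
`β`: `inf_{α ≽ 𝒰} sup_{μ ∈ M_T(X)} h_μ(α|β,T) ≤ h(𝒰|β,T)`, the infimum running over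
finite Borel partitions `α` finer than `𝒰`. -/
theorem statement16 {X : Type*} [MetricSpace X] [CompactSpace X]
    [MeasurableSpace X] [BorelSpace X] (T : X ≃ₜ X)
    (𝒰 β : Finset (Set X)) (h𝒰 : IsCover 𝒰) (h𝒰m : MeasF 𝒰)
    (hβ : IsPartition β) (hβm : MeasF β) :
    sInf {h : ℝ | ∃ α : Finset (Set X), IsPartition α ∧ MeasF α ∧ Refines α 𝒰 ∧
        h = sSup {g : ℝ | ∃ μ : MeasureTheory.Measure X,
          MeasureTheory.IsProbabilityMeasure μ ∧
          MeasureTheory.MeasurePreserving (⇑T) μ μ ∧ g = hPart (⇑T) μ α β}} ≤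
      hTop (⇑T) 𝒰 β := by
  have hnn : ∀ α : Finset (Set X), 0 ≤ sSup {g : ℝ | ∃ μ : MeasureTheory.Measure X,
      MeasureTheory.IsProbabilityMeasure μ ∧
      MeasureTheory.MeasurePreserving (⇑T) μ μ ∧ g = hPart (⇑T) μ α β} := by
    intro α
    refine Real.sSup_nonneg ?_
    rintro _ ⟨μ, hμ, -, rfl⟩
    exact hPart_nonneg _ _ _ _
  refine le_of_forall_pos_le_add fun ε hε => ?_
  have hbdd : BddBelow {h : ℝ | ∃ α : Finset (Set X), IsPartition α ∧ MeasF α ∧ Refines α 𝒰 ∧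
      h = sSup {g : ℝ | ∃ μ : MeasureTheory.Measure X, MeasureTheory.IsProbabilityMeasure μ ∧
        MeasureTheory.MeasurePreserving (⇑T) μ μ ∧ g = hPart (⇑T) μ α β}} := by
    refine ⟨0, ?_⟩
    rintro _ ⟨α, -, -, -, rfl⟩
    exact hnn α
  have hex : ∃ α : Finset (Set X), IsPartition α ∧ MeasF α ∧ Refines α 𝒰 ∧
      ∀ μ : Measure X, IsProbabilityMeasure μ → hPart T μ α β ≤ hTop T 𝒰 β + ε := by
    rcases isEmpty_or_nonempty X with hX | hX
    · refine ⟨∅, ⟨isCover_of_exists_mem fun x => hX.elim x, by simp⟩, by simp [MeasF],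
        by simp [Refines], fun μ hμ => ?_⟩
      obtain ⟨x⟩ := μ.nonempty_of_neZero
      exact hX.elim x
    · exact exists_partition_hPart_le T h𝒰 h𝒰m hβ hβm hε
  obtain ⟨α, hα, hαm, hα𝒰, hle⟩ := hex
  refine (csInf_le hbdd ⟨α, hα, hαm, hα𝒰, rfl⟩).trans (Real.sSup_le ?_ ?_)
  · rintro _ ⟨μ, hμ, -, rfl⟩
    exact hle μ hμ
  · exact add_nonneg (hTop_nonneg _ _ _) hε.le
end
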